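/- For all integers g ≥ 0 and d ≥ 3, every (g,d)-map graph is contained in H ⊠ P ⊠ K_ℓ for some planar graph H with treewidth at most 3 and for some path P, where ℓ = max{2g⌊d/2⌋, d + 3⌊d/2⌋ − 3}. -/

import Mathlib

/-!
Common definitions: multigraphs, combinatorial (cellular) surface embeddings,
Euler genus, framed graphs, strong products, treewidth, partitions and layerings.
-/

/-- A multigraph on vertex type `V` with edge type `E`, given by its endpoints map. -/
structure Multigraph (V E : Type) where
  ends : E → Sym2 V

namespace Multigraph

variable {V E F : Type}

/-- The simple graph underlying a multigraph. -/
def simple (G : Multigraph V E) : SimpleGraph V where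
  Adj u v := u ≠ v ∧ ∃ e, G.ends e = s(u, v)
  symm := by
    constructor
    rintro u v ⟨hne, e, he⟩
    exact ⟨hne.symm, e, he.trans Sym2.eq_swap⟩
  loopless := by constructor; rintro u ⟨hne, -⟩; exact hne rfl

/-- The simple graph on `V` whose edges are the edges of `G` lying in `S`. -/
def simpleOn (G : Multigraph V E) (S : Set E) : SimpleGraph V where
  Adj u v := u ≠ v ∧ ∃ e ∈ S, G.ends e = s(u, v)
  symm := by
    constructor
    rintro u v ⟨hne, e, heS, he⟩
    exact ⟨hne.symm, e, heS, he.trans Sym2.eq_swap⟩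
  loopless := by constructor; rintro u ⟨hne, -⟩; exact hne rfl

/-- A multigraph is simple: no loops and no parallel edges. -/
def IsSimple (G : Multigraph V E) : Prop :=
  (∀ e, ¬ (G.ends e).IsDiag) ∧ Function.Injective G.ends

/-- A set `S` of edges of `G` forms a spanning tree of `G`. -/
def IsSpanningTree (G : Multigraph V E) (S : Set E) : Prop :=
  (G.simpleOn S).IsTree ∧ (∀ e ∈ S, ¬ (G.ends e).IsDiag) ∧
    ∀ e ∈ S, ∀ e' ∈ S, G.ends e = G.ends e' → e = e'

/-- A closed walk in a multigraph, recorded as periodic sequences of vertices and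
edges: the walk visits `vtx 0, vtx 1, …, vtx (len - 1)` and returns to
`vtx len = vtx 0`, traversing the edge `edge i` between `vtx i` and `vtx (i+1)`. -/
structure CWalk (G : Multigraph V E) where
  len : ℕ
  len_pos : 0 < len
  vtx : ℕ → V
  edge : ℕ → E
  vtx_per : ∀ i, vtx (i + len) = vtx i
  edge_per : ∀ i, edge (i + len) = edge i
  compat : ∀ i, G.ends (edge i) = s(vtx i, vtx (i + 1))

namespace CWalk

variable {G : Multigraph V E}

/-- The vertex `v` lies on the closed walk `W`. -/
def HasVtx (W : G.CWalk) (v : V) : Prop := ∃ i, i < W.len ∧ W.vtx i = v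

/-- The edge `e` lies on the closed walk `W`. -/
def HasEdge (W : G.CWalk) (e : E) : Prop := ∃ i, i < W.len ∧ W.edge i = e

/-- The closed walk `W` is a cycle: it repeats no vertex and no edge. -/
def IsCycle (W : G.CWalk) : Prop :=
  (∀ i j, i < W.len → j < W.len → W.vtx i = W.vtx j → i = j) ∧
  (∀ i j, i < W.len → j < W.len → W.edge i = W.edge j → i = j)

end CWalk

/-- `p = (f, i)` is an occurrence of the edge `e` in the family `bd` of closed walks:
the walk of face `f` traverses `e` at position `i`. -/
def IsOcc {G : Multigraph V E} (bd : F → G.CWalk) (e : E) (p : F × ℕ) : Prop :=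
  p.2 < (bd p.1).len ∧ (bd p.1).edge p.2 = e

/-- `c = (f, i)` is a corner of the vertex `v`: the walk of face `f` visits `v`
at position `i`. -/
def IsCorner {G : Multigraph V E} (bd : F → G.CWalk) (v : V) (c : F × ℕ) : Prop :=
  c.2 < (bd c.1).len ∧ (bd c.1).vtx c.2 = v

/-- The corner `c` is one of the two end corners of the edge occurrence `p`. -/
def EndOf {G : Multigraph V E} (bd : F → G.CWalk) (c p : F × ℕ) : Prop :=
  c.1 = p.1 ∧ (c.2 = p.2 ∨ c.2 = (p.2 + 1) % (bd p.1).len)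

/-- Two corners of `v` are linked if they are end corners (at `v`) of the two
distinct occurrences of a common edge; this is the edge-to-edge gluing relation
around the vertex `v`. -/
def CornerLinked {G : Multigraph V E} (bd : F → G.CWalk) (v : V) (c c' : F × ℕ) : Prop :=
  IsCorner bd v c ∧ IsCorner bd v c' ∧
    ∃ (e : E) (p p' : F × ℕ), p ≠ p' ∧ IsOcc bd e p ∧ IsOcc bd e p' ∧
      EndOf bd c p ∧ EndOf bd c' p'

/-- A combinatorial (cellular) embedding of a connected multigraph `G` in a closed
surface, with face set `F`: every face is given by its closed boundary walk, every
edge of `G` is traversed exactly twice in total by the boundary walks, and the link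
of every vertex is connected (so the embedding is in a genuine surface, with no
pinch points). -/
structure Embedding (G : Multigraph V E) (F : Type) where
  boundary : F → G.CWalk
  conn : G.simple.Connected
  edge_twice : ∀ e : E, {p : F × ℕ | IsOcc boundary e p}.ncard = 2
  link_conn : ∀ (v : V) (c c' : F × ℕ), IsCorner boundary v c → IsCorner boundary v c' →
    Relation.EqvGen (CornerLinked boundary v) c c'

/-- The Euler genus `2 - (|V| - |E| + |F|)` of an embedding, via Euler's formula. -/
noncomputable def Embedding.eulerGenus {G : Multigraph V E} {F : Type}
    (_ : Embedding G F) : ℤ :=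
  2 - ((Nat.card V : ℤ) - Nat.card E + Nat.card F)

/-- The simple graph underlying the framed multigraph `G^{(d)}`: two distinct
vertices are adjacent iff they are joined by an edge of `G` or lie on a common
face of length at most `d` (in which case `G^{(d)}` has a chord between them). -/
def framedGraph {G : Multigraph V E} {F : Type} (emb : Embedding G F) (d : ℕ) :
    SimpleGraph V where
  Adj u v := u ≠ v ∧ ((∃ e, G.ends e = s(u, v)) ∨
    ∃ f, (emb.boundary f).len ≤ d ∧ (emb.boundary f).HasVtx u ∧ (emb.boundary f).HasVtx v)
  symm := by
    constructor
    rintro u v ⟨hne, (⟨e, he⟩ | ⟨f, h1, h2, h3⟩)⟩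
    · exact ⟨hne.symm, Or.inl ⟨e, he.trans Sym2.eq_swap⟩⟩
    · exact ⟨hne.symm, Or.inr ⟨f, h1, h3, h2⟩⟩
  loopless := by constructor; rintro u ⟨hne, -⟩; exact hne rfl

end Multigraph

namespace SimpleGraph

/-- `G` is contained in `X`: `G` is isomorphic to a subgraph of `X`. -/
def IsContainedIn {α β : Type} (G : SimpleGraph α) (X : SimpleGraph β) : Prop :=
  ∃ f : G →g X, Function.Injective f

/-- The strong product of two simple graphs. -/
def strongProd {α β : Type} (G : SimpleGraph α) (H : SimpleGraph β) :
    SimpleGraph (α × β) where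
  Adj x y := x ≠ y ∧ (x.1 = y.1 ∨ G.Adj x.1 y.1) ∧ (x.2 = y.2 ∨ H.Adj x.2 y.2)
  symm := by
    constructor
    rintro x y ⟨hne, h1, h2⟩
    exact ⟨hne.symm, h1.imp Eq.symm (fun h => G.adj_symm h), h2.imp Eq.symm (fun h => H.adj_symm h)⟩
  loopless := by constructor; rintro x ⟨hne, -⟩; exact hne rfl

end SimpleGraph

/-- `G` has treewidth at most `k`: it has a tree-decomposition with all bags of
size at most `k + 1`. -/
def TreewidthLE {α : Type} (G : SimpleGraph α) (k : ℕ) : Prop :=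
  ∃ (ι : Type) (T : SimpleGraph ι) (B : ι → Set α),
    T.IsTree ∧
    (∀ v, ∃ i, v ∈ B i) ∧
    (∀ u v, G.Adj u v → ∃ i, u ∈ B i ∧ v ∈ B i) ∧
    (∀ v, (T.induce {i | v ∈ B i}).Connected) ∧
    ∀ i, (B i).encard ≤ (k : ℕ∞) + 1

/-- `G` has Euler genus at most `g`: `G` is (isomorphic to) a subgraph of a
multigraph having a combinatorial embedding of Euler genus at most `g`. -/
def HasEulerGenusLE {α : Type} (G : SimpleGraph α) (g : ℕ) : Prop :=
  ∃ (V' E' F' : Type), Finite V' ∧ Finite E' ∧ Finite F' ∧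
    ∃ (M : Multigraph V' E') (emb : M.Embedding F'),
      emb.eulerGenus ≤ (g : ℤ) ∧ G.IsContainedIn M.simple

/-- A planar graph: a graph of Euler genus `0`. -/
def IsPlanar {α : Type} (G : SimpleGraph α) : Prop := HasEulerGenusLE G 0

/-- An apex graph: deleting some vertex leaves a planar graph. -/
def IsApex {α : Type} (G : SimpleGraph α) : Prop :=
  ∃ v : α, IsPlanar (G.induce {w | w ≠ v})

/-- `A` indexes a partition of the vertices of `G` into nonempty parts `A x`, and the
quotient of `G` by this partition is (isomorphic to) `H`, via the indexing: this is an
`H`-partition of `G`. -/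
def IsHPartition {α W : Type} (G : SimpleGraph α) (H : SimpleGraph W) (A : W → Set α) : Prop :=
  (∀ x, (A x).Nonempty) ∧ (∀ v, ∃! x, v ∈ A x) ∧
    ∀ x y, x ≠ y → (H.Adj x y ↔ ∃ u ∈ A x, ∃ v ∈ A y, G.Adj u v)

/-- `(L 0, L 1, …)` is a layering of `G`: an ordered partition of the vertices such
that every edge joins vertices in the same or in consecutive layers. -/
def IsLayering {α : Type} (G : SimpleGraph α) (L : ℕ → Set α) : Prop :=
  (∀ v, ∃! j, v ∈ L j) ∧
    ∀ u v, G.Adj u v → ∀ i j, u ∈ L i → v ∈ L j → i ≤ j + 1 ∧ j ≤ i + 1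

/-- `b` lies on every walk from `a` to `c` in `T` (for a tree: `b` is on the unique
`a`–`c` path). -/
def BtwIn {α : Type} (T : SimpleGraph α) (a b c : α) : Prop :=
  ∀ p : T.Walk a c, b ∈ p.support

/-- `Q` is the vertex set of a vertical path in the tree `T` rooted at `r` with upper
end `w` and lower end `u`: `w` lies on the path from `r` to `u`, and `Q` is the set of
vertices of the `w`–`u` path. -/
def IsVerticalPathBtw {α : Type} (T : SimpleGraph α) (r : α) (Q : Set α) (w u : α) : Prop :=
  BtwIn T r w u ∧ Q = {x | BtwIn T w x u}

/-- `Q` is the vertex set of a vertical path in the tree `T` rooted at `r`. -/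
def IsVerticalPath {α : Type} (T : SimpleGraph α) (r : α) (Q : Set α) : Prop :=
  ∃ w u, IsVerticalPathBtw T r Q w u

/-- `Y` is the union of at most `k` vertical paths in the tree `T` rooted at `r`. -/
def IsUnionOfVPaths {α : Type} (T : SimpleGraph α) (r : α) (k : ℕ) (Y : Set α) : Prop :=
  ∃ m, m ≤ k ∧ ∃ Q : Fin m → Set α, (∀ i, IsVerticalPath T r (Q i)) ∧ Y = ⋃ i, Q i

set_option linter.unusedSectionVars false
set_option linter.unusedVariables false
set_option linter.unusedSimpArgs false

section
namespace MGP
open Finset Classical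

abbrev K := ZMod 2

theorem Kd (x : K) : x = 0 ∨ x = 1 := by revert x; decide
theorem Ka (x : K) : x + x = 0 := by revert x; decide
theorem Kb {x y : K} (h : x + y = 0) : x = y := by revert x y; decide
theorem Kc {x y : K} (h : x = y) : x + y = 0 := by subst h; exact Ka x

section LA
variable {E X : Type} [Fintype E] [Fintype X] (a b : E → X)

/-- `z` is a cycle. -/
def Cyc (z : E → K) : Prop := ∀ h : X → K, ∑ e, z e * (h (a e) + h (b e)) = 0

def Ind (s : Finset E) : Prop := ∀ z : E → K, (∀ e, e ∉ s → z e = 0) → Cyc a b z → z = 0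

theorem ii {be s : Finset E} (km : be ⊆ s) (hi : Ind a b be) :
    ∃ t, be ⊆ t ∧ t ⊆ s ∧ Ind a b t ∧
      ∀ h : X → K, (∀ e ∈ t, h (a e) = h (b e)) → ∀ e ∈ s, h (a e) = h (b e) := by
  obtain ⟨t, ht, hmax⟩ := Finset.exists_max_image
    (univ.filter (fun t : Finset E => be ⊆ t ∧ t ⊆ s ∧ Ind a b t)) Finset.card
    ⟨be, by simp [km, hi]⟩
  simp only [mem_filter, mem_univ, true_and] at ht hmax
  refine ⟨t, ht.1, ht.2.1, ht.2.2, fun h hh e he => ?_⟩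
  by_cases het : e ∈ t
  · exact hh e het
  have hni : ¬ Ind a b (insert e t) := by
    intro hI
    have := hmax (insert e t) ⟨ht.1.trans (subset_insert _ _),
      insert_subset he ht.2.1, hI⟩
    rw [card_insert_of_notMem het] at this
    omega
  unfold Ind at hni
  push Not at hni
  obtain ⟨z, hz, hc, hne⟩ := hni
  have hze : z e ≠ 0 := by
    intro km
    apply hne
    apply ht.2.2 z _ hc
    intro ea aq
    by_cases kd : ea = e
    · rw [kd, km]
    · exact hz ea (by simp [kd, aq])
  have := hc h
  rw [Finset.sum_eq_single e] at this
  · rcases mul_eq_zero.mp this with kd | kd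
    · exact absurd kd hze
    · exact Kb kd
  · intro ea _ fm
    by_cases ke : ea ∈ t
    · rw [Kc (hh ea ke), mul_zero]
    · rw [hz ea (by simp [fm, ke]), zero_mul]
  · simp

theorem ij (s : Finset E) (R : Finset X)
    (H : ∀ h : X → K, (∀ e ∈ s, h (a e) = h (b e)) → (∀ x ∈ R, h x = 0) → h = 0) :
    Fintype.card X ≤ s.card + R.card := by
  let f : (X → K) →ₗ[K] ((s → K) × (R → K)) :=
    { toFun := fun h => (fun e => h (a e) + h (b e), fun x => h x)
      map_add' := by
        intro x y; ext <;> simp; ring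
      map_smul' := by
        intro c x; ext <;> simp; ring }
  have hf : Function.Injective f := by
    rw [← LinearMap.ker_eq_bot, LinearMap.ker_eq_bot']
    intro h hh
    have kd := congrArg Prod.fst hh
    have ke := congrArg Prod.snd hh
    apply H
    · intro e he
      exact Kb (congrFun kd ⟨e, he⟩)
    · intro x hx
      exact congrFun ke ⟨x, hx⟩
  have := LinearMap.finrank_le_finrank_of_injective hf
  simpa using this

theorem prescribe (s : Finset E) (ψ : E → K)
    (H : ∀ z : E → K, (∀ e, e ∉ s → z e = 0) → Cyc a b z → ∑ e, z e * ψ e = 0) :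
    ∃ h : X → K, ∀ e ∈ s, h (a e) + h (b e) = ψ e := by
  let A : (X → K) →ₗ[K] (s → K) :=
    { toFun := fun h e => h (a e) + h (b e)
      map_add' := by
        intro x y; ext; simp; ring
      map_smul' := by
        intro c x; ext; simp; ring }
  have : (fun e : s => ψ e) ∈ LinearMap.range A := by
    by_contra hn
    obtain ⟨f, hf, hle⟩ := Submodule.exists_le_ker_of_notMem hn
    apply hf
    have hrep : ∀ w : s → K, f w = ∑ e : s, w e * f (Pi.single e 1) := by
      intro w
      conv_lhs => rw [← LinearMap.sum_single_apply (φ := fun _ : s => K) w]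
      rw [map_sum]
      refine Finset.sum_congr rfl fun e _ => ?_
      rw [show (Pi.single e (w e) : s → K) = w e • Pi.single e 1 by
        rw [← Pi.single_smul]; simp]
      rw [map_smul]; rfl
    have key : ∀ φ : E → K, f (fun e : s => φ e) =
        ∑ e, (if he : e ∈ s then f (Pi.single ⟨e, he⟩ 1) else 0) * φ e := by
      intro φ
      rw [hrep]
      have ke : ∀ e ∈ univ, e ∉ s →
        (if he : e ∈ s then f (Pi.single ⟨e, he⟩ 1) else 0) * φ e = 0 := by
        intro e _ he; simp [he]
      rw [← Finset.sum_subset (subset_univ s) ke, ← Finset.sum_coe_sort s]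
      refine Finset.sum_congr rfl fun e _ => ?_
      simp [mul_comm]
    rw [key]
    apply H
    · intro e he; simp [he]
    · intro h
      have : f (A h) = 0 := hle ⟨h, rfl⟩
      exact (key (fun e => h (a e) + h (b e))).symm.trans this
  obtain ⟨h, hh⟩ := this
  exact ⟨h, fun e he => congrFun hh ⟨e, he⟩⟩

theorem pg {s : Finset E} (hs : Ind a b s) (ψ : E → K) :
    ∃ h : X → K, ∀ e ∈ s, h (a e) + h (b e) = ψ e := by
  apply prescribe
  intro z kd ke
  rw [hs z kd ke]; simp

theorem il : Ind a b ∅ := fun z hz _ => by ext e; simpa using hz e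

end LA

section Cx
variable {T E L : Type} [Fintype T] [Fintype E] [Fintype L]
variable (σ : E × Bool ≃ T × Fin 3) (node : T → Fin 3 → L)

def lf (e : E) : T := (σ (e, false)).1
def rt (e : E) : T := (σ (e, true)).1
def src (e : E) : L := node (σ (e, false)).1 (σ (e, false)).2
def tgt (e : E) : L := node (σ (e, false)).1 ((σ (e, false)).2 + 1)
def side (t : T) (i : Fin 3) : E := (σ.symm (t, i)).1
noncomputable def reached : Finset L := univ.image (fun p : T × Fin 3 => node p.1 p.2)

structure PreP (live : Finset E) (g : ℕ) : Prop where
  compat : ∀ e, (node (σ (e, true)).1 (σ (e, true)).2 = src σ node e ∧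
      node (σ (e, true)).1 ((σ (e, true)).2 + 1) = tgt σ node e) ∨
    (node (σ (e, true)).1 (σ (e, true)).2 = tgt σ node e ∧
      node (σ (e, true)).1 ((σ (e, true)).2 + 1) = src σ node e)
  dead : ∀ e, e ∉ live → src σ node e = tgt σ node e
  dual : ∀ S : T → K, (∀ e ∈ live, S (lf σ e) = S (rt σ e)) → ∀ t ta, S t = S ta
  count : live.card + 2 ≤ (reached node).card + Fintype.card T + g

variable {σ node} {live : Finset E} {g : ℕ}

theorem mb (t : T) (i : Fin 3) : node t i ∈ reached node := by
  simp only [reached, mem_image, mem_univ, true_and]; exact ⟨(t, i), rfl⟩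

theorem exchange (S : T → K) (φ : E → K) :
    ∑ t, S t * ∑ i, φ (side σ t i) = ∑ e, φ e * (S (lf σ e) + S (rt σ e)) := by
  simp_rw [Finset.mul_sum]
  rw [← Fintype.sum_prod_type' (f := fun t i => S t * φ (side σ t i)),
    ← Equiv.sum_comp σ, Fintype.sum_prod_type]
  refine Finset.sum_congr rfl fun e _ => ?_
  simp [side, lf, rt]
  ring

theorem PreP.sa (P : PreP σ node live g) (t : T) (i : Fin 3) :
    (node t i = src σ node (side σ t i) ∧ node t (i+1) = tgt σ node (side σ t i)) ∨
    (node t i = tgt σ node (side σ t i) ∧ node t (i+1) = src σ node (side σ t i)) := by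
  have h : σ (side σ t i, (σ.symm (t, i)).2) = (t, i) := by simp [side]
  rcases hb : (σ.symm (t, i)).2 with _ | _
  · rw [hb] at h
    left
    simp [src, tgt, h]
  · rw [hb] at h
    have := P.compat (side σ t i)
    rw [h] at this
    exact this

theorem PreP.sb (P : PreP σ node live g) (h : L → K) (t : T) (i : Fin 3) :
    h (src σ node (side σ t i)) + h (tgt σ node (side σ t i)) = h (node t i) + h (node t (i+1)) := by
  rcases P.sa t i with ⟨kd, ke⟩ | ⟨kd, ke⟩ <;> rw [kd, ke]
  rw [add_comm]

theorem sj (f : Fin 3 → K) : ∑ i, (f i + f (i+1)) = 0 := by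
  simp [Fin.sum_univ_three]
  have ke := Ka (f 0)
  have kf := Ka (f 1)
  have ki := Ka (f 2)
  linear_combination ke + kf + ki

theorem PreP.bb (P : PreP σ node live g) (S : T → K) :
    Cyc (src σ node) (tgt σ node) (fun e => S (lf σ e) + S (rt σ e)) := by
  intro h
  have := exchange (σ := σ) S (fun e => h (src σ node e) + h (tgt σ node e))
  simp_rw [P.sb h] at this
  simp_rw [mul_comm (S _ + S _)]
  rw [← this]
  apply Finset.sum_eq_zero
  intro t _
  rw [sj (fun i => h (node t i)), mul_zero]

theorem PreP.sg (P : PreP σ node live g) (e : E) : ∃ i, node (lf σ e) i = src σ node e := ⟨_, rfl⟩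
theorem PreP.te (P : PreP σ node live g) (e : E) : ∃ i, node (lf σ e) i = tgt σ node e := ⟨_, rfl⟩
theorem PreP.si (P : PreP σ node live g) (e : E) : ∃ i, node (rt σ e) i = src σ node e := by
  rcases P.compat e with h | h
  · exact ⟨_, h.1⟩
  · exact ⟨_, h.2⟩
theorem PreP.tf (P : PreP σ node live g) (e : E) : ∃ i, node (rt σ e) i = tgt σ node e := by
  rcases P.compat e with h | h
  · exact ⟨_, h.2⟩
  · exact ⟨_, h.1⟩

theorem ev {X : Type} (f : Fin 3 → X) (h : ∀ i, f i = f (i+1)) (i j : Fin 3) : f i = f j := by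
  have km : f 0 = f 1 := h 0
  have kd : f 1 = f 2 := h 1
  have : ∀ i, f i = f 0 := by
    intro i
    fin_cases i
    · rfl
    · exact km.symm
    · exact (km.trans kd).symm
  rw [this i, this j]

theorem PreP.conn (P : PreP σ node live g) (h : L → K)
    (hh : ∀ e ∈ live, h (src σ node e) = h (tgt σ node e)) :
    ∀ x ∈ reached node, ∀ y ∈ reached node, h x = h y := by
  have kd : ∀ e, h (src σ node e) = h (tgt σ node e) := by
    intro e
    by_cases he : e ∈ live
    · exact hh e he
    · rw [P.dead e he]
  have ke : ∀ t i, h (node t i) = h (node t (i+1)) := by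
    intro t i
    apply Kb
    rw [← P.sb h, Kc (kd _)]
  have kf : ∀ t i j, h (node t i) = h (node t j) := fun t i j =>
    ev (fun i => h (node t i)) (ke t) i j
  have ki := P.dual (fun t => h (node t 0)) (by
    intro e _
    obtain ⟨i, hi⟩ := P.sg e
    obtain ⟨j, hj⟩ := P.si e
    show h (node (lf σ e) 0) = h (node (rt σ e) 0)
    rw [kf _ 0 i, kf _ 0 j, hi, hj])
  intro x hx y hy
  simp only [reached, mem_image, mem_univ, true_and] at hx hy
  obtain ⟨⟨t, i⟩, rfl⟩ := hx
  obtain ⟨⟨ta, ib⟩, rfl⟩ := hy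
  show h (node t i) = h (node ta ib)
  rw [kf t i 0, kf ta ib 0]
  exact ki t ta

/-- basic homology lemma -/
theorem PreP.fill (P : PreP σ node live 0) (z : E → K) (hz : Cyc (src σ node) (tgt σ node) z) :
    ∃ S : T → K, ∀ e ∈ live, S (lf σ e) + S (rt σ e) = z e := by
  by_cases hT : Nonempty T
  swap
  · refine ⟨fun _ => 0, fun e => ?_⟩
    exact absurd ⟨lf σ e⟩ hT
  obtain ⟨tc⟩ := hT
  obtain ⟨Tr, -, hTr, hTrI, hTrS⟩ := ii (src σ node) (tgt σ node)
    (empty_subset live) (il _ _)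
  have hTc : Fintype.card L ≤ Tr.card + (insert (node tc 0) (univ \ reached node)).card := by
    apply ij (src σ node) (tgt σ node)
    intro h kd ke
    ext x
    by_cases hx : x ∈ reached node
    · rw [P.conn h (hTrS h kd) x hx (node tc 0) (mb _ _)]
      exact ke _ (by simp)
    · exact ke _ (by simp [hx])
  have hc1 : (insert (node tc 0) (univ \ reached node)).card + (reached node).card ≤
      Fintype.card L + 1 := by
    have := card_insert_le (node tc 0) (univ \ reached node)
    have kf := card_sdiff_add_card_eq_card (subset_univ (reached node))
    rw [card_univ] at kf
    omega
  obtain ⟨Ts, -, hTs, hTsI, hTsS⟩ := ii (lf σ) (rt σ)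
    (empty_subset (live \ Tr)) (il _ _)
  have hdual : ∀ S : T → K, (∀ e ∈ live \ Tr, S (lf σ e) = S (rt σ e)) → ∀ t ta, S t = S ta := by
    intro S hS
    apply P.dual
    have km := hTrI (fun e => if e ∈ Tr then S (lf σ e) + S (rt σ e) else 0)
      (fun e he => by simp [he]) (by
        intro h
        have := P.bb S h
        refine Eq.trans (Finset.sum_congr rfl fun e _ => ?_) this
        by_cases kd : e ∈ Tr
        · simp [kd]
        by_cases ke : e ∈ live
        · have := hS e (by simp [kd, ke])
          simp [kd, Kc this]
        · simp [kd, Kc (congrArg h (P.dead e ke))])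
    intro e he
    by_cases kd : e ∈ Tr
    · have := congrFun km e
      simp only [kd, if_true] at this
      exact Kb this
    · exact hS e (by simp [kd, he])
  have hTsc : Fintype.card T ≤ Ts.card + ({tc} : Finset T).card := by
    apply ij (lf σ) (rt σ)
    intro h kd ke
    ext t
    rw [hdual h (hTsS h kd) t tc]
    exact ke _ (by simp)
  have hcount := P.count
  have hdisj : Disjoint Tr Ts := by
    rw [Finset.disjoint_left]
    intro e kd ke
    have := hTs ke
    simp [kd] at this
  have hun : Tr ∪ Ts = live := by
    apply Finset.eq_of_subset_of_card_le
    · exact union_subset hTr (hTs.trans sdiff_subset)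
    · rw [card_union_of_disjoint hdisj]
      rw [card_singleton] at hTsc
      omega
  obtain ⟨S, hS⟩ := pg (lf σ) (rt σ) hTsI z
  refine ⟨S, ?_⟩
  have km := hTrI (fun e => if e ∈ Tr then S (lf σ e) + S (rt σ e) + z e else 0)
    (fun e he => by simp [he]) (by
      intro h
      have := congrArg₂ (· + ·) (P.bb S h) (hz h)
      simp only [← Finset.sum_add_distrib, add_zero] at this
      refine Eq.trans (Finset.sum_congr rfl fun e _ => ?_) this
      by_cases kd : e ∈ Tr
      · simp [kd]; ring
      by_cases ke : e ∈ live
      · have kf : e ∈ Ts := by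
          rw [← hun] at ke; simpa [kd] using ke
        have := hS e kf
        simp only [kd, if_false, zero_mul]
        rw [← add_mul, this, Ka, zero_mul]
      · simp [kd, Kc (congrArg h (P.dead e ke))])
  intro e he
  by_cases kd : e ∈ Tr
  · have := congrFun km e
    simp only [kd, if_true] at this
    exact Kb this
  · exact hS e (by rw [← hun] at he; simpa [kd] using he)

def Tch (node : T → Fin 3 → L) (t : T) (n : L) : Prop := ∃ i, node t i = n

theorem PreP.star (P : PreP σ node live 0) (S : T → K) (n : L)
    (hS : ∀ e ∈ live, (src σ node e = n ∨ tgt σ node e = n) → S (lf σ e) = S (rt σ e))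
    {t ta : T} (ht : Tch node t n) (ah : Tch node ta n) : S t = S ta := by
  let δ : L → K := fun x => if x = n then 1 else 0
  let ψ : E → K := fun e => S (lf σ e) * (δ (src σ node e) + δ (tgt σ node e))
  have bj : ∀ e, e ∉ live → ψ e = 0 := by
    intro e he
    simp only [ψ]
    rw [P.dead e he, Ka, mul_zero]
  have hψ : ∀ t i, ψ (side σ t i) = S t * (δ (node t i) + δ (node t (i+1))) := by
    intro t i
    by_cases hl : side σ t i ∈ live
    · rw [← P.sb δ]
      simp only [ψ]
      have h : σ (side σ t i, (σ.symm (t, i)).2) = (t, i) := by simp [side]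
      rcases hb : (σ.symm (t, i)).2 with _ | _
      · rw [hb] at h
        simp [lf, h]
      · rw [hb] at h
        have kd : rt σ (side σ t i) = t := by simp [rt, h]
        by_cases ke : src σ node (side σ t i) = n ∨ tgt σ node (side σ t i) = n
        · rw [hS _ hl ke, kd]
        · push Not at ke
          simp [δ, ke.1, ke.2]
    · rw [bj _ hl, ← P.sb δ, P.dead _ hl, Ka, mul_zero]
  obtain ⟨h, hh⟩ := prescribe (src σ node) (tgt σ node) live ψ (by
    intro z hz hc
    obtain ⟨Sh, ai⟩ := P.fill z hc
    have kd := exchange (σ := σ) Sh ψ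
    rw [Finset.sum_eq_zero (s := (univ : Finset T))] at kd
    · rw [kd]
      refine Finset.sum_congr rfl fun e _ => ?_
      by_cases he : e ∈ live
      · rw [ai e he, mul_comm]
      · rw [bj e he]; simp
    · intro t _
      simp_rw [hψ]
      rw [← Finset.mul_sum, sj (fun i => δ (node t i)), mul_zero, mul_zero])
  have ar : ∀ e, h (src σ node e) + h (tgt σ node e) = ψ e := by
    intro e
    by_cases he : e ∈ live
    · exact hh e he
    · rw [bj e he, P.dead e he, Ka]
  let G : T → Fin 3 → K := fun t i => h (node t i) + δ (node t i) * S t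
  have hG : ∀ t i j, G t i = G t j := by
    intro t
    apply ev
    intro i
    apply Kb
    have := ar (side σ t i)
    rw [P.sb h, hψ] at this
    simp only [G]
    have ke := Ka (S t * (δ (node t i) + δ (node t (i+1))))
    linear_combination this + ke
  have hc := P.dual (fun t => G t 0) (by
    intro e he
    obtain ⟨i, hi⟩ := P.sg e
    obtain ⟨j, hj⟩ := P.si e
    show G _ 0 = G _ 0
    rw [hG _ 0 i, hG _ 0 j]
    simp only [G, hi, hj]
    by_cases kd : src σ node e = n
    · rw [hS e he (Or.inl kd)]
    · simp [δ, kd]) t ta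
  obtain ⟨i, hi⟩ := ht
  obtain ⟨j, hj⟩ := ah
  have hc : G t 0 = G ta 0 := hc
  rw [hG _ 0 i, hG _ 0 j] at hc
  simpa [G, hi, hj, δ] using hc

theorem PreP.avoid (P : PreP σ node live 0) (z : E → K) (hz : Cyc (src σ node) (tgt σ node) z)
    (n : L) (hn : ∀ e ∈ live, (src σ node e = n ∨ tgt σ node e = n) → z e = 0) :
    ∃ S : T → K, (∀ e ∈ live, S (lf σ e) + S (rt σ e) = z e) ∧ ∀ t, Tch node t n → S t = 0 := by
  obtain ⟨S, hS⟩ := P.fill z hz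
  have hst : ∀ t ta, Tch node t n → Tch node ta n → S t = S ta := by
    intro t ta kd ke
    apply P.star S n _ kd ke
    intro e he h
    apply Kb
    rw [hS e he, hn e he h]
  by_cases hex : ∃ t, Tch node t n
  · obtain ⟨tc, fo⟩ := hex
    refine ⟨fun t => S t + S tc, ?_, ?_⟩
    · intro e he
      have ke := Ka (S tc)
      rw [← hS e he]
      linear_combination ke
    · intro t ht
      exact Kc (hst t tc ht fo)
  · push Not at hex
    exact ⟨S, hS, fun t ht => absurd ht (hex t)⟩

end Cx

theorem ind_card_le {E X : Type} [Fintype E] [Fintype X] (a b : E → X) {s : Finset E}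
    (hs : Ind a b s) (xa : X) : s.card + 1 ≤ Fintype.card X := by
  let f : (X → K) →ₗ[K] ((s → K) × K) :=
    { toFun := fun h => (fun e => h (a e) + h (b e), h xa)
      map_add' := by
        intro x y; ext <;> simp; ring
      map_smul' := by
        intro c x; ext <;> simp; ring }
  have hf : Function.Surjective f := by
    rintro ⟨w, c⟩
    obtain ⟨h, hh⟩ := pg a b hs (fun e => if he : e ∈ s then w ⟨e, he⟩ else 0)
    refine ⟨fun x => h x + (h xa + c), ?_⟩
    have ke := Ka (h xa + c)
    have kf := Ka (h xa)
    ext e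
    · have := hh e e.2
      simp only [e.2, dif_pos] at this
      show h (a e) + (h xa + c) + (h (b e) + (h xa + c)) = w e
      rw [← this]
      linear_combination ke
    · show h xa + (h xa + c) = c
      linear_combination kf
  have := LinearMap.finrank_le_finrank_of_surjective hf
  simpa using this

section Cx
variable {T E L La : Type} [Fintype T] [Fintype E] [Fintype L] [Fintype La]
variable {σ : E × Bool ≃ T × Fin 3} {node : T → Fin 3 → L} {live : Finset E} {g : ℕ}

theorem PreP.ew (P : PreP σ node live g) {Tr : Finset E}
    (hTrI : Ind (src σ node) (tgt σ node) Tr) (S : T → K)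
    (hS : ∀ e ∈ live \ Tr, S (lf σ e) = S (rt σ e)) : ∀ t ta, S t = S ta := by
  apply P.dual
  have km := hTrI (fun e => if e ∈ Tr then S (lf σ e) + S (rt σ e) else 0)
    (fun e he => by simp [he]) (by
      intro h
      have := P.bb S h
      refine Eq.trans (Finset.sum_congr rfl fun e _ => ?_) this
      by_cases kd : e ∈ Tr
      · simp [kd]
      by_cases ke : e ∈ live
      · have := hS e (by simp [kd, ke])
        simp [kd, Kc this]
      · simp [kd, Kc (congrArg h (P.dead e ke))])
  intro e he
  by_cases kd : e ∈ Tr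
  · have := congrFun km e
    simp only [kd, if_true] at this
    exact Kb this
  · exact hS e (by simp [kd, he])

theorem PreP.mc (P : PreP σ node live g) (blk : L → La) (e : E) :
    let node := fun t i => blk (node t i)
    (node (σ (e, true)).1 (σ (e, true)).2 = src σ node e ∧
      node (σ (e, true)).1 ((σ (e, true)).2 + 1) = tgt σ node e) ∨
    (node (σ (e, true)).1 (σ (e, true)).2 = tgt σ node e ∧
      node (σ (e, true)).1 ((σ (e, true)).2 + 1) = src σ node e) := by
  rcases P.compat e with h | h
  · exact Or.inl ⟨congrArg blk h.1, congrArg blk h.2⟩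
  · exact Or.inr ⟨congrArg blk h.1, congrArg blk h.2⟩

theorem PreP.contract (P : PreP σ node live g) (blk : L → La)
    (hblk : ∀ h : L → K, (∀ e ∈ live, blk (src σ node e) = blk (tgt σ node e) →
      h (src σ node e) = h (tgt σ node e)) → ∀ x y, blk x = blk y → h x = h y) :
    ∃ lb ⊆ live, PreP σ (fun t i => blk (node t i)) lb g ∧
      ∀ e ∈ live, blk (src σ node e) ≠ blk (tgt σ node e) → e ∈ lb := by
  obtain ⟨F, -, hF, hFI, hFS⟩ := ii (src σ node) (tgt σ node)
    (empty_subset (live.filter (fun e => blk (src σ node e) = blk (tgt σ node e)))) (il _ _)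
  simp only [subset_iff, mem_filter] at hF
  refine ⟨live \ F, sdiff_subset, ⟨P.mc blk, ?_, P.ew hFI, ?_⟩, ?_⟩
  · intro e he
    by_cases kd : e ∈ live
    · have : e ∈ F := by simpa [kd] using he
      exact (hF this).2
    · exact congrArg blk (P.dead e kd)
  · by_cases hL : Nonempty L
    swap
    · have kd : reached node = ∅ := by
        rw [Finset.eq_empty_iff_forall_notMem]; exact fun x => absurd ⟨x⟩ hL
      have ke := P.count
      rw [kd, card_empty] at ke
      have kf : (live \ F).card ≤ live.card := card_le_card sdiff_subset
      omega
    have hc := ij (src σ node) (tgt σ node) F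
      ((reached (fun t i => blk (node t i))).image (Function.invFun blk) ∪ (univ \ reached node)) (by
        intro h kd ke
        ext x
        by_cases hx : x ∈ reached node
        · rw [hblk h (fun e he hb => hFS h kd e (by simp [he, hb])) x (Function.invFun blk (blk x))
            (Function.invFun_eq (f := blk) ⟨x, rfl⟩).symm]
          apply ke
          apply mem_union_left
          apply mem_image_of_mem
          simp only [reached, mem_image, mem_univ, true_and] at hx ⊢
          obtain ⟨p, rfl⟩ := hx
          exact ⟨p, rfl⟩
        · exact ke _ (mem_union_right _ (by simp [hx])))
    have kd := card_union_le ((reached (fun t i => blk (node t i))).image (Function.invFun blk))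
      (univ \ reached node)
    have ke := card_image_le (s := reached (fun t i => blk (node t i))) (f := Function.invFun blk)
    have kf := card_sdiff_add_card_eq_card (subset_univ (reached node))
    rw [card_univ] at kf
    have ki := P.count
    have kp := card_sdiff_add_card_eq_card (show F ⊆ live from fun e he => (hF he).1)
    omega
  · intro e he hb
    simp only [mem_sdiff, he, true_and]
    intro h
    exact hb (hF h).2

theorem tree_ind {a b : E → L} {par : L → L} {pe : L → E} {root : L} {rk : L → ℕ}
    (hpe : ∀ n, n ≠ root → (a (pe n) = n ∧ b (pe n) = par n) ∨ (a (pe n) = par n ∧ b (pe n) = n))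
    (hrk : ∀ n, n ≠ root → rk (par n) < rk n) :
    Ind a b ((univ.erase root).image pe) ∧ ((univ.erase root).image pe).card + 1 = Fintype.card L := by
  have hinj : ∀ n m, n ≠ root → m ≠ root → pe n = pe m → n = m := by
    intro n m hn hm h
    have kd := hpe n hn
    have ke := hpe m hm
    have kf := hrk n hn
    have ki := hrk m hm
    rw [h] at kd
    by_contra hne
    rcases kd with ⟨kp, kx⟩ | ⟨kp, kx⟩ <;> rcases ke with ⟨aw, ax⟩ | ⟨aw, ax⟩
    · exact hne (kp.symm.trans aw)
    · rw [kx.symm.trans ax] at kf; rw [← kp.symm.trans aw] at ki; omega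
    · rw [kp.symm.trans aw] at kf; rw [← kx.symm.trans ax] at ki; omega
    · exact hne (kx.symm.trans ax)
  constructor
  · intro z hz hc
    by_contra hne
    have hex : ∃ n, n ≠ root ∧ z (pe n) ≠ 0 := by
      by_contra hno
      push Not at hno
      apply hne
      ext e
      by_cases he : e ∈ (univ.erase root).image pe
      · simp only [mem_image, mem_erase, mem_univ, and_true] at he
        obtain ⟨n, hn, rfl⟩ := he
        exact hno n hn
      · exact hz e he
    obtain ⟨n, hn, hmax⟩ := Finset.exists_max_image
      (univ.filter (fun n => n ≠ root ∧ z (pe n) ≠ 0)) rk (by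
        obtain ⟨n, hn⟩ := hex; exact ⟨n, by simpa using hn⟩)
    simp only [mem_filter, mem_univ, true_and] at hn hmax
    have := hc (fun x => if x = n then 1 else 0)
    have hpn : par n ≠ n := fun h => by have := hrk n hn.1; rw [h] at this; omega
    rw [Finset.sum_eq_single (pe n)] at this
    · apply hn.2
      rcases hpe n hn.1 with ⟨kd, ke⟩ | ⟨kd, ke⟩ <;> simpa [kd, ke, hpn] using this
    · intro e _ hen
      by_cases he : e ∈ (univ.erase root).image pe
      · simp only [mem_image, mem_erase, mem_univ, and_true] at he
        obtain ⟨m, hm, rfl⟩ := he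
        by_cases km : z (pe m) = 0
        · rw [km, zero_mul]
        have hmn : m ≠ n := fun h => hen (by rw [h])
        have hpm : par m ≠ n := by
          intro h
          have kd := hmax m ⟨hm, km⟩
          have ke := hrk m hm
          rw [h] at ke
          omega
        rcases hpe m hm with ⟨kd, ke⟩ | ⟨kd, ke⟩ <;> simp [kd, ke, hmn, hpm]
      · rw [hz e he, zero_mul]
    · simp
  · rw [card_image_of_injOn]
    · rw [card_erase_of_mem (mem_univ _), card_univ]
      have : 0 < Fintype.card L := Fintype.card_pos_iff.mpr ⟨root⟩
      omega
    · intro n hn m hm h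
      exact hinj n m (by simpa using hn) (by simpa using hm) h

theorem PreP.genus_cut (P : PreP σ node live g) (hcov : reached node = univ) (tc : T)
    {par : L → L} {pe : L → E} {root : L} {rk : L → ℕ} (hlive : ∀ n, n ≠ root → pe n ∈ live)
    (hpe : ∀ n, n ≠ root → (src σ node (pe n) = n ∧ tgt σ node (pe n) = par n) ∨
      (src σ node (pe n) = par n ∧ tgt σ node (pe n) = n))
    (hrk : ∀ n, n ≠ root → rk (par n) < rk n)
    (B : Finset E) (hB : B ⊆ live) (hBt : ∀ e ∈ B, ∀ n, n ≠ root → pe n ≠ e)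
    (hBI : Ind (lf σ) (rt σ) B) :
    ∃ X ⊆ live, X.card ≤ g ∧ Disjoint X B ∧ (∀ n, n ≠ root → pe n ∉ X) ∧
      ∀ {La : Type} [Fintype La] (Z : Finset L) (blk : L → La), root ∈ Z → (∀ n ∈ Z, n ≠ root → par n ∈ Z) →
        (∀ e ∈ X, src σ node e ∈ Z ∧ tgt σ node e ∈ Z) →
        (∀ x ∈ Z, ∀ y ∈ Z, blk x = blk y) →
        Fintype.card L + 1 ≤ (univ.image blk).card + Z.card →
        PreP σ (fun t i => blk (node t i)) (live \ (X ∪ (Z.erase root).image pe)) 0 := by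
  obtain ⟨hTI, hTc⟩ := tree_ind hpe hrk
  set Tr := (univ.erase root).image pe with hTr
  obtain ⟨Ts, hBTs, hTs, hTsI, hTsS⟩ := ii (lf σ) (rt σ)
    (show B ⊆ live \ Tr by
      intro e he
      simp only [hTr, mem_sdiff, mem_image, mem_erase, mem_univ, and_true, not_exists, not_and]
      exact ⟨hB he, fun n hn => hBt e he n hn⟩) hBI
  have hdual := P.ew hTI
  have hTrl : Tr ⊆ live := by
    intro e he
    simp only [hTr, mem_image, mem_erase, mem_univ, and_true] at he
    obtain ⟨n, hn, rfl⟩ := he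
    exact hlive n hn
  have hTsc : Fintype.card T ≤ Ts.card + ({tc} : Finset T).card := by
    apply ij (lf σ) (rt σ)
    intro h kd ke
    ext t
    rw [hdual h (hTsS h kd) t tc]
    exact ke _ (by simp)
  rw [card_singleton] at hTsc
  have hTsc2 := ind_card_le (lf σ) (rt σ) hTsI tc
  have hX1 := card_sdiff_add_card_eq_card hTs
  have hX2 := card_sdiff_add_card_eq_card hTrl
  have hcount := P.count
  rw [hcov, card_univ] at hcount
  refine ⟨(live \ Tr) \ Ts, sdiff_subset.trans sdiff_subset, by omega, ?_, ?_, ?_⟩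
  · rw [Finset.disjoint_left]
    intro e he hb
    simp [hBTs hb] at he
  · intro n hn h
    simp only [mem_sdiff, hTr, mem_image, mem_erase, mem_univ, and_true, not_exists, not_and] at h
    exact h.1.2 n hn rfl
  intro La _ Z blk hroot hZ hX hb hcard
  refine ⟨P.mc blk, ?_, ?_, ?_⟩
  · intro e he
    by_cases kd : e ∈ live
    · simp only [mem_sdiff, kd, true_and, not_not, mem_union] at he
      rcases he with he | he
      · have := hX e (by simpa [kd] using he)
        exact hb _ this.1 _ this.2
      · simp only [mem_image, mem_erase] at he
        obtain ⟨n, ⟨hn, hnZ⟩, rfl⟩ := he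
        have ke := hZ n hnZ hn
        rcases hpe n hn with ⟨kf, ki⟩ | ⟨kf, ki⟩
        · show blk (src σ node (pe n)) = blk (tgt σ node (pe n))
          rw [kf, ki]; exact hb _ hnZ _ ke
        · show blk (src σ node (pe n)) = blk (tgt σ node (pe n))
          rw [kf, ki]; exact hb _ ke _ hnZ
    · exact congrArg blk (P.dead e kd)
  · intro S hS
    apply hdual
    apply hTsS
    intro e he
    apply hS
    have kd := hTs he
    rw [mem_sdiff] at kd ⊢
    refine ⟨kd.1, ?_⟩
    rw [mem_union]
    rintro (h | h)
    · simp [he] at h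
    · apply kd.2
      rw [hTr]
      exact image_subset_image (erase_subset_erase _ (subset_univ _)) h
  · have hsub : (live \ (((live \ Tr) \ Ts) ∪ (Z.erase root).image pe)) ⊆
        Ts ∪ ((univ \ Z).image pe) := by
      intro e he
      simp only [mem_sdiff, mem_union, not_or, not_and, not_not] at he
      rw [mem_union]
      by_cases kd : e ∈ Tr
      · right
        rw [hTr, mem_image] at kd
        obtain ⟨n, hn, rfl⟩ := kd
        apply mem_image_of_mem
        rw [mem_sdiff]
        refine ⟨mem_univ _, fun hz => he.2.2 ?_⟩
        exact mem_image_of_mem _ (mem_erase.mpr ⟨(mem_erase.mp hn).1, hz⟩)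
      · left
        exact he.2.1 ⟨he.1, kd⟩
    have kd := card_le_card hsub
    have ke := card_union_le Ts ((univ \ Z).image pe)
    have kf := card_image_le (s := univ \ Z) (f := pe)
    have ki := card_sdiff_add_card_eq_card (subset_univ Z)
    rw [card_univ] at ki
    have kp : univ.image blk ⊆ reached (fun t i => blk (node t i)) := by
      intro y hy
      simp only [mem_image, mem_univ, true_and] at hy
      obtain ⟨x, rfl⟩ := hy
      have hx : x ∈ reached node := by rw [hcov]; exact mem_univ _
      simp only [reached, mem_image, mem_univ, true_and] at hx ⊢
      obtain ⟨p, rfl⟩ := hx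
      exact ⟨p, rfl⟩
    have kx := card_le_card kp
    omega
end Cx

section Cx
variable {T E L La : Type} [Fintype T] [Fintype E] [Fintype L] [Fintype La]
variable {σ : E × Bool ≃ T × Fin 3} {node : T → Fin 3 → L} {live : Finset E} {g : ℕ}

def Jn (σ : E × Bool ≃ T × Fin 3) (node : T → Fin 3 → L) (e : E) (x y : L) : Prop :=
  (src σ node e = x ∧ tgt σ node e = y) ∨ (src σ node e = y ∧ tgt σ node e = x)

theorem Jn.sum {e : E} {x y : L} (j : Jn σ node e x y) (h : L → K) :
    h (src σ node e) + h (tgt σ node e) = h x + h y := by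
  rcases j with ⟨kd, ke⟩ | ⟨kd, ke⟩ <;> rw [kd, ke]
  rw [add_comm]

theorem Jn.symm {e : E} {x y : L} (j : Jn σ node e x y) : Jn σ node e y x := Or.symm j

def Inc (σ : E × Bool ≃ T × Fin 3) (node : T → Fin 3 → L) (e : E) (n : L) : Prop :=
  src σ node e = n ∨ tgt σ node e = n

theorem Jn.inc {e : E} {x y n : L} (j : Jn σ node e x y) : Inc σ node e n ↔ x = n ∨ y = n := by
  rcases j with ⟨rfl, rfl⟩ | ⟨rfl, rfl⟩
  · rfl
  · exact or_comm

theorem PreP.ia (P : PreP σ node live g) {e : E} {n : L} (h : Inc σ node e n) :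
    Tch node (lf σ e) n := by
  rcases h with rfl | rfl
  · exact P.sg e
  · exact P.te e
theorem PreP.ic (P : PreP σ node live g) {e : E} {n : L} (h : Inc σ node e n) :
    Tch node (rt σ e) n := by
  rcases h with rfl | rfl
  · exact P.si e
  · exact P.tf e

noncomputable def dl (e : E) : E → K := fun x => if x = e then 1 else 0
theorem di (e : E) (φ : E → K) : ∑ x, dl e x * φ x = φ e := by simp [dl]
theorem dl_ne {e x : E} (h : dl e x ≠ 0) : x = e := by
  by_contra hne; simp [dl, hne] at h
theorem dd {e x : E} (h : x ≠ e) : dl e x = 0 := by simp [dl, h]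

theorem PreP.theta (P : PreP σ node live g) (Pb Pa Pc : E → K) (Sg Sf Se : T → K)
    (dm : ∀ e, Pb e * Pa e = 0) (dn : ∀ e, Pb e * Pc e = 0) (dp : ∀ e, Pa e * Pc e = 0)
    (df : ∀ e ∈ live, Sg (lf σ e) + Sg (rt σ e) = Pa e + Pc e)
    (dg : ∀ e ∈ live, Sf (lf σ e) + Sf (rt σ e) = Pb e + Pc e)
    (de : ∀ e ∈ live, Se (lf σ e) + Se (rt σ e) = Pb e + Pa e)
    (zd : ∀ e ∈ live, Pb e ≠ 0 → Sg (lf σ e) = 0 ∧ Sg (rt σ e) = 0)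
    (ze : ∀ e ∈ live, Pa e ≠ 0 → Sf (lf σ e) = 0 ∧ Sf (rt σ e) = 0)
    (zf : ∀ e ∈ live, Pc e ≠ 0 → Se (lf σ e) = 0 ∧ Se (rt σ e) = 0)
    (hne : ¬ Cyc (src σ node) (tgt σ node) Pb) (t : T) : Sg t + Sf t + Se t = 1 := by
  have hc := P.dual (fun t => Sg t + Sf t + Se t) (by
    intro e he
    apply Kb
    have ee := Ka (Pb e)
    have ef := Ka (Pa e)
    have eh := Ka (Pc e)
    linear_combination df e he + dg e he + de e he + ee + ef + eh)
  rcases Kd (Sg t + Sf t + Se t) with km | km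
  swap
  · exact km
  exfalso
  apply hne
  have hall : ∀ ta, Sg ta + Sf ta + Se ta = 0 := fun ta => (hc ta t).trans km
  intro h
  refine Eq.trans (Finset.sum_congr rfl fun e _ => ?_) (P.bb (fun t => Sf t * Se t) h)
  by_cases he : e ∈ live
  swap
  · rw [P.dead e he, Ka, mul_zero, mul_zero]
  congr 1
  have ae := df e he
  have aa := dg e he
  have fp := de e he
  have bf := zd e he
  have bg := ze e he
  have fq := zf e he
  have ci := hall (lf σ e)
  have cp := hall (rt σ e)
  have ee := dm e
  have ef := dn e
  have eh := dp e
  show Pb e = Sf (lf σ e) * Se (lf σ e) + Sf (rt σ e) * Se (rt σ e)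
  generalize Sg (lf σ e) = xe at *
  generalize Sg (rt σ e) = xf at *
  generalize Sf (lf σ e) = yb at *
  generalize Sf (rt σ e) = yc at *
  generalize Se (lf σ e) = wa at *
  generalize Se (rt σ e) = wb at *
  generalize Pb e = pi at *
  generalize Pa e = pj at *
  generalize Pc e = pd at *
  clear dm dn dp df dg de zd ze zf hc km hall
  rcases Kd pi with rfl | rfl
  · rcases Kd pj with rfl | rfl
    · rcases Kd pd with rfl | rfl
      · have := Kb (aa.trans (add_zero 0)); subst this
        have := Kb (fp.trans (add_zero 0)); subst this
        exact (Ka _).symm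
      · obtain ⟨rfl, rfl⟩ := fq one_ne_zero; simp
    · obtain ⟨rfl, rfl⟩ := bg one_ne_zero; simp
  · have fr : pd = 0 := by simpa using ef
    subst fr
    obtain ⟨rfl, rfl⟩ := bf one_ne_zero
    have kd : yb = wa := Kb (by simpa using ci)
    have ke : yc = wb := Kb (by simpa using cp)
    subst kd ke
    have : ∀ x : K, x * x = x := by decide
    rw [this, this, aa]; rfl

theorem dh {e f : E} (h : e ≠ f) (x : E) : dl e x * dl f x = 0 := by
  simp only [dl]; split_ifs with kd ke <;> simp_all

theorem Jn.ne {e f : E} {x y u v : L} (j : Jn σ node e x y) (jc : Jn σ node f u v)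
    (h : (x ≠ u ∧ x ≠ v) ∨ (y ≠ u ∧ y ≠ v)) : e ≠ f := by
  rintro rfl
  rcases j with ⟨rfl, rfl⟩ | ⟨rfl, rfl⟩ <;> rcases jc with ⟨kd, ke⟩ | ⟨kd, ke⟩ <;> simp_all

/-- cycle given by listed sum -/
theorem cyc_sum {z : E → K} (l : List E) (hz : ∀ x, z x = (l.map (fun e => dl e x)).sum)
    (H : ∀ h : L → K, (l.map (fun e => h (src σ node e) + h (tgt σ node e))).sum = 0) :
    Cyc (src σ node) (tgt σ node) z := by
  intro h
  rw [← H h]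
  simp_rw [hz]
  clear hz H
  induction l with
  | nil => simp
  | cons a l ih =>
    simp only [List.map_cons, List.sum_cons, add_mul, Finset.sum_add_distrib]
    rw [ih, di]

theorem PreP.avoid' (P : PreP σ node live 0) (z : E → K) (n : L) (l : List E)
    (hz : ∀ x, z x = (l.map (fun e => dl e x)).sum)
    (H : ∀ h : L → K, (l.map (fun e => h (src σ node e) + h (tgt σ node e))).sum = 0)
    (hn : ∀ e ∈ l, ¬ Inc σ node e n) :
    ∃ S : T → K, (∀ e ∈ live, S (lf σ e) + S (rt σ e) = z e) ∧ ∀ t, Tch node t n → S t = 0 := by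
  apply P.avoid z (cyc_sum l hz H)
  intro e he hi
  rw [hz]
  apply List.sum_eq_zero
  intro x hx
  simp only [List.mem_map] at hx
  obtain ⟨f, hf, rfl⟩ := hx
  apply dd
  rintro rfl
  exact hn _ hf hi

theorem four_ne (P : PreP σ node live g) {a b c d : L} {e f : E} (je : Jn σ node e a c) (jf : Jn σ node f c b)
    (hab : a ≠ b) (hac : a ≠ c) : ¬ Cyc (src σ node) (tgt σ node) (fun x => dl e x + dl f x) := by
  intro h
  obtain ⟨δ, hδ⟩ : ∃ δ : L → K, ∀ x, δ x = if x = a then 1 else 0 := ⟨_, fun _ => rfl⟩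
  have := h δ
  simp only [add_mul, Finset.sum_add_distrib, di] at this
  rw [je.sum, jf.sum] at this
  simp [hδ, hac.symm, hab.symm] at this

/-- theta with three two-edge paths -/
theorem PreP.tg (P : PreP σ node live 0) {a b c d k : L} (hab : a ≠ b) (hac : a ≠ c) (had : a ≠ d)
    (hak : a ≠ k) (hbc : b ≠ c) (hbd : b ≠ d) (hbk : b ≠ k) (hcd : c ≠ d) (hck : c ≠ k) (hdk : d ≠ k)
    {ac bc ad bd ak bk : E} (jac : Jn σ node ac a c) (jbc : Jn σ node bc b c)
    (jad : Jn σ node ad a d) (jbd : Jn σ node bd b d) (jak : Jn σ node ak a k) (jbk : Jn σ node bk b k) :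
    ∃ Sg Sf Se : T → K, (∀ t, Sg t + Sf t + Se t = 1) ∧ (∀ t, Tch node t c → Sg t = 0) ∧
      (∀ t, Tch node t d → Sf t = 0) ∧ (∀ t, Tch node t k → Se t = 0) ∧
      (∀ e ∈ live, Sg (lf σ e) + Sg (rt σ e) = dl ad e + dl bd e + (dl ak e + dl bk e)) ∧
      (∀ e ∈ live, Sf (lf σ e) + Sf (rt σ e) = dl ac e + dl bc e + (dl ak e + dl bk e)) ∧
      (∀ e ∈ live, Se (lf σ e) + Se (rt σ e) = dl ac e + dl bc e + (dl ad e + dl bd e)) := by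
  have hsum : ∀ x y u v : K, x + u + (y + u + (x + v + (y + v + 0))) = 0 := by decide
  obtain ⟨Sg, df, zd⟩ := P.avoid' (fun e => dl ad e + dl bd e + (dl ak e + dl bk e)) c [ad, bd, ak, bk]
    (by intro x; simp; ring) (by intro h; simp [jad.sum, jbd.sum, jak.sum, jbk.sum]; simpa using hsum _ _ _ _)
    (by simp [jad.inc, jbd.inc, jak.inc, jbk.inc]; tauto)
  obtain ⟨Sf, dg, ze⟩ := P.avoid' (fun e => dl ac e + dl bc e + (dl ak e + dl bk e)) d [ac, bc, ak, bk]
    (by intro x; simp; ring) (by intro h; simp [jac.sum, jbc.sum, jak.sum, jbk.sum]; simpa using hsum _ _ _ _)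
    (by simp [jac.inc, jbc.inc, jak.inc, jbk.inc]; tauto)
  obtain ⟨Se, de, zf⟩ := P.avoid' (fun e => dl ac e + dl bc e + (dl ad e + dl bd e)) k [ac, bc, ad, bd]
    (by intro x; simp; ring) (by intro h; simp [jac.sum, jbc.sum, jad.sum, jbd.sum]; simpa using hsum _ _ _ _)
    (by simp [jac.inc, jbc.inc, jad.inc, jbd.inc]; tauto)
  refine ⟨Sg, Sf, Se, ?_, zd, ze, zf, df, dg, de⟩
  have key : ∀ {x y u v : E}, x ≠ u → x ≠ v → y ≠ u → y ≠ v → ∀ e,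
      (dl x e + dl y e) * (dl u e + dl v e) = 0 := by
    intro x y u v kd ke kf ki e
    rw [add_mul, mul_add, mul_add, dh kd, dh ke, dh kf, dh ki]; simp
  have zz : ∀ {x y : E} {S : T → K} {n : L}, (∀ t, Tch node t n → S t = 0) → Inc σ node x n → Inc σ node y n →
      ∀ e ∈ live, dl x e + dl y e ≠ 0 → S (lf σ e) = 0 ∧ S (rt σ e) = 0 := by
    intro x y S n hS hx hy e he hne
    have : e = x ∨ e = y := by
      by_contra hno
      push Not at hno
      rw [dd hno.1, dd hno.2] at hne
      simp at hne
    rcases this with rfl | rfl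
    · exact ⟨hS _ (P.ia hx), hS _ (P.ic hx)⟩
    · exact ⟨hS _ (P.ia hy), hS _ (P.ic hy)⟩
  apply P.theta (fun e => dl ac e + dl bc e) (fun e => dl ad e + dl bd e) (fun e => dl ak e + dl bk e)
  · exact key (jac.ne jad (by tauto)) (jac.ne jbd (by tauto)) (jbc.ne jad (by tauto)) (jbc.ne jbd (by tauto))
  · exact key (jac.ne jak (by tauto)) (jac.ne jbk (by tauto)) (jbc.ne jak (by tauto)) (jbc.ne jbk (by tauto))
  · exact key (jad.ne jak (by tauto)) (jad.ne jbk (by tauto)) (jbd.ne jak (by tauto)) (jbd.ne jbk (by tauto))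
  · exact df
  · exact dg
  · exact de
  · exact zz zd (by simp [jac.inc]) (by simp [jbc.inc])
  · exact zz ze (by simp [jad.inc]) (by simp [jbd.inc])
  · exact zz zf (by simp [jak.inc]) (by simp [jbk.inc])
  · exact four_ne (d := d) P jac jbc.symm hab hac

theorem PreP.no_k33 (P : PreP σ node live 0) {a b x c d k : L} (hab : a ≠ b) (hac : a ≠ c) (had : a ≠ d)
    (hak : a ≠ k) (hbc : b ≠ c) (hbd : b ≠ d) (hbk : b ≠ k) (hcd : c ≠ d) (hck : c ≠ k) (hdk : d ≠ k)
    (hxa : x ≠ a) (hxb : x ≠ b) (hxc : x ≠ c) (hxd : x ≠ d) (hxk : x ≠ k)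
    {ac bc ad bd ak bk xc xd xk : E} (jac : Jn σ node ac a c) (jbc : Jn σ node bc b c)
    (jad : Jn σ node ad a d) (jbd : Jn σ node bd b d) (jak : Jn σ node ak a k) (jbk : Jn σ node bk b k)
    (jxc : Jn σ node xc x c) (jxd : Jn σ node xd x d) (jxk : Jn σ node xk x k) : False := by
  obtain ⟨Sg, Sf, Se, hs, zd, ze, zf, df, dg, de⟩ :=
    P.tg hab hac had hak hbc hbd hbk hcd hck hdk jac jbc jad jbd jak jbk
  have st : ∀ {S : T → K} {p q r s e : E} {n : L}, (∀ e ∈ live, S (lf σ e) + S (rt σ e) =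
      dl p e + dl q e + (dl r e + dl s e)) → (∀ t, Tch node t n → S t = 0) →
      ¬ Inc σ node p x → ¬ Inc σ node q x → ¬ Inc σ node r x → ¬ Inc σ node s x →
      Jn σ node e x n → S (lf σ xc) = 0 := by
    intro S p q r s e n hS hz hp hq hr fs he
    rw [P.star S x (ta := lf σ e) _ (P.ia (by simp [jxc.inc])) (P.ia (by simp [he.inc]))]
    · exact hz _ (P.ia (by simp [he.inc]))
    · intro f hf hi
      apply Kb
      rw [hS f hf]
      have : ∀ {p}, ¬ Inc σ node p x → dl p f = 0 := by
        intro p hp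
        apply dd
        rintro rfl
        exact hp hi
      rw [this hp, this hq, this hr, this fs]; simp
  have kd := st df zd (by simp [jad.inc]; tauto) (by simp [jbd.inc]; tauto) (by simp [jak.inc]; tauto)
    (by simp [jbk.inc]; tauto) jxc
  have ke := st dg ze (by simp [jac.inc]; tauto) (by simp [jbc.inc]; tauto) (by simp [jak.inc]; tauto)
    (by simp [jbk.inc]; tauto) jxd
  have kf := st de zf (by simp [jac.inc]; tauto) (by simp [jbc.inc]; tauto) (by simp [jad.inc]; tauto)
    (by simp [jbd.inc]; tauto) jxk
  have := hs (lf σ xc)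
  rw [kd, ke, kf] at this
  simp at this

theorem PreP.cy (P : PreP σ node live 0) {a b c d : L} (hab : a ≠ b) (hac : a ≠ c) (had : a ≠ d)
    (hbc : b ≠ c) (hbd : b ≠ d) (hcd : c ≠ d)
    {ab ac bc ad bd cd : E} (jab : Jn σ node ab a b) (jac : Jn σ node ac a c) (jbc : Jn σ node bc b c)
    (jad : Jn σ node ad a d) (jbd : Jn σ node bd b d) (jcd : Jn σ node cd c d)
    (Se : T → K)
    (de : ∀ e ∈ live, Se (lf σ e) + Se (rt σ e) = dl ac e + dl bc e + (dl ad e + dl bd e))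
    (hl : ab ∈ live) (kd : Se (lf σ ab) = 1) (ke : Se (lf σ cd) = 1) : False := by
  have hsum : ∀ x y u : K, x + y + (x + u + (y + u + 0)) = 0 := by decide
  obtain ⟨Sg, df, zd⟩ := P.avoid' (fun e => dl ab e + (dl ad e + dl bd e)) c [ab, ad, bd]
    (by intro x; simp) (by intro h; simp [jad.sum, jbd.sum, jab.sum]; simpa using hsum _ _ _)
    (by simp [jad.inc, jbd.inc, jab.inc]; tauto)
  obtain ⟨Sf, dg, ze⟩ := P.avoid' (fun e => dl ab e + (dl ac e + dl bc e)) d [ab, ac, bc]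
    (by intro x; simp) (by intro h; simp [jac.sum, jbc.sum, jab.sum]; simpa using hsum _ _ _)
    (by simp [jac.inc, jbc.inc, jab.inc]; tauto)
  have key : ∀ {x u v : E}, x ≠ u → x ≠ v → ∀ e,
      dl x e * (dl u e + dl v e) = 0 := by
    intro x u v kd ke e
    rw [mul_add, dh kd, dh ke]; simp
  have zz : ∀ {x y : E} {S : T → K} {n : L}, (∀ t, Tch node t n → S t = 0) → Inc σ node x n → Inc σ node y n →
      ∀ e ∈ live, dl x e + dl y e ≠ 0 → S (lf σ e) = 0 ∧ S (rt σ e) = 0 := by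
    intro x y S n hS hx hy e he hne
    have : e = x ∨ e = y := by
      by_contra hno
      push Not at hno
      rw [dd hno.1, dd hno.2] at hne
      simp at hne
    rcases this with rfl | rfl
    · exact ⟨hS _ (P.ia hx), hS _ (P.ic hx)⟩
    · exact ⟨hS _ (P.ia hy), hS _ (P.ic hy)⟩
  have dq := jab.ne jac (by tauto)
  have dr := jab.ne jbc (by tauto)
  have ds := jab.ne jad (by tauto)
  have dt := jab.ne jbd (by tauto)
  have hone := Ka 1
  have := P.theta (fun e => dl ab e) (fun e => dl ac e + dl bc e) (fun e => dl ad e + dl bd e)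
    (fun t => 1 + Se t) Sg Sf (key dq dr) (key ds dt)
    (by
      intro e
      rw [add_mul, key (jac.ne jad (by tauto)) (jac.ne jbd (by tauto)),
        key (jbc.ne jad (by tauto)) (jbc.ne jbd (by tauto)), add_zero])
    (by intro e he; rw [← de e he]; linear_combination hone)
    df dg
    (by
      intro e he hne
      have := dl_ne hne
      subst this
      have kf := de e he
      rw [dd dq, dd dr, dd ds, dd dt] at kf
      have ki := Kb (kf.trans (by simp))
      show 1 + Se (lf σ e) = 0 ∧ 1 + Se (rt σ e) = 0
      rw [← ki, kd]
      exact ⟨Ka 1, Ka 1⟩)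
    (zz zd (by simp [jac.inc]) (by simp [jbc.inc]))
    (zz ze (by simp [jad.inc]) (by simp [jbd.inc]))
    (by
      intro h
      obtain ⟨δ, hδ⟩ : ∃ δ : L → K, ∀ x, δ x = if x = a then 1 else 0 := ⟨_, fun _ => rfl⟩
      have := h δ
      simp only [di] at this
      rw [jab.sum] at this
      simp [hδ, hab.symm] at this) (lf σ cd)
  rw [ke, zd _ (P.ia (by simp [jcd.inc])), ze _ (P.ia (by simp [jcd.inc]))] at this
  simp [hone] at this

theorem PreP.no_k5 (P : PreP σ node live 0) {a b c d k : L} (hab : a ≠ b) (hac : a ≠ c) (had : a ≠ d)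
    (hak : a ≠ k) (hbc : b ≠ c) (hbd : b ≠ d) (hbk : b ≠ k) (hcd : c ≠ d) (hck : c ≠ k) (hdk : d ≠ k)
    {ab ac bc ad bd ak bk cd ck dk : E} (hl : ab ∈ live) (jab : Jn σ node ab a b)
    (jac : Jn σ node ac a c) (jbc : Jn σ node bc b c)
    (jad : Jn σ node ad a d) (jbd : Jn σ node bd b d) (jak : Jn σ node ak a k) (jbk : Jn σ node bk b k)
    (jcd : Jn σ node cd c d) (jck : Jn σ node ck c k) (jdk : Jn σ node dk d k) : False := by
  obtain ⟨Sg, Sf, Se, hs, zd, ze, zf, df, dg, de⟩ :=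
    P.tg hab hac had hak hbc hbd hbk hcd hck hdk jac jbc jad jbd jak jbk
  have ft : Se (lf σ cd) = 1 := by
    have := hs (lf σ cd)
    rwa [zd _ (P.ia (by simp [jcd.inc])), ze _ (P.ia (by simp [jcd.inc])), zero_add, zero_add] at this
  have fu : Sf (lf σ ck) = 1 := by
    have := hs (lf σ ck)
    rwa [zd _ (P.ia (by simp [jck.inc])), zf _ (P.ia (by simp [jck.inc])), zero_add, add_zero] at this
  have fv : Sg (lf σ dk) = 1 := by
    have := hs (lf σ dk)
    rwa [ze _ (P.ia (by simp [jdk.inc])), zf _ (P.ia (by simp [jdk.inc])), add_zero, add_zero] at this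
  rcases Kd (Se (lf σ ab)) with kf | kf
  · rcases Kd (Sf (lf σ ab)) with ke | ke
    · have := hs (lf σ ab)
      rw [ke, kf, add_zero, add_zero] at this
      exact P.cy hab had hak hbd hbk hdk jab jad jbd jak jbk jdk Sg df hl this fv
    · exact P.cy hab hac hak hbc hbk hck jab jac jbc jak jbk jck Sf dg hl ke fu
  · exact P.cy hab hac had hbc hbd hcd jab jac jbc jad jbd jcd Se de hl kf ft

end Cx

section Cx
variable {T E L La : Type} [Fintype T] [Fintype E] [Fintype L] [Fintype La]
variable {σ : E × Bool ≃ T × Fin 3} {node : T → Fin 3 → L} {live : Finset E} {g : ℕ}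

theorem PreP.jh (P : PreP σ node live g) {e : E} {x y : L} (j : Jn σ node e x y) (h : x ≠ y) :
    e ∈ live := by
  by_contra hl
  have := P.dead e hl
  rcases j with ⟨rfl, rfl⟩ | ⟨rfl, rfl⟩
  · exact h this
  · exact h this.symm

theorem PreP.td (P : PreP σ node live g) {t : T} {x y : L} (hx : Tch node t x) (hy : Tch node t y)
    (h : x ≠ y) : ∃ e, Jn σ node e x y := by
  obtain ⟨i, rfl⟩ := hx
  obtain ⟨j, rfl⟩ := hy
  have hij : i ≠ j := fun kj => h (by rw [kj])
  have : j = i + 1 ∨ i = j + 1 := by clear h; revert i j; decide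
  rcases this with rfl | rfl
  · refine ⟨side σ t i, ?_⟩
    rcases P.sa t i with ⟨kd, ke⟩ | ⟨kd, ke⟩
    · exact Or.inl ⟨kd.symm, ke.symm⟩
    · exact Or.inr ⟨ke.symm, kd.symm⟩
  · refine ⟨side σ t j, ?_⟩
    rcases P.sa t j with ⟨kd, ke⟩ | ⟨kd, ke⟩
    · exact Or.inr ⟨kd.symm, ke.symm⟩
    · exact Or.inl ⟨ke.symm, kd.symm⟩

theorem not_jn_of {e : E} {x y u v : L} (j : Jn σ node e x y)
    (h : (x ≠ u ∧ x ≠ v) ∨ (y ≠ u ∧ y ≠ v)) : ¬ Jn σ node e u v := fun jc => j.ne jc h rfl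

theorem Jn.unique {e : E} {a x b : L} (j : Jn σ node e a x) (jc : Jn σ node e a b) : x = b := by
  rcases j with ⟨kd, ke⟩ | ⟨kd, ke⟩ <;> rcases jc with ⟨kf, ki⟩ | ⟨kf, ki⟩
  · exact ke.symm.trans ki
  · rw [← ke, ki, ← kf, kd]
  · rw [← kd, kf, ← ki, ke]
  · exact kd.symm.trans kf

theorem PreP.parity (P : PreP σ node live 0) {a b c k : L} (hab : a ≠ b) (hac : a ≠ c) (hak : a ≠ k)
    (hbc : b ≠ c) (hbk : b ≠ k) (hck : c ≠ k) {ab bc ca ka kb kc : E}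
    (jab : Jn σ node ab a b) (jbc : Jn σ node bc b c) (jca : Jn σ node ca c a)
    (jka : Jn σ node ka k a) (jkb : Jn σ node kb k b) (jkc : Jn σ node kc k c)
    (hk : ∀ e x, Jn σ node e k x → x = a ∨ x = b ∨ x = c ∨ x = k)
    (R : T → K) (hR : ∀ t, R t = if Tch node t k then 1 else 0) :
    ∑ e, (if Jn σ node e a b then 1 else 0) * (R (lf σ e) + R (rt σ e)) = 1 := by
  have hsum : ∀ x y u : K, u + x + (u + y + (x + y + 0)) = 0 := by decide
  obtain ⟨Sc, dc, zc⟩ := P.avoid' (fun e => dl ka e + (dl kb e + dl ab e)) c [ka, kb, ab]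
    (by intro x; simp) (by intro h; simp [jka.sum, jkb.sum, jab.sum]; simpa using hsum _ _ _)
    (by simp [jka.inc, jkb.inc, jab.inc]; tauto)
  obtain ⟨Sa, da, za⟩ := P.avoid' (fun e => dl kb e + (dl kc e + dl bc e)) a [kb, kc, bc]
    (by intro x; simp) (by intro h; simp [jkb.sum, jkc.sum, jbc.sum]; simpa using hsum _ _ _)
    (by simp [jkb.inc, jkc.inc, jbc.inc]; tauto)
  obtain ⟨Sb, db, zb⟩ := P.avoid' (fun e => dl kc e + (dl ka e + dl ca e)) b [kc, ka, ca]
    (by intro x; simp) (by intro h; simp [jka.sum, jkc.sum, jca.sum]; simpa using hsum _ _ _)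
    (by simp [jka.inc, jkc.inc, jca.inc]; tauto)
  have hnk : ∀ {f e : E} {x y : L}, Jn σ node f x y → x ≠ k → y ≠ k → Inc σ node e k → dl f e = 0 := by
    intro f e x y j hx hy hi
    apply dd
    rintro rfl
    rw [j.inc] at hi
    tauto
  have hst : ∀ t ta, Tch node t k → Tch node ta k → Sa t + Sb t + Sc t = Sa ta + Sb ta + Sc ta := by
    intro t ta ht ah
    apply P.star (fun t => Sa t + Sb t + Sc t) k _ ht ah
    intro e he hi
    apply Kb
    have kd := da e he
    have ke := db e he
    have kf := dc e he
    simp only [hnk jab hak hbk hi, hnk jbc hbk hck hi, hnk jca hck hak hi, add_zero] at kd ke kf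
    linear_combination kd + ke + kf + Ka (dl ka e) + Ka (dl kb e) + Ka (dl kc e)
  have Ra : ∀ {t}, Tch node t k → R t = 1 := fun h => by rw [hR, if_pos h]
  have hone : ∀ t, Tch node t k → Sa t + Sb t + Sc t = 1 := by
    intro t ht
    rcases Kd (Sa t + Sb t + Sc t) with km | km
    swap
    · exact km
    exfalso
    have al : ∀ ta, Tch node ta k → Sa ta + Sb ta + Sc ta = 0 := fun ta ah => (hst ta t ah ht).trans km
    obtain ⟨δ, hδ⟩ : ∃ δ : L → K, ∀ x, δ x = if x = k then 1 else 0 := ⟨_, fun _ => rfl⟩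
    have hc := P.bb (fun t => R t * (Sa t * Sb t)) δ
    beta_reduce at hc
    rw [Finset.sum_eq_single kc] at hc
    · rw [jkc.sum, hδ, hδ] at hc
      have hi : Inc σ node kc k := by simp [jkc.inc]
      have hic : Inc σ node kc c := by simp [jkc.inc]
      have hl := P.jh jkc hck.symm
      have kd := da kc hl
      rw [hnk jbc hbk hck hi, dd (jkc.ne jkb (by tauto))] at kd
      simp only [dl, if_true] at kd
      have ke := al _ (P.ia hi)
      have kf := al _ (P.ic hi)
      rw [zc _ (P.ia hic), add_zero] at ke
      rw [zc _ (P.ic hic), add_zero] at kf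
      rw [Ra (P.ia hi), Ra (P.ic hi), ← Kb ke, ← Kb kf] at hc
      have : ∀ x : K, x * x = x := by decide
      simp only [this, one_mul, kd] at hc
      simp [hck] at hc
    · intro e _ hne
      by_cases he : e ∈ live
      swap
      · rw [P.dead e he, Ka, mul_zero]
      by_cases hi : Inc σ node e k
      · rw [Ra (P.ia hi), Ra (P.ic hi)]
        have kd := da e he
        have ke := db e he
        rw [hnk jbc hbk hck hi, dd hne] at kd
        rw [hnk jca hck hak hi, dd hne] at ke
        by_cases hb : e = kb
        · have hib : Inc σ node e b := by rw [hb]; simp [jkb.inc]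
          rw [zb _ (P.ia hib), zb _ (P.ic hib)]; simp
        by_cases ha : e = ka
        · have hia : Inc σ node e a := by rw [ha]; simp [jka.inc]
          rw [za _ (P.ia hia), za _ (P.ic hia)]; simp
        rw [dd hb] at kd
        rw [dd ha] at ke
        rw [Kb (kd.trans (by simp)), Kb (ke.trans (by simp)), Ka, zero_mul]
      · have kd : src σ node e ≠ k ∧ tgt σ node e ≠ k := not_or.mp hi
        rw [hδ, hδ, if_neg kd.1, if_neg kd.2]; simp
    · simp
  have hRs : ∀ t, R t = R t * Sa t + R t * Sb t + R t * Sc t := by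
    intro t
    by_cases ht : Tch node t k
    · rw [← mul_add, ← mul_add, hone t ht, mul_one]
    · simp [hR, ht]
  obtain ⟨δ, hδ⟩ : ∃ δ : L → K, ∀ x, δ x = if x = a then 1 else 0 := ⟨_, fun _ => rfl⟩
  have hc := P.bb (fun t => R t * Sc t) δ
  have hterm : ∀ e, (R (lf σ e) * Sc (lf σ e) + R (rt σ e) * Sc (rt σ e)) *
      (δ (src σ node e) + δ (tgt σ node e)) =
      (if Jn σ node e a b then 1 else 0) * (R (lf σ e) + R (rt σ e)) + dl ka e * 1 := by
    intro e
    have hRab : (if Jn σ node e a b then 1 else 0) * (R (lf σ e) + R (rt σ e)) =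
      (if Jn σ node e a b then 1 else 0) * (R (lf σ e) * Sc (lf σ e) + R (rt σ e) * Sc (rt σ e)) := by
      split_ifs with hj
      · have hia : Inc σ node e a := by simp [hj.inc]
        have hib : Inc σ node e b := by simp [hj.inc]
        conv_lhs => rw [hRs (lf σ e), hRs (rt σ e)]
        rw [za _ (P.ia hia), za _ (P.ic hia), zb _ (P.ia hib), zb _ (P.ic hib)]
        simp
      · simp
    rw [hRab]
    by_cases he : e ∈ live
    swap
    · rw [P.dead e he, Ka, dd, if_neg]
      · simp
      · intro j; exact he (P.jh j hab)
      · rintro rfl; exact he (P.jh jka hak.symm)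
    by_cases hi : Inc σ node e a
    swap
    · have kd : src σ node e ≠ a ∧ tgt σ node e ≠ a := not_or.mp hi
      rw [hδ, hδ, if_neg kd.1, if_neg kd.2, dd, if_neg]
      · simp
      · intro j; exact hi (by simp [j.inc])
      · rintro rfl; exact hi (by simp [jka.inc])
    obtain ⟨x, jx⟩ : ∃ x, Jn σ node e a x := by
      rcases hi with h | h
      · exact ⟨_, Or.inl ⟨h, rfl⟩⟩
      · exact ⟨_, Or.inr ⟨rfl, h⟩⟩
    rw [jx.sum, hδ, hδ, if_pos rfl]
    by_cases hxb : x = b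
    · subst hxb
      rw [if_pos jx, if_neg hab.symm, dd (jx.ne jka (by tauto))]; ring
    have hnj : ¬ Jn σ node e a b := fun j => hxb (jx.unique j)
    rw [if_neg hnj]
    by_cases hxk : x = k
    · subst hxk
      have kt : Inc σ node e x := by simp [jx.inc]
      have kd := dc e he
      rw [dd (jx.ne jkb (by tauto)), dd (jx.ne jab (by tauto))] at kd
      rw [Ra (P.ia kt), Ra (P.ic kt), one_mul, one_mul, kd, if_neg hak.symm]
      ring
    rw [dd (by rintro rfl; exact hxk (jx.unique jka.symm))]
    by_cases hxc : x = c
    · subst hxc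
      have kt : Inc σ node e x := by simp [jx.inc]
      rw [zc _ (P.ia kt), zc _ (P.ic kt)]; simp
    by_cases hxa : x = a
    · rw [if_pos hxa, Ka]; simp
    have hx : Inc σ node e x := by simp [jx.inc]
    have km : ∀ t, Tch node t x → R t = 0 := by
      intro t ht
      rw [hR, if_neg]
      intro htk
      obtain ⟨f, jf⟩ := P.td htk ht (Ne.symm hxk)
      have := hk f x jf
      tauto
    rw [km _ (P.ia hx), km _ (P.ic hx)]; simp
  have kd : ∑ e, ((if Jn σ node e a b then 1 else 0) * (R (lf σ e) + R (rt σ e)) + dl ka e * 1) = 0 :=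
    (Finset.sum_congr rfl fun e _ => (hterm e).symm).trans hc
  rw [Finset.sum_add_distrib, di ka (fun _ => 1)] at kd
  exact Kb kd

def AG (σ : E × Bool ≃ T × Fin 3) (node : T → Fin 3 → L) : SimpleGraph L where
  Adj x y := x ≠ y ∧ ∃ e, Jn σ node e x y
  symm := ⟨fun x y h => ⟨h.1.symm, h.2.imp fun e j => j.symm⟩⟩
  loopless := ⟨fun x h => h.1 rfl⟩

/-- connected subset -/
def PC {L : Type} (G : SimpleGraph L) (A : Set L) : Prop :=
  ∀ x ∈ A, ∀ y ∈ A, ∀ p : L → Prop, p x → (∀ u ∈ A, ∀ v ∈ A, G.Adj u v → p u → p v) → p y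

def SAdj {L : Type} (G : SimpleGraph L) (A B : Set L) : Prop := ∃ a ∈ A, ∃ b ∈ B, G.Adj a b

theorem PreP.cz (P : PreP σ node live 0) {k : ℕ} (A : Fin k → Set L)
    (hd : ∀ i j x, x ∈ A i → x ∈ A j → i = j) (hA : ∀ i, PC (AG σ node) (A i)) :
    ∃ blk : L → L ⊕ Fin k, (∀ x i, x ∈ A i → blk x = Sum.inr i) ∧
      (∀ x i, blk x = Sum.inr i → x ∈ A i) ∧
      ∃ lb, PreP σ (fun t i => blk (node t i)) lb 0 := by
  let blk : L → L ⊕ Fin k := fun x => if h : ∃ i, x ∈ A i then Sum.inr h.choose else Sum.inl x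
  have kd : ∀ x i, x ∈ A i → blk x = Sum.inr i := by
    intro x i hx
    have h : ∃ i, x ∈ A i := ⟨i, hx⟩
    simp only [blk, dif_pos h]
    rw [hd _ _ x h.choose_spec hx]
  have ke : ∀ x i, blk x = Sum.inr i → x ∈ A i := by
    intro x i hx
    by_cases h : ∃ i, x ∈ A i
    · simp only [blk, dif_pos h, Sum.inr.injEq] at hx
      rw [← hx]; exact h.choose_spec
    · simp [blk, dif_neg h] at hx
  refine ⟨blk, kd, ke, ?_⟩
  obtain ⟨la, -, hP, -⟩ := P.contract blk (by
    intro h hh x y hxy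
    by_cases hx : ∃ i, x ∈ A i
    · obtain ⟨i, hi⟩ := hx
      have hy : y ∈ A i := ke y i (by rw [← hxy]; exact kd x i hi)
      apply hA i x hi y hy (fun u => h x = h u) rfl
      rintro u hu v hv ⟨hne, e, j⟩ hxu
      rw [hxu]
      have hl := P.jh j hne
      have := hh e hl
      rcases j with ⟨jg, jd⟩ | ⟨jg, jd⟩
      · rw [jg, jd] at this
        exact this (by rw [kd u i hu, kd v i hv])
      · rw [jg, jd] at this
        exact (this (by rw [kd u i hu, kd v i hv])).symm
    · have au : blk x = Sum.inl x := by simp only [blk, dif_neg hx]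
      by_cases hy : ∃ i, y ∈ A i
      · obtain ⟨i, hi⟩ := hy
        rw [au, kd y i hi] at hxy
        simp at hxy
      · have ky : blk y = Sum.inl y := by simp only [blk, dif_neg hy]
        rw [au, ky, Sum.inl.injEq] at hxy
        rw [hxy])
  exact ⟨la, hP⟩

theorem Jn.map {e : E} {x y : L} (j : Jn σ node e x y) (blk : L → La) {xb ya : La} (hx : blk x = xb)
    (hy : blk y = ya) : Jn σ (fun t i => blk (node t i)) e xb ya := by
  subst hx hy
  rcases j with ⟨rfl, rfl⟩ | ⟨rfl, rfl⟩
  · exact Or.inl ⟨rfl, rfl⟩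
  · exact Or.inr ⟨rfl, rfl⟩

theorem SAdj.jn {A : Fin n → Set L} {blk : L → L ⊕ Fin n} (h : ∀ x i, x ∈ A i → blk x = Sum.inr i)
    {i j : Fin n} (hs : SAdj (AG σ node) (A i) (A j)) :
    ∃ e, Jn σ (fun t i => blk (node t i)) e (Sum.inr i) (Sum.inr j) := by
  obtain ⟨a, ha, b, hb, hne, e, je⟩ := hs
  exact ⟨e, je.map blk (h a i ha) (h b j hb)⟩

theorem PreP.nq (P : PreP σ node live 0) (A : Fin 5 → Set L)
    (hd : ∀ i j x, x ∈ A i → x ∈ A j → i = j) (hA : ∀ i, PC (AG σ node) (A i))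
    (hadj : ∀ i j, i < j → SAdj (AG σ node) (A i) (A j)) : False := by
  obtain ⟨blk, kd, ke, la, Pa⟩ := P.cz A hd hA
  have hne : ∀ i j : Fin 5, i ≠ j → (Sum.inr i : L ⊕ Fin 5) ≠ Sum.inr j := fun i j h kj => h (by simpa using kj)
  have J : ∀ i j : Fin 5, i < j → _ := fun i j h => (hadj i j h).jn kd
  obtain ⟨fw, jl⟩ := J 0 1 (by decide)
  obtain ⟨fx, jm⟩ := J 0 2 (by decide)
  obtain ⟨ei, ji⟩ := J 0 3 (by decide)
  obtain ⟨fy, jo⟩ := J 0 4 (by decide)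
  obtain ⟨eb, jp⟩ := J 1 2 (by decide)
  obtain ⟨ej, jj⟩ := J 1 3 (by decide)
  obtain ⟨fz, jq⟩ := J 1 4 (by decide)
  obtain ⟨ek, jk⟩ := J 2 3 (by decide)
  obtain ⟨ga, jr⟩ := J 2 4 (by decide)
  obtain ⟨e34, js⟩ := J 3 4 (by decide)
  exact Pa.no_k5 (hne 0 1 (by decide)) (hne 0 2 (by decide)) (hne 0 3 (by decide)) (hne 0 4 (by decide))
    (hne 1 2 (by decide)) (hne 1 3 (by decide)) (hne 1 4 (by decide)) (hne 2 3 (by decide)) (hne 2 4 (by decide))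
    (hne 3 4 (by decide)) (Pa.jh jl (hne 0 1 (by decide))) jl jm jp ji jj jo jq jk jr js

/-- sets 0,1,2 against sets 3,4,5 -/
theorem PreP.nr (P : PreP σ node live 0) (A : Fin 6 → Set L)
    (hd : ∀ i j x, x ∈ A i → x ∈ A j → i = j) (hA : ∀ i, PC (AG σ node) (A i))
    (hadj : ∀ i j : Fin 6, i < 3 → 3 ≤ j → SAdj (AG σ node) (A i) (A j)) : False := by
  obtain ⟨blk, kd, ke, la, Pa⟩ := P.cz A hd hA
  have hne : ∀ i j : Fin 6, i ≠ j → (Sum.inr i : L ⊕ Fin 6) ≠ Sum.inr j := fun i j h kj => h (by simpa using kj)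
  have J : ∀ i j : Fin 6, i < 3 → 3 ≤ j → _ := fun i j h kj => (hadj i j h kj).jn kd
  obtain ⟨ei, ji⟩ := J 0 3 (by decide) (by decide)
  obtain ⟨fy, jo⟩ := J 0 4 (by decide) (by decide)
  obtain ⟨e05, jt⟩ := J 0 5 (by decide) (by decide)
  obtain ⟨ej, jj⟩ := J 1 3 (by decide) (by decide)
  obtain ⟨fz, jq⟩ := J 1 4 (by decide) (by decide)
  obtain ⟨e15, ju⟩ := J 1 5 (by decide) (by decide)
  obtain ⟨ek, jk⟩ := J 2 3 (by decide) (by decide)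
  obtain ⟨ga, jr⟩ := J 2 4 (by decide) (by decide)
  obtain ⟨e25, jv⟩ := J 2 5 (by decide) (by decide)
  apply Pa.no_k33 (a := Sum.inr 0) (b := Sum.inr 1) (x := Sum.inr 2) (c := Sum.inr 3) (d := Sum.inr 4)
    (k := Sum.inr 5) (jac := ji) (jbc := jj) (jad := jo) (jbd := jq) (jak := jt) (jbk := ju) (jxc := jk)
    (jxd := jr) (jxk := jv)
  all_goals exact hne _ _ (by decide)

end Cx

section Cx
variable {T E L La : Type} [Fintype T] [Fintype E] [Fintype L] [Fintype La]
variable {σ : E × Bool ≃ T × Fin 3} {node : T → Fin 3 → L} {live : Finset E} {g : ℕ}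

def cw (a b c d : Fin 3) : K := if c = a ∧ d = b then 1 else 0

theorem cw_sum : ∀ c : Fin 3 → Fin 3, (∑ i, (cw 0 1 (c i) (c (i+1)) + cw 0 1 (c (i+1)) (c i)) ≠ 0) →
    ∃ ρ : Fin 3 → Fin 3, ∀ i, c (ρ i) = i := by
  intro c h
  have : ∀ x y z : Fin 3, (cw 0 1 x y + cw 0 1 y x + (cw 0 1 y z + cw 0 1 z y) + (cw 0 1 z x + cw 0 1 x z) ≠ 0)
    → ∃ ρ : Fin 3 → Fin 3, ∀ i, ![x,y,z] (ρ i) = i := by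
    have hh : ∀ x y z : Fin 3, (cw 0 1 x y + cw 0 1 y x + (cw 0 1 y z + cw 0 1 z y) + (cw 0 1 z x + cw 0 1 x z) ≠ 0)
      → ∀ i, ∃ j, ![x,y,z] j = i := by unfold cw; decide
    intro x y z h
    choose ρ hρ using hh x y z h
    exact ⟨ρ, hρ⟩
  have e : c = ![c 0, c 1, c 2] := by ext i; fin_cases i <;> rfl
  rw [e]
  apply this
  simpa [Fin.sum_univ_three] using h

theorem PreP.rainbow (P : PreP σ node live 0) (A : Fin 4 → Set L)
    (hd : ∀ i j x, x ∈ A i → x ∈ A j → i = j) (hA : ∀ i, PC (AG σ node) (A i))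
    (hadj : ∀ i j, i < j → SAdj (AG σ node) (A i) (A j))
    (hk : ∀ x ∈ A 3, ∀ y, (AG σ node).Adj x y → ∃ i, y ∈ A i)
    (χ : L → Fin 3) (hχ : ∀ (i : Fin 3) x, x ∈ A i.castSucc → χ x = i) :
    ∃ n : Fin 3 → L, (∀ i, χ (n i) = i) ∧ (∀ i j, i ≠ j → (AG σ node).Adj (n i) (n j)) ∧ ∃ i, n i ∈ A 3 := by
  obtain ⟨blk, kd, ke, la, Pa⟩ := P.cz A hd hA
  have hne : ∀ i j : Fin 4, i ≠ j → (Sum.inr i : L ⊕ Fin 4) ≠ Sum.inr j := fun i j h kj => h (by simpa using kj)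
  have J : ∀ i j : Fin 4, i < j → _ := fun i j h => (hadj i j h).jn kd
  obtain ⟨fw, jl⟩ := J 0 1 (by decide)
  obtain ⟨fx, jm⟩ := J 0 2 (by decide)
  obtain ⟨ei, ji⟩ := J 0 3 (by decide)
  obtain ⟨eb, jp⟩ := J 1 2 (by decide)
  obtain ⟨ej, jj⟩ := J 1 3 (by decide)
  obtain ⟨ek, jk⟩ := J 2 3 (by decide)
  have cov : ∀ k ∈ A 3, ∀ y, (∃ t, Tch node t k ∧ Tch node t y) → ∃ i, y ∈ A i := by
    rintro k kz y ⟨t, ht, ah⟩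
    by_cases h : k = y
    · exact ⟨3, h ▸ kz⟩
    · obtain ⟨e, j⟩ := P.td ht ah h
      exact hk k kz y ⟨h, e, j⟩
  have gb : ∀ e x, Jn σ (fun t i => blk (node t i)) e (Sum.inr 3) x → x = Sum.inr 0 ∨ x = Sum.inr 1 ∨ x = Sum.inr 2
      ∨ x = Sum.inr 3 := by
    intro e x j
    have hx : ∃ k y, k ∈ A 3 ∧ blk y = x ∧ Jn σ node e k y := by
      rcases j with ⟨ja, jb⟩ | ⟨ja, jb⟩
      · exact ⟨_, _, ke _ _ ja, jb, Or.inl ⟨rfl, rfl⟩⟩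
      · exact ⟨_, _, ke _ _ jb, ja, Or.inr ⟨rfl, rfl⟩⟩
    obtain ⟨k, y, kz, rfl, jy⟩ := hx
    obtain ⟨i, hi⟩ := cov k kz y ⟨lf σ e, P.ia (by simp [jy.inc]), P.ia (by simp [jy.inc])⟩
    rw [kd y i hi]
    fin_cases i <;> simp
  obtain ⟨R, hR⟩ : ∃ R : T → K, ∀ t, R t = if Tch (fun t i => blk (node t i)) t (Sum.inr 3) then 1 else 0 :=
    ⟨_, fun _ => rfl⟩
  have hpar := Pa.parity (hne 0 1 (by decide)) (hne 0 2 (by decide)) (hne 0 3 (by decide)) (hne 1 2 (by decide))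
    (hne 1 3 (by decide)) (hne 2 3 (by decide)) jl jp jm.symm ji.symm jj.symm jk.symm gb R hR
  let φ : E → K := fun e => cw 0 1 (χ (src σ node e)) (χ (tgt σ node e)) +
      cw 0 1 (χ (tgt σ node e)) (χ (src σ node e))
  have hex := exchange (σ := σ) R φ
  have hφ : ∀ t i, φ (side σ t i) = cw 0 1 (χ (node t i)) (χ (node t (i+1))) +
      cw 0 1 (χ (node t (i+1))) (χ (node t i)) := by
    intro t i
    rcases P.sa t i with ⟨ha, hb⟩ | ⟨ha, hb⟩ <;> simp only [φ, ha, hb]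
    rw [add_comm]
  have hterm : ∀ e, φ e * (R (lf σ e) + R (rt σ e)) =
      (if Jn σ (fun t i => blk (node t i)) e (Sum.inr 0) (Sum.inr 1) then 1 else 0) * (R (lf σ e) + R (rt σ e)) := by
    intro e
    by_cases heq : R (lf σ e) = R (rt σ e)
    · rw [heq, Ka]; simp
    congr 1
    have hts : ∃ t, Tch (fun t i => blk (node t i)) t (Sum.inr 3) ∧ Tch node t (src σ node e) ∧
        Tch node t (tgt σ node e) := by
      by_cases hl : Tch (fun t i => blk (node t i)) (lf σ e) (Sum.inr 3)
      · exact ⟨_, hl, P.sg e, P.te e⟩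
      · refine ⟨rt σ e, ?_, P.si e, P.tf e⟩
        by_contra hr
        exact heq (by rw [hR, hR, if_neg hl, if_neg hr])
    obtain ⟨t, ⟨i, hi⟩, hs, ht⟩ := hts
    have kz := ke _ _ hi
    have hni : ∀ x, Inc σ node e x → x ∉ A 3 := by
      intro x hx gc
      apply heq
      have au : ∀ t, Tch node t x → R t = 1 := by
        rintro t ⟨i, hi⟩
        rw [hR, if_pos]
        exact ⟨i, by simp only [hi]; exact kd x 3 gc⟩
      rw [au _ (P.ia hx), au _ (P.ic hx)]
    have key : ∀ x, Inc σ node e x → Tch node t x → blk x = Sum.inr (χ x).castSucc := by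
      intro x hx htx
      obtain ⟨j, hj⟩ := cov _ kz x ⟨t, ⟨i, rfl⟩, htx⟩
      have : j ≠ 3 := by rintro rfl; exact hni x hx hj
      obtain ⟨jc, rfl⟩ : ∃ jc : Fin 3, j = jc.castSucc := by
        clear hj; revert j; decide
      rw [kd x _ hj, hχ jc x hj]
    have kg := key _ (Or.inl rfl) hs
    have kh := key _ (Or.inr rfl) ht
    have ps : src σ (fun t i => blk (node t i)) e = blk (src σ node e) := rfl
    have pt : tgt σ (fun t i => blk (node t i)) e = blk (tgt σ node e) := rfl
    simp only [Jn, ps, pt, kg, kh, φ]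
    have gd : (0 : Fin 4) = (0 : Fin 3).castSucc := rfl
    have ci : (1 : Fin 4) = (1 : Fin 3).castSucc := rfl
    rw [gd, ci]
    simp only [Sum.inr.injEq, Fin.castSucc_inj]
    generalize χ (src σ node e) = p
    generalize χ (tgt σ node e) = q
    have : ∀ p q : Fin 3, cw 0 1 p q + cw 0 1 q p = if (p = 0 ∧ q = 1) ∨ (p = 1 ∧ q = 0) then 1 else 0 := by
      unfold cw; decide
    rw [this]
  rw [Finset.sum_congr rfl fun e _ => hterm e, hpar] at hex
  obtain ⟨t, ht⟩ : ∃ t, R t * ∑ i, φ (side σ t i) ≠ 0 := by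
    by_contra hall
    push Not at hall
    rw [Finset.sum_eq_zero fun t _ => hall t] at hex
    exact zero_ne_one hex
  have du := left_ne_zero_of_mul ht
  have dv := right_ne_zero_of_mul ht
  simp only [hφ] at dv
  obtain ⟨ρ, hρ⟩ := cw_sum (fun i => χ (node t i)) dv
  have htK : Tch (fun t i => blk (node t i)) t (Sum.inr 3) := by
    by_contra h
    rw [hR, if_neg h] at du
    exact du rfl
  obtain ⟨i, hi⟩ := htK
  have hnode : ∀ i j, i ≠ j → node t (ρ i) ≠ node t (ρ j) := by
    intro i j hij h
    apply hij
    rw [← hρ i, ← hρ j]; simp only [h]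
  refine ⟨fun i => node t (ρ i), hρ, fun i j hij => ⟨hnode i j hij, P.td ⟨_, rfl⟩ ⟨_, rfl⟩ (hnode i j hij)⟩, ?_⟩
  have hinj : Function.Injective ρ := fun i j h => by rw [← hρ i, ← hρ j, h]
  obtain ⟨j, rfl⟩ := (Finite.injective_iff_surjective.mp hinj) i
  exact ⟨j, ke _ _ hi⟩

end Cx

section TSsec
theorem fh : ∀ k : Fin 2, k = 0 ∨ k = 1 := by decide

variable {V E F : Type} [Fintype V] [Fintype E] [Fintype F]

def cn {F : Type} (s : F × Fin 3) (j : Bool) : F × Fin 3 := (s.1, bif j then s.2 + 1 else s.2)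
def nd {F V : Type} (node : F → Fin 3 → V) (c : F × Fin 3) : V := node c.1 c.2

structure TS (σ : E × Bool ≃ F × Fin 3) (node : F → Fin 3 → V) : Prop where
  compat : ∀ e, (nd node (cn (σ (e, true)) false) = nd node (cn (σ (e, false)) false) ∧
      nd node (cn (σ (e, true)) true) = nd node (cn (σ (e, false)) true)) ∨
    (nd node (cn (σ (e, true)) false) = nd node (cn (σ (e, false)) true) ∧
      nd node (cn (σ (e, true)) true) = nd node (cn (σ (e, false)) false))
  link : ∀ p : F × Fin 3 → Prop, (∀ e j jc, nd node (cn (σ (e, false)) j) = nd node (cn (σ (e, true)) jc) →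
      (p (cn (σ (e, false)) j) ↔ p (cn (σ (e, true)) jc))) → ∀ c cb, nd node c = nd node cb → p c → p cb
  surj : ∀ v, ∃ c, nd node c = v
  conn : ∀ p : V → Prop, (∀ f i j, p (node f i) → p (node f j)) → ∀ u v, p u → p v
  euler : Fintype.card V + Fintype.card F = Fintype.card E + 2

def TAdj (node : F → Fin 3 → V) (u v : V) : Prop := ∃ f i, (node f i = u ∧ node f (i+1) = v) ∨ (node f i = v ∧ node f (i+1) = u)

theorem TAdj.symm {node : F → Fin 3 → V} {u v : V} (h : TAdj node u v) : TAdj node v u := by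
  obtain ⟨f, i, h⟩ := h; exact ⟨f, i, h.symm⟩

theorem TS.ext {σ : E × Bool ≃ F × Fin 3} {node : F → Fin 3 → V} (S : TS σ node)
    (na : F ⊕ Fin 2 → Fin 3 → Option V) (r κ : F × Fin 3 → (F ⊕ Fin 2) × Fin 3)
    (tb : Fin 3 → Bool → (F ⊕ Fin 2) × Fin 3)
    (hri : Function.Injective r) (hti : ∀ k b kv ba, tb k b = tb kv ba → k = kv ∧ b = ba)
    (hrt : ∀ s k b, r s ≠ tb k b)
    (hr : ∀ s j, nd na (cn (r s) j) = some (nd node (cn s j)))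
    (hκ : ∀ c, nd na (κ c) = some (nd node c))
    (hc : ∀ k, nd na (cn (tb k true) false) = nd na (cn (tb k false) true) ∧
      nd na (cn (tb k true) true) = nd na (cn (tb k false) false) ∨ 
      nd na (cn (tb k true) false) = nd na (cn (tb k false) false) ∧
      nd na (cn (tb k true) true) = nd na (cn (tb k false) true))
    (hl : ∀ p : (F ⊕ Fin 2) × Fin 3 → Prop, (∀ k j jc, nd na (cn (tb k false) j) = nd na (cn (tb k true) jc) →
      (p (cn (tb k false) j) ↔ p (cn (tb k true) jc))) →
      (∀ s j, p (κ (cn s j)) ↔ p (cn (r s) j)) ∧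
      (∀ cb v, nd na cb = some v → ∃ c, nd node c = v ∧ (p cb ↔ p (κ c))) ∧
      (∀ c cb, nd na c = none → nd na cb = none → (p c → p cb)))
    (hconn : ∀ p : Option V → Prop, (∀ f i j, p (na f i) → p (na f j)) →
      (∀ f i j, p (some (node f i)) → p (some (node f j))) ∧ ∃ v, p none ↔ p (some v)) 
    (hn : ∃ c, nd na c = none) :
    ∃ kr : (E ⊕ Fin 3) × Bool ≃ (F ⊕ Fin 2) × Fin 3, TS kr na := by
  let sd : (E ⊕ Fin 3) × Bool → (F ⊕ Fin 2) × Fin 3 := fun x => match x with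
    | (Sum.inl e, b) => r (σ (e, b))
    | (Sum.inr k, b) => tb k b
  have hcard : Fintype.card E * 2 = Fintype.card F * 3 := by
    have := Fintype.card_congr σ
    simpa using this
  have hbij : Function.Bijective sd := by
    rw [Fintype.bijective_iff_injective_and_card]
    refine ⟨?_, by simp; omega⟩
    rintro ⟨e | k, b⟩ ⟨ea | kv, ba⟩ h
    · have := σ.injective (hri h)
      simp at this; simp [this]
    · exact (hrt _ _ _ h).elim
    · exact (hrt _ _ _ h.symm).elim
    · have := hti _ _ _ _ h
      simp [this]
  refine ⟨Equiv.ofBijective sd hbij, ?_, ?_, ?_, ?_, ?_⟩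
  · rintro (e | k)
    · simp only [Equiv.ofBijective_apply, sd, hr]
      rcases S.compat e with ⟨kd, ke⟩ | ⟨kd, ke⟩ <;> simp [kd, ke]
    · exact (hc k).symm
  · intro p hp
    obtain ⟨kd, ke, kf⟩ := hl p (fun k j jc h => hp (Sum.inr k) j jc h)
    have ki := S.link (fun c => p (κ c)) (by
      intro e j jc h
      rw [kd, kd]
      exact hp (Sum.inl e) j jc (by simp only [Equiv.ofBijective_apply, sd, hr, h]))
    intro c cb hcc hpc
    rcases hv : nd na c with _ | v
    · exact kf c cb hv (hcc ▸ hv) hpc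
    · obtain ⟨a, ha, bl⟩ := ke c v hv
      obtain ⟨b, hb, am⟩ := ke cb v (hcc ▸ hv)
      rw [am]
      rw [bl] at hpc
      exact ki a b (ha.trans hb.symm) hpc
  · rintro (_ | v)
    · exact hn
    · obtain ⟨c, hc⟩ := S.surj v
      exact ⟨κ c, by rw [hκ, hc]⟩
  · intro p hp
    obtain ⟨kd, v0, ke⟩ := hconn p hp
    have kf := S.conn (fun v => p (some v)) kd
    rintro (_ | u) (_ | v) h
    · exact h
    · exact kf _ _ (ke.1 h)
    · exact ke.2 (kf _ _ h)
    · exact kf _ _ h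
  · have := S.euler
    simp; omega

noncomputable def fimg (node : F → Fin 3 → V) (f : F) : Finset V := univ.image (node f)

theorem fimg_vec {α : Type} {U : Type} (node : U → Fin 3 → α) (f : U) (x y z : α) (h : node f = ![x, y, z]) :
    univ.image (node f) = {x, y, z} := by
  rw [h]; ext a; simp [Fin.exists_fin_succ, eq_comm]

theorem TS.stack2 {σ : E × Bool ≃ F × Fin 3} {node : F → Fin 3 → V} (S : TS σ node) (φ : F) (i : Fin 3) :
    ∃ (na : F ⊕ Fin 2 → Fin 3 → Option V) (kr : (E ⊕ Fin 3) × Bool ≃ (F ⊕ Fin 2) × Fin 3), TS kr na ∧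
      (∀ f, na (Sum.inl f) = fun j => some (node f j)) ∧
      (∀ k, na (Sum.inr k) = ![some (node φ i), some (node φ (i+1)), none]) := by
  let na : F ⊕ Fin 2 → Fin 3 → Option V := Sum.elim (fun f j => some (node f j))
    (fun _ => ![some (node φ i), some (node φ (i+1)), none])
  let r : F × Fin 3 → (F ⊕ Fin 2) × Fin 3 := fun s => if s = (φ, i) then (Sum.inr 1, 0) else (Sum.inl s.1, s.2)
  let tb : Fin 3 → Bool → (F ⊕ Fin 2) × Fin 3 := fun k b =>
    ![bif b then (Sum.inr 0, 0) else (Sum.inl φ, i), bif b then (Sum.inr 1, 1) else (Sum.inr 0, 1),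
      bif b then (Sum.inr 1, 2) else (Sum.inr 0, 2)] k
  suffices h : ∃ kr, TS kr na by
    obtain ⟨kr, h⟩ := h
    exact ⟨na, kr, h, fun f => rfl, fun k => rfl⟩
  have hrφ : r (φ, i) = (Sum.inr 1, 0) := by simp [r]
  have hrn : ∀ s, s ≠ (φ, i) → r s = (Sum.inl s.1, s.2) := fun s h => by simp [r, h]
  apply S.ext na r (fun c => (Sum.inl c.1, c.2)) tb
  · intro s sk h
    by_cases kd : s = (φ, i) <;> by_cases ke : sk = (φ, i)
    · rw [kd, ke]
    · rw [kd, hrφ, hrn _ ke] at h; simp at h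
    · rw [ke, hrφ, hrn _ kd] at h; simp at h
    · rw [hrn _ kd, hrn _ ke] at h
      simp at h; exact Prod.ext h.1 h.2
  · intro k b kv ba h
    fin_cases k <;> fin_cases kv <;> cases b <;> cases ba <;> simp [tb] at h ⊢
  · intro s k b h
    by_cases kd : s = (φ, i)
    · rw [kd, hrφ] at h
      fin_cases k <;> cases b <;> simp [tb] at h
    · rw [hrn _ kd] at h
      fin_cases k <;> cases b <;> simp [tb] at h
      exact kd (Prod.ext h.1 h.2)
  · intro s j
    by_cases kd : s = (φ, i)
    · rw [kd, hrφ]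
      cases j <;> simp [cn, nd, na]
    · rw [hrn _ kd]
      cases j <;> simp [cn, nd, na]
  · intro c; rfl
  · intro k
    fin_cases k <;> simp [cn, nd, na, tb]
  · intro p hp
    have al := hp 0 false false (by simp [cn, nd, na, tb])
    have bm := hp 0 true true (by simp [cn, nd, na, tb])
    have bn := hp 1 false false (by simp [cn, nd, na, tb])
    have dw := hp 1 true true (by simp [cn, nd, na, tb])
    have bo := hp 2 true true (by simp [cn, nd, na, tb])
    simp [cn, tb] at al bm bn dw bo
    refine ⟨?_, ?_, ?_⟩
    · intro s j
      by_cases kd : s = (φ, i)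
      · rw [kd, hrφ]
        cases j <;> simp [cn]
        · rw [al, bo]
        · rw [bm, bn]
      · rw [hrn _ kd]
        cases j <;> simp [cn]
    · rintro ⟨f | k, j⟩ v hv
      · exact ⟨(f, j), by simpa [nd, na] using hv, Iff.rfl⟩
      · have hk : k = 0 ∨ k = 1 := fh k
        fin_cases j <;> simp [nd, na] at hv
        · refine ⟨(φ, i), hv, ?_⟩
          rcases hk with rfl | rfl <;> simp [al, bo]
        · refine ⟨(φ, i+1), hv, ?_⟩
          rcases hk with rfl | rfl <;> simp [bm, bn]
    · have : ∀ c, nd na c = none → (p c ↔ p (Sum.inr 1, 2)) := by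
        rintro ⟨f | k, j⟩ hv
        · simp [nd, na] at hv
        · have hk : k = 0 ∨ k = 1 := fh k
          fin_cases j <;> simp [nd, na] at hv
          rcases hk with rfl | rfl <;> simp [dw]
      intro c cb h kj 
      rw [this c h, this cb kj]; exact id
  · intro p hp
    refine ⟨fun f j jc h => hp (Sum.inl f) j jc h, node φ i, ?_⟩
    exact ⟨fun h => hp (Sum.inr 0) 2 0 h, fun h => hp (Sum.inr 0) 0 2 h⟩
  · exact ⟨(Sum.inr 0, 2), rfl⟩

theorem TS.stack3 {σ : E × Bool ≃ F × Fin 3} {node : F → Fin 3 → V} (S : TS σ node) (φ : F) :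
    ∃ (na : F ⊕ Fin 2 → Fin 3 → Option V) (kr : (E ⊕ Fin 3) × Bool ≃ (F ⊕ Fin 2) × Fin 3), TS kr na ∧
      (∀ f, f ≠ φ → na (Sum.inl f) = fun j => some (node f j)) ∧
      (na (Sum.inl φ) = ![some (node φ 0), some (node φ 1), none]) ∧
      (na (Sum.inr 0) = ![some (node φ 1), some (node φ 2), none]) ∧
      (na (Sum.inr 1) = ![some (node φ 2), some (node φ 0), none]) := by
  let na : F ⊕ Fin 2 → Fin 3 → Option V := Sum.elim
    (fun f => if f = φ then ![some (node φ 0), some (node φ 1), none] else fun j => some (node f j))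
    ![![some (node φ 1), some (node φ 2), none], ![some (node φ 2), some (node φ 0), none]]
  let r : F × Fin 3 → (F ⊕ Fin 2) × Fin 3 := fun s => if s.1 = φ then
    ![(Sum.inl φ, 0), (Sum.inr 0, 0), (Sum.inr 1, 0)] s.2 else (Sum.inl s.1, s.2)
  let κ : F × Fin 3 → (F ⊕ Fin 2) × Fin 3 := fun s => if s.1 = φ then
    ![(Sum.inl φ, 0), (Sum.inl φ, 1), (Sum.inr 0, 1)] s.2 else (Sum.inl s.1, s.2)
  let tb : Fin 3 → Bool → (F ⊕ Fin 2) × Fin 3 := fun k b =>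
    ![bif b then (Sum.inr 0, 2) else (Sum.inl φ, 1), bif b then (Sum.inr 1, 1) else (Sum.inl φ, 2),
      bif b then (Sum.inr 1, 2) else (Sum.inr 0, 1)] k
  have nn : ∀ f, f ≠ φ → na (Sum.inl f) = fun j => some (node f j) := fun f h => by simp [na, h]
  have np : na (Sum.inl φ) = ![some (node φ 0), some (node φ 1), none] := by simp [na]
  have ni : na (Sum.inr 0) = ![some (node φ 1), some (node φ 2), none] := rfl
  have ng : na (Sum.inr 1) = ![some (node φ 2), some (node φ 0), none] := rfl
  suffices h : ∃ kr, TS kr na by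
    obtain ⟨kr, h⟩ := h
    exact ⟨na, kr, h, nn, np, ni, ng⟩
  have hrφ : ∀ j, r (φ, j) = ![(Sum.inl φ, 0), (Sum.inr 0, 0), (Sum.inr 1, 0)] j := by simp [r]
  have hrn : ∀ f j, f ≠ φ → r (f, j) = (Sum.inl f, j) := fun s j h => by simp [r, h]
  have hκφ : ∀ j, κ (φ, j) = ![(Sum.inl φ, 0), (Sum.inl φ, 1), (Sum.inr 0, 1)] j := by simp [κ]
  have hκn : ∀ f j, f ≠ φ → κ (f, j) = (Sum.inl f, j) := fun s j h => by simp [κ, h]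
  have eb : (1 : Fin 3) + 1 = 2 := rfl
  have ec : (2 : Fin 3) + 1 = 0 := rfl
  apply S.ext na r κ tb
  · rintro ⟨f, j⟩ ⟨fb, jc⟩ h
    by_cases kd : f = φ <;> by_cases ke : fb = φ
    · subst kd; subst ke
      rw [hrφ, hrφ] at h
      fin_cases j <;> fin_cases jc <;> simp at h ⊢
    · subst kd; rw [hrφ, hrn _ _ ke] at h
      fin_cases j <;> simp at h
      exact (ke h.1.symm).elim
    · subst ke; rw [hrφ, hrn _ _ kd] at h
      fin_cases jc <;> simp at h
      exact (kd h.1).elim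
    · rw [hrn _ _ kd, hrn _ _ ke] at h
      simpa using h
  · intro k b kv ba h
    fin_cases k <;> fin_cases kv <;> cases b <;> cases ba <;> simp [tb] at h ⊢
  · rintro ⟨f, j⟩ k b h
    by_cases kd : f = φ
    · subst kd
      rw [hrφ] at h
      fin_cases j <;> fin_cases k <;> cases b <;> simp [tb] at h
    · rw [hrn _ _ kd] at h
      fin_cases k <;> cases b <;> simp [tb, kd] at h
  · rintro ⟨f, j⟩ b
    by_cases kd : f = φ
    · subst kd
      rw [hrφ]
      fin_cases j <;> cases b <;> simp [cn, nd, np, ni, ng, eb, ec]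
    · rw [hrn _ _ kd]
      cases b <;> simp [cn, nd, nn _ kd]
  · rintro ⟨f, j⟩
    by_cases kd : f = φ
    · subst kd
      rw [hκφ]
      fin_cases j <;> simp [cn, nd, np, ni, ng]
    · rw [hκn _ _ kd]
      simp [nd, nn _ kd]
  · intro k
    fin_cases k <;> simp [cn, nd, np, ni, ng, tb, eb, ec]
  · intro p hp
    have ae := hp 0 false true (by simp [cn, nd, np, ni, ng, tb, eb, ec])
    have aa := hp 0 true false (by simp [cn, nd, np, ni, ng, tb, eb, ec])
    have bf := hp 1 false true (by simp [cn, nd, np, ni, ng, tb, eb, ec])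
    have bg := hp 1 true false (by simp [cn, nd, np, ni, ng, tb, eb, ec])
    have ci := hp 2 false true (by simp [cn, nd, np, ni, ng, tb, eb, ec])
    have cp := hp 2 true false (by simp [cn, nd, np, ni, ng, tb, eb, ec])
    simp [cn, tb, eb, ec] at ae aa bf bg ci cp
    refine ⟨?_, ?_, ?_⟩
    · rintro ⟨f, j⟩ b
      by_cases kd : f = φ
      · subst kd
        rw [hrφ]
        fin_cases j <;> cases b <;> simp [cn, hκφ, eb, ec, ae, aa, bf, bg, ci, cp]
      · cases b <;> simp [cn, hrn _ _ kd, hκn _ _ kd]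
    · rintro ⟨f | k, j⟩ v hv
      · by_cases kd : f = φ
        · subst kd
          fin_cases j <;> simp [nd, np] at hv
          · exact ⟨(f, 0), hv, by simp [hκφ]⟩
          · exact ⟨(f, 1), hv, by simp [hκφ]⟩
        · exact ⟨(f, j), by simpa [nd, nn _ kd] using hv, by rw [hκn _ _ kd]⟩
      · have hk : k = 0 ∨ k = 1 := fh k
        rcases hk with rfl | rfl <;> fin_cases j <;> simp [nd, ni, ng] at hv
        · exact ⟨(φ, 1), hv, by simp [hκφ, ae]⟩
        · exact ⟨(φ, 2), hv, by simp [hκφ]⟩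
        · exact ⟨(φ, 2), hv, by simp [hκφ, ci]⟩
        · exact ⟨(φ, 0), hv, by simp [hκφ, bg]⟩
    · have : ∀ c, nd na c = none → (p c ↔ p (Sum.inr 1, 2)) := by
        rintro ⟨f | k, j⟩ hv
        · by_cases kd : f = φ
          · subst kd
            fin_cases j <;> simp [nd, np] at hv
            simpa using bf
          · simp [nd, nn _ kd] at hv
        · have hk : k = 0 ∨ k = 1 := fh k
          rcases hk with rfl | rfl <;> fin_cases j <;> simp [nd, ni, ng] at hv
          · simpa using cp
          · rfl
      intro c cb h kj 
      rw [this c h, this cb kj]; exact id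
  · intro p hp
    have hφ : ∀ j, p (some (node φ 0)) ↔ p (some (node φ j)) := by
      have xe := hp (Sum.inl φ) 0 1
      have xf := hp (Sum.inl φ) 1 0
      have xg := hp (Sum.inr 1) 0 1
      have xh := hp (Sum.inr 1) 1 0
      simp [np, ng] at xe xf xg xh
      intro j; fin_cases j
      · exact Iff.rfl
      · exact ⟨xe, xf⟩
      · exact ⟨xh, xg⟩
    refine ⟨fun f j jc h => ?_, node φ 0, ?_⟩
    · by_cases kd : f = φ
      · subst kd; rw [← hφ] at h ⊢; exact h
      · have := hp (Sum.inl f) j jc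
        simp [nn _ kd] at this; exact this h
    · have xe := hp (Sum.inl φ) 0 2
      have xf := hp (Sum.inl φ) 2 0
      simp [np] at xe xf
      exact ⟨xf, xe⟩
  · exact ⟨(Sum.inr 0, 2), rfl⟩

end TSsec

section TSsec
variable {V E F : Type} [Fintype V] [Fintype E] [Fintype F]

theorem ts_base : ∃ (σ : Fin 3 × Bool ≃ Fin 2 × Fin 3), TS σ (fun (_ : Fin 2) (i:Fin 3) => i) := by
  let σ : Fin 3 × Bool ≃ Fin 2 × Fin 3 :=
    { toFun := fun x => (bif x.2 then 1 else 0, x.1)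
      invFun := fun y => (y.2, decide (y.1 = 1))
      left_inv := by decide
      right_inv := by decide }
  have hs : ∀ e b, σ (e, b) = (bif b then 1 else 0, e) := fun e b => rfl
  refine ⟨σ, ?_, ?_, fun v => ⟨(0, v), rfl⟩, fun p h u v => h 0 u v, by simp⟩
  · intro e; left; simp [hs, cn, nd]
  · intro p h c cb hc hp
    have kd : ∀ j, p (0, j) ↔ p (1, j) := fun j => h j false false (by simp [hs, cn, nd])
    obtain ⟨k, j⟩ := c
    obtain ⟨kv, jc⟩ := cb
    simp only [nd] at hc
    subst hc
    rcases fh k with rfl | rfl <;> rcases fh kv with rfl | rfl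
    · exact hp
    · exact (kd _).1 hp
    · exact (kd _).2 hp
    · exact hp

def fd (i : ℕ) : Fin 3 := Fin.ofNat 3 i
theorem fk (i : ℕ) : fd (i + 3) = fd i := by simp [fd, Fin.ext_iff]
theorem f3_succ (i : ℕ) : fd (i + 1) = fd i + 1 := by simp [fd, Fin.ext_iff, Fin.val_add]
theorem fi (i : Fin 3) : fd i = i := by simp [fd]
theorem fj {i : ℕ} (h : i < 3) : (fd i : ℕ) = i := by simp [fd, Nat.mod_eq_of_lt h]

def tsG (σ : E × Bool ≃ F × Fin 3) (node : F → Fin 3 → V) : Multigraph V E :=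
  ⟨fun e => s(nd node (cn (σ (e, false)) false), nd node (cn (σ (e, false)) true))⟩

theorem TS.ends {σ : E × Bool ≃ F × Fin 3} {node : F → Fin 3 → V} (S : TS σ node) (s : F × Fin 3) :
    (tsG σ node).ends (σ.symm s).1 = s(nd node (cn s false), nd node (cn s true)) := by
  have h : σ ((σ.symm s).1, (σ.symm s).2) = s := by simp
  simp only [tsG]
  rcases hb : (σ.symm s).2 with _ | _
  · rw [hb] at h; rw [h]
  · rw [hb] at h
    have := S.compat (σ.symm s).1
    rw [h] at this
    rcases this with ⟨kd, ke⟩ | ⟨kd, ke⟩ <;> rw [kd, ke]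
    exact Sym2.eq_swap

def tsB {σ : E × Bool ≃ F × Fin 3} {node : F → Fin 3 → V} (S : TS σ node) (f : F) : (tsG σ node).CWalk where
  len := 3
  len_pos := by decide
  vtx i := node f (fd i)
  edge i := (σ.symm (f, fd i)).1
  vtx_per i := by simp only [fk]
  edge_per i := by simp only [fk]
  compat i := by rw [S.ends]; simp [cn, nd, f3_succ]

theorem TS.embedding {σ : E × Bool ≃ F × Fin 3} {node : F → Fin 3 → V} (S : TS σ node) :
    ∃ emb : (tsG σ node).Embedding F, emb.eulerGenus ≤ 0 := by
  have hne : Nonempty V := by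
    by_contra h
    rw [not_nonempty_iff] at h
    have hF : IsEmpty F := ⟨fun f => h.false (node f 0)⟩
    have := S.euler
    simp at this
  refine ⟨⟨tsB S, ?_, ?_, ?_⟩, ?_⟩
  · rw [SimpleGraph.connected_iff]
    refine ⟨fun u v => ?_, hne⟩
    apply S.conn (fun w => (tsG σ node).simple.Reachable u w) _ u v (SimpleGraph.Reachable.refl _)
    have kd : ∀ f i, (tsG σ node).simple.Reachable (node f i) (node f (i+1)) := by
      intro f i
      by_cases h : node f i = node f (i+1)
      · rw [h]
      · apply SimpleGraph.Adj.reachable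
        exact ⟨h, _, S.ends (f, i)⟩
    have ke : ∀ f i, (tsG σ node).simple.Reachable (node f 0) (node f i) := by
      intro f i
      have a := kd f 0
      have b := kd f 1
      fin_cases i
      · exact SimpleGraph.Reachable.refl _
      · exact a
      · exact a.trans b
    intro f i j h
    exact h.trans ((ke f i).symm.trans (ke f j))
  · intro e
    have : {p : F × ℕ | Multigraph.IsOcc (tsB S) e p} =
        {((σ (e, false)).1, ((σ (e, false)).2 : ℕ)), ((σ (e, true)).1, ((σ (e, true)).2 : ℕ))} := by
      ext ⟨f, i⟩
      simp only [Set.mem_ofPred_eq, Multigraph.IsOcc, tsB, Set.mem_insert_iff, Set.mem_singleton_iff, Prod.mk.injEq]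
      constructor
      · rintro ⟨hi, he⟩
        have h : σ (e, (σ.symm (f, fd i)).2) = (f, fd i) := by rw [← he]; simp
        have hv : (fd i : ℕ) = i := fj hi
        rcases hb : (σ.symm (f, fd i)).2 with _ | _
        · left; rw [hb] at h; rw [h]; simp only [hv]; trivial
        · right; rw [hb] at h; rw [h]; simp only [hv]; trivial
      · rintro (⟨rfl, rfl⟩ | ⟨rfl, rfl⟩)
        · exact ⟨Fin.is_lt _, by simp [fi]⟩
        · exact ⟨Fin.is_lt _, by simp [fi]⟩
    rw [this, Set.ncard_pair]
    intro h
    simp only [Prod.mk.injEq] at h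
    have : σ (e, false) = σ (e, true) := Prod.ext h.1 (Fin.ext h.2)
    simp at this
  · rintro v ⟨f, i⟩ ⟨fb, ib⟩ ⟨hi, hv⟩ ⟨kt, ag⟩
    have key := S.link (fun c => nd node c = v → Relation.EqvGen (Multigraph.CornerLinked (tsB S) v) (f, i) (c.1, (c.2 : ℕ))) (by
      intro e j jc h
      have hcl : nd node (cn (σ (e, false)) j) = v → Multigraph.CornerLinked (tsB S) v
          ((cn (σ (e, false)) j).1, ((cn (σ (e, false)) j).2 : ℕ)) ((cn (σ (e, true)) jc).1, ((cn (σ (e, true)) jc).2 : ℕ)) := by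
        intro dx
        have ge := h ▸ dx
        refine ⟨⟨Fin.is_lt _, ?_⟩, ⟨Fin.is_lt _, ?_⟩, e, ((σ (e, false)).1, ((σ (e, false)).2 : ℕ)),
          ((σ (e, true)).1, ((σ (e, true)).2 : ℕ)), ?_, ⟨Fin.is_lt _, ?_⟩, ⟨Fin.is_lt _, ?_⟩, ⟨rfl, ?_⟩, ⟨rfl, ?_⟩⟩
        · simpa [tsB, nd, fi] using dx
        · simpa [tsB, nd, fi] using ge
        · intro h
          simp only [Prod.mk.injEq] at h
          have : σ (e, false) = σ (e, true) := Prod.ext h.1 (Fin.ext h.2)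
          simp at this
        · simp [tsB, fi]
        · simp [tsB, fi]
        · cases j
          · exact Or.inl rfl
          · right; simp [cn, Fin.val_add, tsB]
        · cases jc
          · exact Or.inl rfl
          · right; simp [cn, Fin.val_add, tsB]
      constructor
      · intro hp ke
        rw [← h] at ke
        exact (hp ke).trans _ _ _ (Relation.EqvGen.rel _ _ (hcl ke))
      · intro hp ke
        exact (hp (h ▸ ke)).trans _ _ _ (Relation.EqvGen.symm _ _ (Relation.EqvGen.rel _ _ (hcl ke))))
    have gf : i < 3 := hi
    have gg : ib < 3 := kt
    have ee : (fd i : ℕ) = i := fj gf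
    have ef : (fd ib : ℕ) = ib := fj gg
    have := key (f, fd i) (fb, fd ib) (hv.trans ag.symm) (fun _ => by
      simp only [ee]; exact Relation.EqvGen.refl _) ag
    simpa only [ef] using this
  · have := S.euler
    simp only [Multigraph.Embedding.eulerGenus, Nat.card_eq_fintype_card]
    omega

theorem TS.tadj {σ : E × Bool ≃ F × Fin 3} {node : F → Fin 3 → V} (S : TS σ node) {u v : V}
    (h : TAdj node u v) (hne : u ≠ v) : (tsG σ node).simple.Adj u v := by
  obtain ⟨f, i, ⟨rfl, rfl⟩ | ⟨rfl, rfl⟩⟩ := h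
  · exact ⟨hne, _, S.ends (f, i)⟩
  · exact ⟨hne, _, (S.ends (f, i)).trans Sym2.eq_swap⟩

end TSsec

section Rec
variable {W : Type} [Fintype W]

def Anc (z : W) (par : W → W) (n a : W) : Prop := Relation.ReflTransGen (fun a b => a ≠ z ∧ par a = b) n a

structure Sys (G : SimpleGraph W) (z : W) (par : W → W) (rk : W → ℕ) (hub nat : W → Prop) (lay : W → ℕ)
    (d q : ℕ) : Prop where
  nq : ∀ A : Fin 5 → Set W, (∀ i j x, x ∈ A i → x ∈ A j → i = j) → (∀ i, PC G (A i)) →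
    (∀ i j, i < j → SAdj G (A i) (A j)) → False
  nr : ∀ A : Fin 6 → Set W, (∀ i j x, x ∈ A i → x ∈ A j → i = j) → (∀ i, PC G (A i)) →
    (∀ i j : Fin 6, i < 3 → 3 ≤ j → SAdj G (A i) (A j)) → False
  rainbow : ∀ A : Fin 4 → Set W, (∀ i j x, x ∈ A i → x ∈ A j → i = j) → (∀ i, PC G (A i)) →
    (∀ i j, i < j → SAdj G (A i) (A j)) → (∀ x ∈ A 3, ∀ y, G.Adj x y → ∃ i, y ∈ A i) →
    ∀ χ : W → Fin 3, (∀ (i : Fin 3) x, x ∈ A i.castSucc → χ x = i) →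
    ∃ n : Fin 3 → W, (∀ i, χ (n i) = i) ∧ (∀ i j, i ≠ j → G.Adj (n i) (n j)) ∧ ∃ i, n i ∈ A 3
  par_adj : ∀ n, n ≠ z → G.Adj n (par n)
  rk_lt : ∀ n, n ≠ z → rk (par n) < rk n
  hub_par : ∀ n, n ≠ z → ¬ hub (par n)
  hub_z : ¬ hub z
  hub_hub : ∀ u v, hub u → hub v → ¬ G.Adj u v
  deg : ∀ v, hub v → (∃ n, G.Adj v n ∧ nat n) → (univ.filter (G.Adj v)).card ≤ d
  anc : ∀ n l, (univ.filter fun a => Anc z par n a ∧ nat a ∧ lay a = l).card ≤ q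
  hd : 3 ≤ d
  hq : 1 ≤ q

def Rc (G : SimpleGraph W) (D : Finset W) (u v : W) : Prop := u ∉ D ∧ v ∉ D ∧ G.Adj u v
def comp (G : SimpleGraph W) (D : Finset W) (x y : W) : Prop := Relation.ReflTransGen (Rc G D) x y
def pt (D : Finset W) (p : W → ℕ) (i : ℕ) : Set W := {n | n ∈ D ∧ p n = i}
noncomputable def att (G : SimpleGraph W) (D : Finset W) (p : W → ℕ) (m : ℕ) (x : W) : Finset ℕ :=
  (range m).filter fun i => ∃ y w, comp G D x y ∧ w ∈ D ∧ G.Adj y w ∧ p w = i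

variable {G : SimpleGraph W} {D : Finset W} {p : W → ℕ} {m : ℕ}

theorem comp.symm {x y : W} (h : comp G D x y) : comp G D y x := by
  induction h with
  | refl => exact Relation.ReflTransGen.refl
  | tail _ h ih => exact Relation.ReflTransGen.head ⟨h.2.1, h.1, h.2.2.symm⟩ ih

theorem comp.notin {x y : W} (h : comp G D x y) (hx : x ∉ D) : y ∉ D := by
  induction h with
  | refl => exact hx
  | tail _ h ih => exact h.2.1

theorem comp.trans {x y w : W} (h : comp G D x y) (kj : comp G D y w) : comp G D x w :=
  Relation.ReflTransGen.trans h kj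

theorem comp.mono {Da : Finset W} (hD : D ⊆ Da) {x y : W} (h : comp G Da x y) : comp G D x y := by
  induction h with
  | refl => exact Relation.ReflTransGen.refl
  | tail _ h ih => exact Relation.ReflTransGen.tail ih ⟨fun a => h.1 (hD a), fun a => h.2.1 (hD a), h.2.2⟩

theorem comp.adj {x y w : W} (h : comp G D x y) (hx : x ∉ D) (hw : w ∉ D) (ha : G.Adj y w) : comp G D x w :=
  Relation.ReflTransGen.tail h ⟨h.notin hx, hw, ha⟩

/-- a set all of whose elements are linked inside it to a center is connected -/
theorem PC.oc {A : Set W} (c : W) (hc : c ∈ A) (h : ∀ x ∈ A, ∀ p : W → Prop, p c →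
    (∀ u ∈ A, ∀ v ∈ A, G.Adj u v → p u → p v) → p x) : PC G A := by
  intro x hx y hy p hpx hp
  have hpc : p c := by
    by_contra hn
    exact h x hx (fun w => ¬ p w) hn (fun u hu v hv huv hnu ag => hnu (hp v hv u hu huv.symm ag)) hpx
  exact h y hy p hpc hp

theorem cr (x : W) (hx : x ∉ D) : PC G {y | comp G D x y} := by
  apply PC.oc x Relation.ReflTransGen.refl
  intro y hy p hpx hp
  have ky : comp G D x y := hy
  clear hy
  induction ky with
  | refl => exact hpx
  | tail kd ke ih => exact hp _ kd _ (kd.tail ke) ke.2.2 ih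

theorem ma {x y w : W} (hlt : ∀ n ∈ D, p n < m) (h : comp G D x y) (hw : w ∈ D) (ha : G.Adj y w) :
    p w ∈ att G D p m x := by
  simp only [att, mem_filter, mem_range]
  exact ⟨hlt w hw, y, w, h, hw, ha, rfl⟩

theorem ap {x : W} {i : ℕ} (h : i ∈ att G D p m x) : SAdj G {y | comp G D x y} (pt D p i) := by
  simp only [att, mem_filter, mem_range] at h
  obtain ⟨_, y, w, kd, ke, kf, ki⟩ := h
  exact ⟨y, kd, w, ⟨ke, ki⟩, kf⟩

theorem SAdj.symm {A B : Set W} (h : SAdj G A B) : SAdj G B A := by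
  obtain ⟨a, ha, b, hb, h⟩ := h
  exact ⟨b, hb, a, ha, h.symm⟩

variable {z : W} {par : W → W} {rk : W → ℕ} {hub nat : W → Prop} {lay : W → ℕ} {d q : ℕ}

theorem legs (S : Sys G z par rk hub nat lay d q) (hz : z ∈ D) (hlt : ∀ n ∈ D, p n < m) :
    ∃ (col : W → ℕ) (leg : W → Finset W), (∀ n ∈ D, col n = p n ∧ leg n = ∅) ∧
      ∀ n, n ∉ D → col n = col (par n) ∧ leg n = insert n (leg (par n)) ∧ (∀ a ∈ leg n, Anc z par n a) ∧
        (∀ a ∈ leg n, comp G D n a) ∧ PC G (leg n : Set W) ∧ SAdj G (leg n : Set W) (pt D p (col n)) ∧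
        (∀ a ∈ leg n, hub a → a = n) := by
  have hex : ∀ k n, rk n ≤ k → ∃ j, par^[j] n ∈ D := by
    intro k
    induction k with
    | zero =>
      intro n hn
      refine ⟨0, ?_⟩
      by_cases h : n = z
      · simpa [h] using hz
      · have := S.rk_lt n h; omega
    | succ k ih =>
      intro n hn
      by_cases h : n = z
      · exact ⟨0, by simpa [h] using hz⟩
      · obtain ⟨j, hj⟩ := ih (par n) (by have := S.rk_lt n h; omega)
        exact ⟨j + 1, hj⟩
  have bp : ∀ n, ∃ j, par^[j] n ∈ D := fun n => hex _ n le_rfl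
  let k : W → ℕ := fun n => Nat.find (bp n)
  have bq : ∀ n ∈ D, k n = 0 := fun n hn => by simp [k, hn]
  have ks : ∀ n, n ∉ D → k n = k (par n) + 1 := by
    intro n hn
    exact Nat.find_comp_succ (bp n) (bp (par n)) hn
  let leg : W → Finset W := fun n => (range (k n)).image fun i => par^[i] n
  have hcol : ∀ n, n ∉ D → p (par^[k n] n) = p (par^[k (par n)] (par n)) := by
    intro n hn; rw [ks n hn]; rfl
  have hleg : ∀ n, n ∉ D → leg n = insert n (leg (par n)) := by
    intro n hn
    simp only [leg, ks n hn, Finset.range_add_one', Finset.image_insert]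
    rw [Finset.map_eq_image, Finset.image_image]
    rfl
  have dy : ∀ n ∈ D, leg n = ∅ := fun n hn => by simp [leg, bq n hn]
  refine ⟨fun n => p (par^[k n] n), leg, fun n hn => ⟨by simp [bq n hn], dy n hn⟩, ?_⟩
  have main : ∀ K n, rk n ≤ K → n ∉ D → (∀ a ∈ leg n, Anc z par n a) ∧
        (∀ a ∈ leg n, comp G D n a) ∧ PC G (leg n : Set W) ∧ SAdj G (leg n : Set W) (pt D p (p (par^[k n] n))) ∧
        (∀ a ∈ leg n, hub a → a = n) := by
    intro K
    induction K with
    | zero =>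
      intro n hn hD
      have := S.rk_lt n (fun h => hD (h ▸ hz)); omega
    | succ K ih =>
      intro n hn hD
      have hnz : n ≠ z := fun h => hD (h ▸ hz)
      have hadj := S.par_adj n hnz
      rw [hcol n hD, hleg n hD]
      by_cases hp : par n ∈ D
      · rw [dy _ hp, bq _ hp]
        refine ⟨?_, ?_, ?_, ?_, ?_⟩
        · simp; exact Relation.ReflTransGen.refl
        · simp; exact Relation.ReflTransGen.refl
        · intro x hx y hy pp h _
          simp at hx hy; subst hx; subst hy; exact h
        · exact ⟨n, by simp, par n, ⟨hp, rfl⟩, hadj⟩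
        · simp
      · obtain ⟨kd, ke, kf, ki, kp⟩ := ih (par n) (by have := S.rk_lt n hnz; omega) hp
        have hmem : par n ∈ leg (par n) := by rw [hleg _ hp]; simp
        refine ⟨?_, ?_, ?_, ?_, ?_⟩
        · intro a ha
          rw [mem_insert] at ha
          rcases ha with rfl | ha
          · exact Relation.ReflTransGen.refl
          · exact Relation.ReflTransGen.head ⟨hnz, rfl⟩ (kd a ha)
        · intro a ha
          rw [mem_insert] at ha
          rcases ha with rfl | ha
          · exact Relation.ReflTransGen.refl
          · exact Relation.ReflTransGen.head ⟨hD, hp, hadj⟩ (ke a ha)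
        · apply PC.oc (par n) (by simp [hmem])
          intro x hx pp hc hcl
          simp only [coe_insert, Set.mem_insert_iff, mem_coe] at hx
          rcases hx with rfl | hx
          · exact hcl (par x) (by simp [hmem]) x (by simp) hadj.symm hc
          · exact kf _ hmem x hx pp hc (fun u hu v hv => hcl u (by simp at hu; simp [hu]) v (by simp at hv; simp [hv]))
        · obtain ⟨a, ha, b, hb, hab⟩ := ki
          exact ⟨a, by simp at ha; simp [ha], b, hb, hab⟩
        · intro a ha hh
          rw [mem_insert] at ha
          rcases ha with rfl | ha
          · rfl
          · rw [kp a ha hh] at hh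
            exact (S.hub_par n hnz hh).elim
  exact fun n hn => ⟨hcol n hn, hleg n hn, main _ n le_rfl hn⟩

structure St (G : SimpleGraph W) (z : W) (hub nat : W → Prop) (lay : W → ℕ) (ℓ : ℕ) (m : ℕ) (D : Finset W)
    (p : W → ℕ) : Prop where
  zD : z ∈ D
  lt : ∀ n ∈ D, p n < m
  pz : ∀ n ∈ D, (p n = 0 ↔ n = z)
  pc : ∀ i, PC G (pt D p i)
  acl : ∀ x, x ∉ D → ∀ i ∈ att G D p m x, ∀ j ∈ att G D p m x, i ≠ j → SAdj G (pt D p i) (pt D p j)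
  acard : ∀ x, x ∉ D → (att G D p m x).card ≤ 3
  back : ∀ j, j < m → ((range j).filter fun i => SAdj G (pt D p i) (pt D p j)).card ≤ 3 ∧
    ∀ i ib, i < j → ib < j → i ≠ ib → SAdj G (pt D p i) (pt D p j) → SAdj G (pt D p ib) (pt D p j) →
      SAdj G (pt D p i) (pt D p ib)
  hubD : ∀ v ∈ D, hub v → ∀ x, G.Adj v x → x ∈ D ∧ ∀ y, G.Adj v y → p x = p y ∨ SAdj G (pt D p (p x)) (pt D p (p y))
  bound : ∀ i, 1 ≤ i → ∀ l, (D.filter fun n => p n = i ∧ nat n ∧ lay n = l).card ≤ ℓ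

theorem clique (S : Sys G z par rk hub nat lay d q) {ℓ : ℕ} (St : St G z hub nat lay ℓ m D p) (xa : W) (kl : xa ∉ D)
    (col : W → ℕ) (hcD : ∀ n ∈ D, col n = p n) (hca : ∀ n, n ∉ D → col n ∈ att G D p m n) :
    ∃ Q : Finset W, (∀ x ∈ Q, ∀ y ∈ Q, x ≠ y → G.Adj x y) ∧ (∀ x ∈ Q, ∀ y ∈ Q, col x = col y → x = y) ∧
      Q.card = (att G D p m xa).card ∧ ∃ n ∈ Q, comp G D xa n := by
  have kf := St.acard xa kl
  have kd : 0 < (att G D p m xa).card := Finset.card_pos.mpr ⟨_, hca xa kl⟩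
  have hnb : ∀ x, comp G D xa x → ∀ y, G.Adj x y → comp G D xa y ∨ (y ∈ D ∧ p y ∈ att G D p m xa) := by
    intro x hx y hxy
    by_cases hy : y ∈ D
    · exact Or.inr ⟨hy, ma St.lt hx hy hxy⟩
    · exact Or.inl (hx.adj kl hy hxy)
  rcases (by omega : (att G D p m xa).card = 1 ∨ (att G D p m xa).card = 2 ∨ (att G D p m xa).card = 3) with h | h | h
  · exact ⟨{xa}, by simp, by simp, by simp [h], xa, by simp, Relation.ReflTransGen.refl⟩
  · by_contra hno
    have hmono : ∀ u v, comp G D xa u → G.Adj u v → col u = col v := by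
      intro u v hu huv
      by_contra hne
      apply hno
      refine ⟨{u, v}, ?_, ?_, by rw [h, Finset.card_pair huv.ne], u, by simp, hu⟩
      · simp [huv, huv.symm]
      · simp [hne, Ne.symm hne]
    have hconst : ∀ u, comp G D xa u → col u = col xa := by
      intro u hu
      apply cr xa kl xa Relation.ReflTransGen.refl u hu (fun u => col u = col xa) rfl
      intro u hu v hv huv kj
      rw [← hmono u v hu huv, kj]
    obtain ⟨a, b, hab, hT⟩ := Finset.card_eq_two.mp h
    have : ∀ i ∈ att G D p m xa, i = col xa := by
      intro i hi
      obtain ⟨y, hy, w, hw, hyw⟩ := ap hi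
      rw [← hw.2, ← hcD w hw.1, ← hmono y w hy hyw, hconst y hy]
    exact hab ((this a (by simp [hT])).trans (this b (by simp [hT])).symm)
  · obtain ⟨a, b, c, hab, hac, hbc, hT⟩ := Finset.card_eq_three.mp h
    have ay : ∀ i : Fin 3, (![a, b, c] i) ∈ att G D p m xa := by
      intro i; fin_cases i <;> simp [hT]
    have hinj : ∀ i j : Fin 3, ![a, b, c] i = ![a, b, c] j → i = j := by
      intro i j; fin_cases i <;> fin_cases j <;> simp [hab, hac, hbc, hab.symm, hac.symm, hbc.symm]
    let A : Fin 4 → Set W := Fin.snoc (α := fun _ => Set W) (fun i : Fin 3 => pt D p (![a, b, c] i)) {y | comp G D xa y}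
    have Aa : A 3 = {y | comp G D xa y} := Fin.snoc_last (α := fun _ => Set W) _ _
    have Ai : ∀ i : Fin 3, A i.castSucc = pt D p (![a, b, c] i) := fun i => Fin.snoc_castSucc (α := fun _ => Set W) _ _ _
    have cq : ∀ i : Fin 4, i = 3 ∨ ∃ j : Fin 3, i = j.castSucc := by decide
    let χ : W → Fin 3 := fun w => if col w = a then 0 else if col w = b then 1 else 2
    have hχ : ∀ w, col w ∈ att G D p m xa → ![a, b, c] (χ w) = col w := by
      intro w hw
      rw [hT] at hw
      simp only [mem_insert, mem_singleton] at hw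
      rcases hw with h | h | h <;> simp [χ, h, hab.symm, hac.symm, hbc.symm]
    obtain ⟨n, ng, nj, ik, nk⟩ := S.rainbow A (by
        intro i j x hi hj
        rcases cq i with rfl | ⟨i, rfl⟩ <;> rcases cq j with rfl | ⟨j, rfl⟩
        · rfl
        · rw [Aa] at hi; rw [Ai] at hj
          exact (comp.notin hi kl hj.1).elim
        · rw [Aa] at hj; rw [Ai] at hi
          exact (comp.notin hj kl hi.1).elim
        · rw [Ai] at hi hj
          rw [hinj i j (hi.2.symm.trans hj.2)])
      (by
        intro i
        rcases cq i with rfl | ⟨i, rfl⟩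
        · rw [Aa]; exact cr xa kl
        · rw [Ai]; exact St.pc _)
      (by
        intro i j hij
        rcases cq i with rfl | ⟨i, rfl⟩ <;> rcases cq j with rfl | ⟨j, rfl⟩
        · exact (lt_irrefl _ hij).elim
        · exact absurd hij (by have := j.castSucc_lt_last; exact not_lt.mpr this.le)
        · rw [Aa, Ai]; exact (ap (ay i)).symm
        · rw [Ai, Ai]
          exact St.acl xa kl _ (ay i) _ (ay j) (fun he => by rw [hinj i j he] at hij; exact lt_irrefl _ hij))
      (by
        intro x hx y hxy
        rw [Aa] at hx
        rcases hnb x hx y hxy with h | ⟨h, kj⟩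
        · exact ⟨3, by rw [Aa]; exact h⟩
        · refine ⟨(χ y).castSucc, ?_⟩
          rw [Ai, hχ y (by rw [hcD y h]; exact kj)]
          exact ⟨h, (hcD y h).symm⟩)
      χ (by
        intro i x hx
        rw [Ai] at hx
        apply hinj
        rw [hχ, hcD x hx.1, hx.2]
        rw [hcD x hx.1, hx.2]; exact ay i)
    have hni : Function.Injective n := fun i j h => by rw [← ng i, ← ng j, h]
    refine ⟨univ.image n, ?_, ?_, ?_, n ik, by simp, by rw [Aa] at nk; exact nk⟩
    · intro x hx y hy hxy
      simp only [mem_image, mem_univ, true_and] at hx hy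
      obtain ⟨i, rfl⟩ := hx
      obtain ⟨j, rfl⟩ := hy
      exact nj i j (fun h => hxy (by rw [h]))
    · intro x hx y hy hxy
      simp only [mem_image, mem_univ, true_and] at hx hy
      obtain ⟨i, rfl⟩ := hx
      obtain ⟨j, rfl⟩ := hy
      have : χ (n i) = χ (n j) := by simp only [χ, hxy]
      rw [ng, ng] at this
      rw [this]
    · rw [Finset.card_image_of_injective _ hni, h]; simp

theorem find_Y (S : Sys G z par rk hub nat lay d q) {ℓ : ℕ} (St : St G z hub nat lay ℓ m D p) (xa : W) (kl : xa ∉ D) :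
    ∃ Y : Finset W, Y.Nonempty ∧ (∀ y ∈ Y, comp G D xa y) ∧ PC G (Y : Set W) ∧
      (∀ i ∈ att G D p m xa, SAdj G (Y : Set W) (pt D p i)) ∧
      (∀ v ∈ Y, hub v → ∀ u, G.Adj v u → u ∈ D ∨ u ∈ Y) ∧
      ∀ l, (Y.filter fun n => nat n ∧ lay n = l).card ≤ d + 3 * q - 3 := by
  obtain ⟨col, leg, hcD, hleg⟩ := legs S St.zD St.lt
  have hself : ∀ n, n ∉ D → n ∈ leg n := fun n hn => by rw [(hleg n hn).2.1]; simp
  obtain ⟨Q, hQa, hQi, hQc, ni, hn0Q, az⟩ := clique S St xa kl col (fun n hn => (hcD n hn).1) (by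
    intro n hn
    obtain ⟨-, -, -, ke, -, ki, -⟩ := hleg n hn
    obtain ⟨a, ha, b, hb, hab⟩ := ki
    rw [← hb.2]
    exact ma St.lt (ke a ha) hb.1 hab)
  have hn0D := az.notin kl
  have hQK : ∀ x ∈ Q, x ∉ D → comp G D xa x := by
    intro x hx hxD
    by_cases h : ni = x
    · exact h ▸ az
    · exact az.adj kl hxD (hQa _ hn0Q _ hx h)
  have hcolT : ∀ x ∈ Q, col x ∈ att G D p m xa := by
    intro x hx
    by_cases hxD : x ∈ D
    · rw [(hcD x hxD).1]
      exact ma St.lt az hxD (hQa _ hn0Q _ hx (fun h => hn0D (h ▸ hxD)))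
    · obtain ⟨-, -, -, ke, -, ki, -⟩ := hleg x hxD
      obtain ⟨a, ha, b, hb, hab⟩ := ki
      rw [← hb.2]
      exact ma St.lt ((hQK x hx hxD).trans (ke a ha)) hb.1 hab
  have himg : Q.image col = att G D p m xa := by
    apply Finset.eq_of_subset_of_card_le
    · intro i hi
      rw [mem_image] at hi
      obtain ⟨x, hx, rfl⟩ := hi
      exact hcolT x hx
    · rw [Finset.card_image_of_injOn (fun x hx y hy h => hQi x hx y hy h), hQc]
  have gh : Q.card ≤ 3 := hQc ▸ St.acard xa kl
  let Ex : Finset W := univ.filter fun u => u ∉ D ∧ ∃ v ∈ Q, v ∉ D ∧ hub v ∧ G.Adj v u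
  have hEx : ∀ u, u ∈ Ex ↔ u ∉ D ∧ ∃ v ∈ Q, v ∉ D ∧ hub v ∧ G.Adj v u := fun u => by simp [Ex]
  have hlD : ∀ x a, a ∈ leg x → x ∉ D := by
    intro x a ha hx
    rw [(hcD x hx).2] at ha; simp at ha
  let Y := Q.biUnion leg ∪ Ex
  have hYl : ∀ x ∈ Q, ∀ a ∈ leg x, a ∈ Y := fun x hx a ha => by
    simp only [Y, mem_union, mem_biUnion]; exact Or.inl ⟨x, hx, ha⟩
  have hQY : ∀ x ∈ Q, x ∉ D → x ∈ Y := fun x hx hxD => hYl x hx x (hself x hxD)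
  have hn0Y := hQY ni hn0Q hn0D
  refine ⟨Y, ⟨ni, hn0Y⟩, ?_, ?_, ?_, ?_, ?_⟩
  · intro y hy
    simp only [Y, mem_union, mem_biUnion] at hy
    rcases hy with ⟨x, hx, hyx⟩ | hy
    · exact (hQK x hx (hlD x y hyx)).trans ((hleg x (hlD x y hyx)).2.2.2.1 y hyx)
    · obtain ⟨hyD, v, hv, hvD, -, hvy⟩ := (hEx y).1 hy
      exact (hQK v hv hvD).adj kl hyD hvy
  · apply PC.oc ni hn0Y
    have hq : ∀ x ∈ Q, x ∉ D → ∀ p : W → Prop, p ni → (∀ u ∈ (Y : Set W), ∀ v ∈ (Y : Set W), G.Adj u v → p u → p v) → p x := by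
      intro x hx hxD p hp hcl
      by_cases h : ni = x
      · exact h ▸ hp
      · exact hcl ni hn0Y x (hQY x hx hxD) (hQa _ hn0Q _ hx h) hp
    intro y hyY p hp hcl
    have hy : y ∈ Y := hyY
    simp only [Y, mem_union, mem_biUnion] at hy
    rcases hy with ⟨x, hx, hyx⟩ | hy
    · have hxD := hlD x y hyx
      exact (hleg x hxD).2.2.2.2.1 x (hself x hxD) y hyx p (hq x hx hxD p hp hcl)
        (fun u hu v hv => hcl u (hYl x hx u hu) v (hYl x hx v hv))
    · obtain ⟨hyD, v, hv, hvD, -, hvy⟩ := (hEx y).1 hy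
      exact hcl v (hQY v hv hvD) y hyY hvy (hq v hv hvD p hp hcl)
  · intro i hi
    rw [← himg, mem_image] at hi
    obtain ⟨x, hx, rfl⟩ := hi
    by_cases hxD : x ∈ D
    · exact ⟨ni, hn0Y, x, ⟨hxD, (hcD x hxD).1.symm⟩, hQa _ hn0Q _ hx (fun h => hn0D (h ▸ hxD))⟩
    · obtain ⟨a, ha, b, hb, hab⟩ := (hleg x hxD).2.2.2.2.2.1
      exact ⟨a, hYl x hx a ha, b, hb, hab⟩
  · intro v hv hh u hvu
    by_cases huD : u ∈ D
    · exact Or.inl huD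
    right
    simp only [Y, mem_union, mem_biUnion] at hv
    rcases hv with ⟨x, hx, hvx⟩ | hv
    · have := (hleg x (hlD x v hvx)).2.2.2.2.2.2 v hvx hh
      subst this
      simp only [Y, mem_union, mem_biUnion]
      exact Or.inr ((hEx u).2 ⟨huD, v, hx, hlD _ _ hvx, hh, hvu⟩)
    · obtain ⟨_, w, _, _, hw, hwv⟩ := (hEx v).1 hv
      exact (S.hub_hub w v hw hh hwv).elim
  · intro l
    have hd := S.hd
    have hq := S.hq
    have hL : ((Q.biUnion leg).filter fun n => nat n ∧ lay n = l).card ≤ Q.card * q := by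
      rw [Finset.filter_biUnion]
      apply Finset.card_biUnion_le_card_mul
      intro x hx
      by_cases hxD : x ∈ D
      · rw [(hcD x hxD).2]; simp
      · refine le_trans (Finset.card_le_card ?_) (S.anc x l)
        intro a ha
        rw [mem_filter] at ha ⊢
        exact ⟨mem_univ _, (hleg x hxD).2.2.1 a ha.1, ha.2⟩
    have hLq : Q.card * q ≤ 3 * q := Nat.mul_le_mul_right _ gh
    by_cases hhub : ∃ v ∈ Q, v ∉ D ∧ hub v ∧ ∃ n, G.Adj v n ∧ nat n
    · obtain ⟨v, hv, hvD, hh, hnat⟩ := hhub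
      have hdeg := S.deg v hh hnat
      have hvz : v ≠ z := fun h => hvD (h ▸ St.zD)
      let N := univ.filter (G.Adj v)
      let B := insert (par v) (Q.erase v)
      have hBN : B ⊆ N := by
        intro u hu
        simp only [B, mem_insert, mem_erase] at hu
        simp only [N, mem_filter, mem_univ, true_and]
        rcases hu with rfl | ⟨kd, ke⟩
        · exact S.par_adj v hvz
        · exact hQa v hv u ke kd.symm
      have hBc : B.card = Q.card := by
        have : par v ∉ Q.erase v := by
          intro h
          rw [mem_erase] at h
          exact h.1 (hQi _ h.2 _ hv (hleg v hvD).1.symm)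
        simp only [B]
        rw [Finset.card_insert_of_notMem this, Finset.card_erase_of_mem hv]
        have := Finset.card_pos.mpr ⟨v, hv⟩
        omega
      have hsub : (Y.filter fun n => nat n ∧ lay n = l) ⊆
          ((Q.biUnion leg).filter fun n => nat n ∧ lay n = l) ∪ (N \ B) := by
        intro u hu
        rw [mem_filter] at hu
        obtain ⟨huY, hun⟩ := hu
        rw [mem_union, mem_filter, mem_sdiff]
        by_cases hul : u ∈ Q.biUnion leg
        · exact Or.inl ⟨hul, hun⟩
        right
        have hux : u ∈ Ex := by
          simp only [Y, mem_union] at huY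
          exact huY.resolve_left hul
        obtain ⟨huD, vb, ag, br, ar, hvu⟩ := (hEx u).1 hux
        have : vb = v := by
          by_contra hne
          exact S.hub_hub vb v ar hh (hQa _ ag _ hv hne)
        subst this
        refine ⟨by simp [N, hvu], ?_⟩
        intro hB
        apply hul
        rw [mem_biUnion]
        simp only [B, mem_insert, mem_erase] at hB
        rcases hB with rfl | ⟨kd, ke⟩
        · refine ⟨vb, ag, ?_⟩
          rw [(hleg vb br).2.1]
          exact mem_insert_of_mem (hself _ huD)
        · exact ⟨u, ke, hself _ huD⟩
      have kd := Finset.card_le_card hsub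
      have ke := Finset.card_union_le ((Q.biUnion leg).filter fun n => nat n ∧ lay n = l) (N \ B)
      rw [Finset.card_sdiff_of_subset hBN, hBc] at ke
      have kf := Finset.card_le_card hBN
      rw [hBc] at kf
      have ki : N.card ≤ d := hdeg
      have hQ1 : 0 < Q.card := Finset.card_pos.mpr ⟨v, hv⟩
      have kp : Q.card * q + 3 ≤ 3 * q + Q.card := by
        rcases (by omega : Q.card = 1 ∨ Q.card = 2 ∨ Q.card = 3) with h | h | h <;> rw [h] <;> omega
      omega
    · have hsub : (Y.filter fun n => nat n ∧ lay n = l) ⊆ ((Q.biUnion leg).filter fun n => nat n ∧ lay n = l) := by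
        intro u hu
        rw [mem_filter] at hu ⊢
        refine ⟨?_, hu.2⟩
        have huY := hu.1
        simp only [Y, mem_union] at huY
        rcases huY with h | h
        · exact h
        · obtain ⟨huD, vb, ag, br, ar, hvu⟩ := (hEx u).1 h
          exact (hhub ⟨vb, ag, br, ar, u, hvu, hu.2.1⟩).elim
      have := Finset.card_le_card hsub
      omega

end Rec

section Step
variable {W : Type} [Fintype W] {G : SimpleGraph W} {D : Finset W} {p : W → ℕ} {m : ℕ}
variable {z : W} {par : W → W} {rk : W → ℕ} {hub nat : W → Prop} {lay : W → ℕ} {d q : ℕ}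

theorem Sys.ns (S : Sys G z par rk hub nat lay d q) (P Q : Fin 3 → Set W)
    (hP : ∀ i j x, x ∈ P i → x ∈ P j → i = j) (hQ : ∀ i j x, x ∈ Q i → x ∈ Q j → i = j)
    (hPQ : ∀ i j x, x ∈ P i → x ∈ Q j → False) (pP : ∀ i, PC G (P i)) (pQ : ∀ i, PC G (Q i))
    (hs : ∀ i j, SAdj G (P i) (Q j)) : False := by
  have cm : ∀ i : Fin 6, (∃ j : Fin 3, i = Fin.castAdd 3 j) ∨ ∃ j : Fin 3, i = Fin.natAdd 3 j := by decide
  let A : Fin 6 → Set W := Fin.append P Q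
  have Ab : ∀ j, A (Fin.castAdd 3 j) = P j := fun j => Fin.append_left P Q j
  have Ac : ∀ j, A (Fin.natAdd 3 j) = Q j := fun j => Fin.append_right P Q j
  refine S.nr A ?_ ?_ ?_
  · intro i j x
    rcases cm i with ⟨i, rfl⟩ | ⟨i, rfl⟩ <;> rcases cm j with ⟨j, rfl⟩ | ⟨j, rfl⟩ <;> simp only [Ab, Ac] <;> intro hi hj
    · rw [hP i j x hi hj]
    · exact (hPQ _ _ x hi hj).elim
    · exact (hPQ _ _ x hj hi).elim
    · rw [hQ i j x hi hj]
  · intro i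
    rcases cm i with ⟨i, rfl⟩ | ⟨i, rfl⟩ <;> simp only [Ab, Ac]
    exacts [pP i, pQ i]
  · intro i j hi hj
    rcases cm i with ⟨i, rfl⟩ | ⟨i, rfl⟩ <;> rcases cm j with ⟨j, rfl⟩ | ⟨j, rfl⟩ <;> simp only [Ab, Ac]
    · exact absurd hj (by revert j; decide)
    · exact hs i j
    · exact absurd hi (by revert i; decide)
    · exact absurd hi (by revert i; decide)

theorem Sys.nt (S : Sys G z par rk hub nat lay d q) (P : Fin 3 → Set W) (Q : Fin 2 → Set W)
    (hP : ∀ i j x, x ∈ P i → x ∈ P j → i = j) (hQ : ∀ i j x, x ∈ Q i → x ∈ Q j → i = j)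
    (hPQ : ∀ i j x, x ∈ P i → x ∈ Q j → False) (pP : ∀ i, PC G (P i)) (pQ : ∀ i, PC G (Q i))
    (hs : ∀ i j, SAdj G (P i) (Q j)) (gi : ∀ i j, i ≠ j → SAdj G (P i) (P j)) (gj : SAdj G (Q 0) (Q 1)) : False := by
  have cm : ∀ i : Fin 5, (∃ j : Fin 3, i = Fin.castAdd 2 j) ∨ ∃ j : Fin 2, i = Fin.natAdd 3 j := by decide
  let A : Fin 5 → Set W := Fin.append P Q
  have Ab : ∀ j, A (Fin.castAdd 2 j) = P j := fun j => Fin.append_left P Q j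
  have Ac : ∀ j, A (Fin.natAdd 3 j) = Q j := fun j => Fin.append_right P Q j
  refine S.nq A ?_ ?_ ?_
  · intro i j x
    rcases cm i with ⟨i, rfl⟩ | ⟨i, rfl⟩ <;> rcases cm j with ⟨j, rfl⟩ | ⟨j, rfl⟩ <;> simp only [Ab, Ac] <;> intro hi hj
    · rw [hP i j x hi hj]
    · exact (hPQ _ _ x hi hj).elim
    · exact (hPQ _ _ x hj hi).elim
    · rw [hQ i j x hi hj]
  · intro i
    rcases cm i with ⟨i, rfl⟩ | ⟨i, rfl⟩ <;> simp only [Ab, Ac]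
    exacts [pP i, pQ i]
  · intro i j hi
    rcases cm i with ⟨i, rfl⟩ | ⟨i, rfl⟩ <;> rcases cm j with ⟨j, rfl⟩ | ⟨j, rfl⟩ <;> simp only [Ab, Ac]
    · exact gi i j (fun h => by subst h; exact lt_irrefl _ hi)
    · exact hs i j
    · exact absurd hi (by revert i j; decide)
    · have : i = 0 ∧ j = 1 := by revert hi; revert i j; decide
      rw [this.1, this.2]; exact gj

structure Stp (G : SimpleGraph W) (D Da : Finset W) (p pa : W → ℕ) (m : ℕ) (xa : W) (Y : Finset W) : Prop where
  Yc : ∀ y ∈ Y, comp G D xa y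
  ne : Y.Nonempty
  hD : ∀ n, n ∈ Da ↔ n ∈ D ∨ n ∈ Y
  YD : ∀ y ∈ Y, y ∉ D
  pY : ∀ y ∈ Y, pa y = m
  pD : ∀ n ∈ D, pa n = p n
  ptlt : ∀ i, i < m → pt Da pa i = pt D p i
  ptm : pt Da pa m = (Y : Set W)
  ptgt : ∀ i, m < i → pt Da pa i = ∅
  old : ∀ x, x ∉ Da → ¬ comp G D xa x → (∀ y, comp G D x y → comp G Da x y) ∧ att G Da pa (m+1) x = att G D p m x
  new : ∀ x, x ∉ Da → comp G D xa x → m ∈ att G Da pa (m+1) x ∧ att G Da pa (m+1) x ⊆ insert m (att G D p m xa)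
  ysadj : ∀ i ∈ att G D p m xa, SAdj G (Y : Set W) (pt D p i)
  ypc : PC G (Y : Set W)

theorem mkStp {ℓ : ℕ} (St : St G z hub nat lay ℓ m D p) (xa : W) (kl : xa ∉ D) (Y : Finset W)
    (hne : Y.Nonempty) (Yc : ∀ y ∈ Y, comp G D xa y) (ypc : PC G (Y : Set W))
    (ys : ∀ i ∈ att G D p m xa, SAdj G (Y : Set W) (pt D p i)) :
    Stp G D (D ∪ Y) p (fun n => if n ∈ Y then m else p n) m xa Y := by
  have YD : ∀ y ∈ Y, y ∉ D := fun y hy => (Yc y hy).notin kl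
  have DY : ∀ n ∈ D, n ∉ Y := fun n hn hy => YD n hy hn
  have hmono : ∀ {x y}, comp G (D ∪ Y) x y → comp G D x y := fun h => h.mono subset_union_left
  refine ⟨Yc, hne, fun n => by simp, YD, fun y hy => by simp [hy], fun n hn => by simp [DY n hn], ?_, ?_, ?_, ?_, ?_, ys, ypc⟩
  · intro i hi
    ext n
    simp only [pt, Set.mem_ofPred_eq, mem_union]
    by_cases h : n ∈ Y
    · simp [h, YD n h]; omega
    · simp [h]
  · ext n
    simp only [pt, Set.mem_ofPred_eq, mem_union, mem_coe]
    by_cases h : n ∈ Y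
    · simp [h]
    · simp only [h, if_false, or_false, iff_false, not_and]
      intro hD; exact (St.lt n hD).ne
  · intro i hi
    ext n
    simp only [pt, Set.mem_ofPred_eq, mem_union, Set.mem_empty_iff_false, iff_false, not_and]
    intro h
    by_cases kj : n ∈ Y
    · simp [kj]; omega
    · have := St.lt n (h.resolve_right kj); simp [kj]; omega
  · intro x hx hK
    have hxD : x ∉ D := fun h => hx (by simp [h])
    have kd : ∀ y, comp G D x y → comp G (D ∪ Y) x y ∧ y ∉ D ∪ Y := by
      intro y hy
      induction hy with
      | refl => exact ⟨Relation.ReflTransGen.refl, hx⟩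
      | @tail b c hb hbc ih =>
        have hc : c ∉ D ∪ Y := by
          rw [mem_union, not_or]
          refine ⟨hbc.2.1, fun h => hK ?_⟩
          exact (Yc c h).trans (comp.symm (hb.tail hbc))
        exact ⟨Relation.ReflTransGen.tail ih.1 ⟨ih.2, hc, hbc.2.2⟩, hc⟩
    refine ⟨fun y hy => (kd y hy).1, ?_⟩
    ext i
    simp only [att, mem_filter, mem_range]
    constructor
    · rintro ⟨hi, y, w, hy, hw, hyw, hpw⟩
      have ky := hmono hy
      have hwY : w ∉ Y := by
        intro dz
        exact hK ((Yc w dz).trans (ky.adj hxD (YD w dz) hyw).symm)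
      have hwD : w ∈ D := (mem_union.1 hw).resolve_right hwY
      simp only [hwY, if_false] at hpw
      exact ⟨hpw ▸ St.lt w hwD, y, w, ky, hwD, hyw, hpw⟩
    · rintro ⟨hi, y, w, hy, hw, hyw, hpw⟩
      exact ⟨by omega, y, w, (kd y hy).1, by simp [hw], hyw, by simp [DY w hw, hpw]⟩
  · intro x hx hK
    have hxD : x ∉ D := fun h => hx (by simp [h])
    constructor
    · by_contra hm
      have hnoY : ∀ y w, comp G (D ∪ Y) x y → w ∈ Y → ¬ G.Adj y w := by
        intro y w hy hw hyw
        apply hm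
        simp only [att, mem_filter, mem_range]
        exact ⟨by omega, y, w, hy, by simp [hw], hyw, by simp [hw]⟩
      obtain ⟨yd, el⟩ := hne
      have : ∀ y, comp G D x y → comp G (D ∪ Y) x y := by
        intro y hy
        induction hy with
        | refl => exact Relation.ReflTransGen.refl
        | @tail b c hb hbc ih =>
          have hc : c ∉ D ∪ Y := by
            rw [mem_union, not_or]
            exact ⟨hbc.2.1, fun h => hnoY b c ih h hbc.2.2⟩
          exact ih.adj hx hc hbc.2.2
      have ke := this yd (hK.symm.trans (Yc yd el))
      exact ke.notin hx (by simp [el])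
    · intro i hi
      simp only [att, mem_filter, mem_range] at hi
      obtain ⟨hi, y, w, hy, hw, hyw, hpw⟩ := hi
      rw [mem_insert]
      by_cases hwY : w ∈ Y
      · left; simpa [hwY] using hpw.symm
      · right
        simp only [hwY, if_false] at hpw
        rw [← hpw]
        exact ma St.lt (hK.trans (hmono hy)) ((mem_union.1 hw).resolve_right hwY) hyw

variable {Da : Finset W} {pa : W → ℕ} {xa : W} {Y : Finset W}

/-- no three disjoint connected sets attach to three parts -/
theorem Lb (S : Sys G z par rk hub nat lay d q) (hpc : ∀ i, PC G (pt D p i)) (U : Finset ℕ) (hU : U.card = 3)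
    (Q : Fin 3 → Set W) (hQ : ∀ i j x, x ∈ Q i → x ∈ Q j → i = j)
    (hPQ : ∀ i ∈ U, ∀ j x, x ∈ pt D p i → x ∈ Q j → False) (pQ : ∀ i, PC G (Q i))
    (hs : ∀ i ∈ U, ∀ j, SAdj G (Q j) (pt D p i)) : False := by
  let e := (Finset.equivFinOfCardEq hU).symm
  refine S.ns (fun i => pt D p (e i)) Q ?_ hQ ?_ (fun i => hpc _) pQ ?_
  · intro i j x hi hj
    exact e.injective (Subtype.ext (hi.2.symm.trans hj.2))
  · exact fun i j x => hPQ _ (e i).2 j x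
  · exact fun i j => (hs _ (e i).2 j).symm

theorem Stp.tlt (s : Stp G D Da p pa m xa Y) {x : W} {i : ℕ} (hi : i ∈ att G D p m x) : i < m := by
  simp only [att, mem_filter, mem_range] at hi; exact hi.1

theorem Stp.pc {ℓ : ℕ} (s : Stp G D Da p pa m xa Y) (St : St G z hub nat lay ℓ m D p) (i : ℕ) : PC G (pt Da pa i) := by
  rcases lt_trichotomy i m with h | h | h
  · rw [s.ptlt i h]; exact St.pc i
  · rw [h, s.ptm]; exact s.ypc
  · rw [s.ptgt i h]; intro x hx; exact hx.elim

theorem Stp.sadj {ℓ : ℕ} (s : Stp G D Da p pa m xa Y) (St : St G z hub nat lay ℓ m D p) (kl : xa ∉ D) {i j : ℕ}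
    (hi : i ∈ insert m (att G D p m xa)) (hj : j ∈ insert m (att G D p m xa)) (hij : i ≠ j) :
    SAdj G (pt Da pa i) (pt Da pa j) := by
  rw [mem_insert] at hi hj
  rcases hi with rfl | hi <;> rcases hj with rfl | hj
  · exact (hij rfl).elim
  · rw [s.ptm, s.ptlt j (s.tlt hj)]; exact s.ysadj j hj
  · rw [s.ptm, s.ptlt i (s.tlt hi)]; exact (s.ysadj i hi).symm
  · rw [s.ptlt j (s.tlt hj), s.ptlt i (s.tlt hi)]; exact St.acl xa kl i hi j hj hij

theorem Stp.st {ℓ : ℕ} (s : Stp G D Da p pa m xa Y) (S : Sys G z par rk hub nat lay d q)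
    (Sd : St G z hub nat lay ℓ m D p) (kl : xa ∉ D)
    (hhub : ∀ v ∈ Y, hub v → ∀ u, G.Adj v u → u ∈ D ∨ u ∈ Y)
    (hb : ∀ l, (Y.filter fun n => nat n ∧ lay n = l).card ≤ ℓ) :
    St G z hub nat lay ℓ (m+1) Da pa := by
  have hm : 0 < m := by have := Sd.lt z Sd.zD; omega
  have hDD : ∀ n ∈ D, n ∈ Da := fun n hn => (s.hD n).2 (Or.inl hn)
  refine ⟨hDD z Sd.zD, ?_, ?_, s.pc Sd, ?_, ?_, ?_, ?_, ?_⟩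
  · intro n hn
    rcases (s.hD n).1 hn with h | h
    · rw [s.pD n h]; have := Sd.lt n h; omega
    · rw [s.pY n h]; omega
  · intro n hn
    rcases (s.hD n).1 hn with h | h
    · rw [s.pD n h]; exact Sd.pz n h
    · rw [s.pY n h]
      exact ⟨fun h => by omega, fun kj => (s.YD n h (kj ▸ Sd.zD)).elim⟩
  · intro x hx i hi j hj hij
    have hxD : x ∉ D := fun h => hx (hDD x h)
    by_cases hK : comp G D xa x
    · exact s.sadj Sd kl ((s.new x hx hK).2 hi) ((s.new x hx hK).2 hj) hij
    · rw [(s.old x hx hK).2] at hi hj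
      rw [s.ptlt i (s.tlt hi), s.ptlt j (s.tlt hj)]
      exact Sd.acl x hxD i hi j hj hij
  · intro x hx
    have hxD : x ∉ D := fun h => hx (hDD x h)
    by_cases hK : comp G D xa x
    · by_contra hc
      obtain ⟨kd, ke⟩ := s.new x hx hK
      have gk := Sd.acard xa kl
      have hc2 := Finset.card_le_card ke
      have hc3 := Finset.card_insert_le m (att G D p m xa)
      have hT : (att G D p m xa).card = 3 := by omega
      have heq := Finset.eq_of_subset_of_card_le ke (by omega)
      let e := (Finset.equivFinOfCardEq hT).symm
      have hlt : ∀ i, (e i : ℕ) < m := fun i => s.tlt (e i).2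
      have hcs : ∀ i ∈ insert m (att G D p m xa), SAdj G {y | comp G Da x y} (pt Da pa i) := by
        intro i hi; rw [← heq] at hi; exact ap hi
      have fe : ∀ i : Fin 2, i = 0 ∨ i = 1 := by decide
      refine S.nt (fun i => pt Da pa (e i)) ![pt Da pa m, {y | comp G Da x y}] ?_ ?_ ?_ (fun i => s.pc Sd _) ?_ ?_ ?_ ?_
      · intro i j x hi hj
        exact e.injective (Subtype.ext (hi.2.symm.trans hj.2))
      · intro i j y
        rcases fe i with rfl | rfl <;> rcases fe j with rfl | rfl <;> simp only [Matrix.cons_val_zero, Matrix.cons_val_one] <;> intro hi hj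
        · trivial
        · exact (comp.notin hj hx hi.1).elim
        · exact (comp.notin hi hx hj.1).elim
        · trivial
      · intro i j y hi hj
        rcases fe j with rfl | rfl <;> simp only [Matrix.cons_val_zero, Matrix.cons_val_one] at hj
        · have kd := hi.2.symm.trans hj.2
          have := hlt i; omega
        · exact comp.notin hj hx hi.1
      · intro i
        rcases fe i with rfl | rfl
        · exact s.pc Sd m
        · exact cr x hx
      · intro i j
        rcases fe j with rfl | rfl
        · exact s.sadj Sd kl (mem_insert_of_mem (e i).2) (mem_insert_self _ _) (hlt i).ne
        · exact (hcs _ (mem_insert_of_mem (e i).2)).symm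
      · intro i j hij
        exact s.sadj Sd kl (mem_insert_of_mem (e i).2) (mem_insert_of_mem (e j).2)
          (fun h => hij (e.injective (Subtype.ext h)))
      · exact (hcs m (mem_insert_self _ _)).symm
    · rw [(s.old x hx hK).2]; exact Sd.acard x hxD
  · intro j hj
    rcases (by omega : j < m ∨ j = m) with h | rfl
    · have hb := Sd.back j h
      constructor
      · convert hb.1 using 3
        next i hi =>
        rw [mem_range] at hi
        rw [s.ptlt i (by omega), s.ptlt j h]
      · intro i ib hi kt
        rw [s.ptlt i (by omega), s.ptlt ib (by omega), s.ptlt j h]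
        exact hb.2 i ib hi kt
    · have key : ∀ i, i < j → SAdj G (pt Da pa i) (pt Da pa j) → i ∈ att G D p j xa := by
        intro i hi h
        rw [s.ptlt i hi, s.ptm] at h
        obtain ⟨a, ha, b, hb, hab⟩ := h
        rw [← ha.2]
        exact ma Sd.lt (s.Yc b hb) ha.1 hab.symm
      constructor
      · refine le_trans (Finset.card_le_card ?_) (Sd.acard xa kl)
        intro i hi
        rw [mem_filter, mem_range] at hi
        exact key i hi.1 hi.2
      · intro i ib hi kt hne h kj
        exact s.sadj Sd kl (mem_insert_of_mem (key i hi h)) (mem_insert_of_mem (key ib kt kj)) hne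
  · intro v hv hh x hvx
    rcases (s.hD v).1 hv with h | h
    · obtain ⟨kd, ke⟩ := Sd.hubD v h hh x hvx
      refine ⟨hDD x kd, fun y hy => ?_⟩
      have hyD := (Sd.hubD v h hh y hy).1
      rw [s.pD x kd, s.pD y hyD, s.ptlt _ (Sd.lt x kd), s.ptlt _ (Sd.lt y hyD)]
      exact ke y hy
    · refine ⟨(s.hD x).2 (hhub v h hh x hvx), fun y hy => ?_⟩
      have key : ∀ u, G.Adj v u → pa u ∈ insert m (att G D p m xa) := by
        intro u hu
        rcases hhub v h hh u hu with kw | kw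
        · rw [s.pD u kw, mem_insert]
          exact Or.inr (ma Sd.lt (s.Yc v h) kw hu)
        · rw [s.pY u kw]; exact mem_insert_self _ _
      by_cases he : pa x = pa y
      · exact Or.inl he
      · exact Or.inr (s.sadj Sd kl (key x hvx) (key y hy) he)
  · intro i hi l
    by_cases him : i = m
    · refine le_trans (Finset.card_le_card ?_) (hb l)
      intro n hn
      rw [mem_filter] at hn ⊢
      refine ⟨?_, hn.2.2⟩
      have : n ∈ pt Da pa m := ⟨hn.1, hn.2.1.trans him⟩
      rw [s.ptm] at this; exact this
    · refine le_trans (Finset.card_le_card ?_) (Sd.bound i hi l)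
      intro n hn
      rw [mem_filter] at hn ⊢
      rcases (s.hD n).1 hn.1 with h | h
      · exact ⟨h, by rw [← s.pD n h]; exact hn.2⟩
      · exact (him (hn.2.1.symm.trans (s.pY n h))).elim

end Step

section Step
variable {W : Type} [Fintype W] {G : SimpleGraph W} {D : Finset W} {p : W → ℕ} {m : ℕ}
variable {z : W} {par : W → W} {rk : W → ℕ} {hub nat : W → Prop} {lay : W → ℕ} {d q : ℕ}
variable {Da : Finset W} {pa : W → ℕ} {xa : W} {Y : Finset W}

def Pl (G : SimpleGraph W) (D : Finset W) (p : W → ℕ) (m : ℕ) : Prop :=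
  ∃ (V E F : Type) (_ : Fintype V) (_ : Fintype E) (_ : Fintype F) (σ : E × Bool ≃ F × Fin 3) (node : F → Fin 3 → V),
    TS σ node ∧ ∃ (vert : ℕ → V) (fa : W → F), (∀ i j, i < m → j < m → vert i = vert j → i = j) ∧
      (∀ i j, i < m → j < m → i ≠ j → SAdj G (pt D p i) (pt D p j) → TAdj node (vert i) (vert j)) ∧
      (∀ x, x ∉ D → (att G D p m x).card = 3 → ∀ v, (∃ k, node (fa x) k = v) ↔ ∃ i ∈ att G D p m x, vert i = v) ∧
      (∀ x y, x ∉ D → y ∉ D → (att G D p m x).card = 3 → (att G D p m y).card = 3 → fa x = fa y → comp G D x y)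

theorem Stp.ph {ℓ : ℕ} (s : Stp G D Da p pa m xa Y) (Sd : St G z hub nat lay ℓ m D p) (kl : xa ∉ D)
    {V F Ea Fa : Type} [Fintype V] [Fintype F] [Fintype Ea] [Fintype Fa]
    {node : F → Fin 3 → V}
    {kr : Ea × Bool ≃ Fa × Fin 3} {na : Fa → Fin 3 → Option V} (Ta : TS kr na) (vert : ℕ → V) (fa : W → F)
    (hv : ∀ i j, i < m → j < m → vert i = vert j → i = j)
    (hadj : ∀ i j, i < m → j < m → i ≠ j → SAdj G (pt D p i) (pt D p j) → TAdj node (vert i) (vert j))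
    (hfa : ∀ x, x ∉ D → (att G D p m x).card = 3 → ∀ v, (∃ k, node (fa x) k = v) ↔ ∃ i ∈ att G D p m x, vert i = v)
    (hfu : ∀ x y, x ∉ D → y ∉ D → (att G D p m x).card = 3 → (att G D p m y).card = 3 → fa x = fa y → comp G D x y)
    (ae : ∀ u v, TAdj node u v → TAdj na (some u) (some v))
    (aa : ∀ j ∈ att G D p m xa, TAdj na (some (vert j)) none)
    (old : F → Fa) (hold : Function.Injective old)
    (ho : ∀ x, x ∉ Da → ¬ comp G D xa x → (att G D p m x).card = 3 →
      ∀ k, na (old (fa x)) k = some (node (fa x) k))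
    (fn : W → Fa)
    (hn : ∀ x, x ∉ Da → comp G D xa x → (att G Da pa (m+1) x).card = 3 →
      ∀ v, (∃ k, na (fn x) k = v) ↔ v = none ∨ ∃ j ∈ att G Da pa (m+1) x, j ≠ m ∧ some (vert j) = v)
    (hnu : ∀ x y, x ∉ Da → y ∉ Da → comp G D xa x → comp G D xa y → (att G Da pa (m+1) x).card = 3 →
      (att G Da pa (m+1) y).card = 3 → fn x = fn y → comp G Da x y)
    (hno : ∀ x y, x ∉ Da → y ∉ Da → comp G D xa x → ¬ comp G D xa y → (att G Da pa (m+1) x).card = 3 →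
      (att G D p m y).card = 3 → fn x ≠ old (fa y)) : Pl G Da pa (m+1) := by
  have hDD : ∀ x, x ∉ Da → x ∉ D := fun n hn h => hn ((s.hD n).2 (Or.inl h))
  have hvm : ∀ i, i < m + 1 → i = m ∨ i < m := by omega
  have amem : ∀ i, i < m → SAdj G (pt Da pa i) (pt Da pa m) → i ∈ att G D p m xa := by
    intro i hi h
    rw [s.ptlt i hi, s.ptm] at h
    obtain ⟨a, ha, b, hb, hab⟩ := h
    rw [← ha.2]
    exact ma Sd.lt (s.Yc b hb) ha.1 hab.symm
  refine ⟨Option V, Ea, Fa, inferInstance, inferInstance, inferInstance, kr, na, Ta,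
    fun i => if i = m then none else some (vert i), fun x => if comp G D xa x then fn x else old (fa x), ?_, ?_, ?_, ?_⟩
  · intro i j hi hj
    rcases hvm i hi with rfl | hi <;> rcases hvm j hj with rfl | hj
    · simp
    · simp [hj.ne]
    · simp [hi.ne]
    · simp only [hi.ne, hj.ne, if_false, Option.some.injEq]; exact hv i j hi hj
  · intro i j hi hj hij hS
    rcases hvm i hi with rfl | hi <;> rcases hvm j hj with rfl | hj
    · exact (hij rfl).elim
    · simp only [hj.ne, if_false, if_true]
      exact (aa j (amem j hj hS.symm)).symm
    · simp only [hi.ne, if_false, if_true]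
      exact aa i (amem i hi hS)
    · simp only [hi.ne, hj.ne, if_false]
      rw [s.ptlt i hi, s.ptlt j hj] at hS
      exact ae _ _ (hadj i j hi hj hij hS)
  · intro x hx hc
    by_cases hK : comp G D xa x
    · simp only [hK, if_true]
      intro v
      rw [hn x hx hK hc]
      constructor
      · rintro (rfl | ⟨j, hj, hjm, rfl⟩)
        · exact ⟨m, (s.new x hx hK).1, by simp⟩
        · exact ⟨j, hj, by simp [hjm]⟩
      · rintro ⟨j, hj, rfl⟩
        by_cases hjm : j = m
        · simp [hjm]
        · exact Or.inr ⟨j, hj, hjm, by simp [hjm]⟩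
    · simp only [hK, if_false]
      rw [(s.old x hx hK).2] at hc ⊢
      intro v
      have kd := hfa x (hDD x hx) hc
      simp only [ho x hx hK hc]
      constructor
      · rintro ⟨k, rfl⟩
        obtain ⟨i, hi, kt⟩ := (kd _).1 ⟨k, rfl⟩
        exact ⟨i, hi, by simp [(s.tlt hi).ne, kt]⟩
      · rintro ⟨i, hi, rfl⟩
        obtain ⟨k, hk⟩ := (kd _).2 ⟨i, hi, rfl⟩
        exact ⟨k, by simp [(s.tlt hi).ne, hk]⟩
  · intro x y hx hy hcx hcy hxy
    by_cases hKx : comp G D xa x <;> by_cases hKy : comp G D xa y <;> simp only [hKx, hKy, if_true, if_false] at hxy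
    · exact hnu x y hx hy hKx hKy hcx hcy hxy
    · rw [(s.old y hy hKy).2] at hcy
      exact (hno x y hx hy hKx hKy hcx hcy hxy).elim
    · rw [(s.old x hx hKx).2] at hcx
      exact (hno y x hy hx hKy hKx hcy hcx hxy.symm).elim
    · rw [(s.old y hy hKy).2] at hcy
      rw [(s.old x hx hKx).2] at hcx
      exact (s.old x hx hKx).1 y (hfu x y (hDD x hx) (hDD y hy) hcx hcy (hold hxy))

theorem Stp.lc {ℓ : ℕ} (s : Stp G D Da p pa m xa Y) (S : Sys G z par rk hub nat lay d q)
    (Sd : St G z hub nat lay ℓ m D p) (x y : W) (hx : x ∉ Da) (hy : y ∉ Da)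
    (hc : (att G Da pa (m+1) x).card = 3) (hxy : att G Da pa (m+1) x = att G Da pa (m+1) y)
    (C : Set W) (pC : PC G C) (hCx : ∀ u ∈ C, ¬ comp G Da x u) (hCy : ∀ u ∈ C, ¬ comp G Da y u)
    (hCp : ∀ i ∈ att G Da pa (m+1) x, (∀ u ∈ C, u ∉ pt Da pa i) ∧ SAdj G C (pt Da pa i)) : comp G Da x y := by
  by_contra hn
  have cj : ∀ i : Fin 3, i = 0 ∨ i = 1 ∨ i = 2 := by decide
  refine Lb S (s.pc Sd) _ hc ![{u | comp G Da x u}, {u | comp G Da y u}, C] ?_ ?_ ?_ ?_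
  · intro i j u
    rcases cj i with rfl | rfl | rfl <;> rcases cj j with rfl | rfl | rfl <;>
      simp only [Matrix.cons_val_zero, Matrix.cons_val_one, Matrix.cons_val] <;> intro hi hj
    · trivial
    · exact (hn (comp.trans hi (comp.symm hj))).elim
    · exact (hCx u hj hi).elim
    · exact (hn (comp.trans hj (comp.symm hi))).elim
    · trivial
    · exact (hCy u hj hi).elim
    · exact (hCx u hi hj).elim
    · exact (hCy u hi hj).elim
    · trivial
  · intro i hi j u hu
    rcases cj j with rfl | rfl | rfl <;>
      simp only [Matrix.cons_val_zero, Matrix.cons_val_one, Matrix.cons_val] <;> intro hj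
    · exact comp.notin hj hx hu.1
    · exact comp.notin hj hy hu.1
    · exact (hCp i hi).1 u hj hu
  · intro j
    rcases cj j with rfl | rfl | rfl
    · exact cr x hx
    · exact cr y hy
    · exact pC
  · intro i hi j
    rcases cj j with rfl | rfl | rfl
    · exact ap hi
    · rw [hxy] at hi; exact ap hi
    · exact (hCp i hi).2

theorem Stp.pl {ℓ : ℕ} (s : Stp G D Da p pa m xa Y) (S : Sys G z par rk hub nat lay d q)
    (Sd : St G z hub nat lay ℓ m D p) (kl : xa ∉ D) (h : Pl G D p m) : Pl G Da pa (m+1) := by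
  obtain ⟨V, E, F, iV, iE, iF, σ, node, Tb, vert, fa, hv, hadj, hfa, hfu⟩ := h
  have hDD : ∀ x, x ∉ Da → x ∉ D := fun n hn h => hn ((s.hD n).2 (Or.inl h))
  have gk := Sd.acard xa kl
  have hm : 0 < m := by have := Sd.lt z Sd.zD; omega
  set T := att G D p m xa with hTdef
  have hTm : ∀ j ∈ T, j < m := fun j hj => s.tlt hj
  have hTimg : (T.image vert).card = T.card :=
    Finset.card_image_of_injOn (fun i hi j hj h => hv i j (hTm i hi) (hTm j hj) h)
  have hsub : ∀ x, x ∉ Da → comp G D xa x → (att G Da pa (m+1) x).erase m ⊆ T := by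
    intro x hx hK
    have := (s.new x hx hK).2
    intro j hj
    rw [mem_erase] at hj
    exact (mem_insert.1 (this hj.2)).resolve_left hj.1
  have hcard : ∀ x, x ∉ Da → comp G D xa x → (att G Da pa (m+1) x).card = 3 → ((att G Da pa (m+1) x).erase m).card = 2 := by
    intro x hx hK hc
    rw [Finset.card_erase_of_mem (s.new x hx hK).1, hc]
  have cj : ∀ i : Fin 3, i = 0 ∨ i = 1 ∨ i = 2 := by decide
  by_cases hT : T.card = 3
  · set φ := fa xa with hφ
    obtain ⟨na, kr, Ta, ng, nj, nk, nu⟩ := Tb.stack3 φ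
    have hφT : ∀ v, (∃ k, node φ k = v) ↔ ∃ i ∈ T, vert i = v := hfa xa kl hT
    have hφi : Function.Injective (node φ) := by
      have : (univ.image (node φ)) = T.image vert := by
        ext v; simp only [mem_image, mem_univ, true_and]; exact hφT v
      have ke : (univ.image (node φ)).card = (univ : Finset (Fin 3)).card := by rw [this, hTimg, hT]; rfl
      have := Finset.card_image_iff.1 ke
      exact fun i j h => this (mem_coe.2 (mem_univ i)) (mem_coe.2 (mem_univ j)) h
    let opp : Fin 3 → F ⊕ Fin 2 := ![Sum.inr 0, Sum.inr 1, Sum.inl φ]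
    have hopp : ∀ k, na (opp k) = ![some (node φ (k+1)), some (node φ (k+2)), none] := by
      intro k
      rcases cj k with rfl | rfl | rfl
      · exact nk
      · exact nu
      · exact nj
    have oppi : ∀ k l, opp k = opp l → k = l := by
      intro k l
      rcases cj k with rfl | rfl | rfl <;> rcases cj l with rfl | rfl | rfl <;> simp [opp]
    have kn : ∀ k l : Fin 3, l = k ∨ l = k + 1 ∨ l = k + 2 := by decide
    have bs : ∀ k : Fin 3, k + 1 ≠ k ∧ k + 2 ≠ k ∧ k + 1 + 1 = k + 2 ∧ k + 2 + 1 = k := by decide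
    have hex : ∀ x, ∃ k, x ∉ Da → comp G D xa x → (att G Da pa (m+1) x).card = 3 →
        ∃ c ∈ T, att G Da pa (m+1) x = insert m (T.erase c) ∧ node φ k = vert c := by
      intro x
      by_cases h : x ∉ Da ∧ comp G D xa x ∧ (att G Da pa (m+1) x).card = 3
      · obtain ⟨hx, hK, hc⟩ := h
        have kd := hsub x hx hK
        have ke := hcard x hx hK hc
        obtain ⟨c, hcT, hcn⟩ := Finset.exists_mem_notMem_of_card_lt_card (by omega : ((att G Da pa (m+1) x).erase m).card < T.card)
        obtain ⟨k, hk⟩ := (hφT _).2 ⟨c, hcT, rfl⟩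
        refine ⟨k, fun _ _ _ => ⟨c, hcT, ?_, hk⟩⟩
        rw [← Finset.insert_erase (s.new x hx hK).1]
        congr 1
        apply Finset.eq_of_subset_of_card_le
        · intro j hj
          exact mem_erase.2 ⟨fun h => hcn (h ▸ hj), kd hj⟩
        · rw [Finset.card_erase_of_mem hcT]; omega
      · exact ⟨0, fun a b c => (h ⟨a, b, c⟩).elim⟩
    choose kk hkk using hex
    refine s.ph Sd kl Ta vert fa hv hadj hfa hfu ?_ ?_ Sum.inl Sum.inl_injective ?_ (fun x => opp (kk x)) ?_ ?_ ?_
    · rintro u v ⟨f, i, h⟩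
      by_cases hf : f = φ
      · subst hf
        obtain ⟨l, rfl⟩ : ∃ l, i = l + 1 := ⟨i + 2, by clear h; revert i; decide⟩
        refine ⟨opp l, 0, ?_⟩
        have ee : l + 1 + 1 = l + 2 := (bs l).2.2.1
        rw [ee] at h
        rw [hopp]
        simpa using h
      · refine ⟨Sum.inl f, i, ?_⟩
        rw [ng f hf]; simpa using h
    · intro j hj
      obtain ⟨k, hk⟩ := (hφT _).2 ⟨j, hj, rfl⟩
      obtain ⟨l, rfl⟩ : ∃ l, k = l + 2 := ⟨k + 1, by clear hk; revert k; decide⟩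
      refine ⟨opp l, 1, Or.inl ?_⟩
      rw [hopp, ← hk]
      simp
    · intro x hx hK hc k
      have : fa x ≠ φ := fun h => hK (hfu xa x kl (hDD x hx) hT hc h.symm)
      rw [ng _ this]
    · intro x hx hK hc v
      obtain ⟨c, hcT, hca, hkc⟩ := hkk x hx hK hc
      rw [hca]
      simp only [hopp]
      have hne : ∀ l, l ≠ kk x → ∃ j ∈ insert m (T.erase c), j ≠ m ∧ some (vert j) = some (node φ l) := by
        intro l hl
        obtain ⟨j, hj, hjl⟩ := (hφT _).1 ⟨l, rfl⟩
        refine ⟨j, mem_insert_of_mem (mem_erase.2 ⟨?_, hj⟩), (hTm j hj).ne, by rw [hjl]⟩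
        rintro rfl
        exact hl (hφi (hjl.symm.trans hkc.symm))
      constructor
      · rintro ⟨k, rfl⟩
        rcases cj k with rfl | rfl | rfl
        · exact Or.inr (hne _ (bs _).1)
        · exact Or.inr (hne _ (bs _).2.1)
        · exact Or.inl rfl
      · rintro (rfl | ⟨j, hj, hjm, rfl⟩)
        · exact ⟨2, rfl⟩
        · have hj := mem_erase.1 ((mem_insert.1 hj).resolve_left hjm)
          obtain ⟨l, hl⟩ := (hφT _).2 ⟨j, hj.2, rfl⟩
          rcases kn (kk x) l with h | h | h
          · subst h
            exact (hj.1 (hv _ _ (hTm _ hj.2) (hTm _ hcT) (hl.symm.trans hkc))).elim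
          · exact ⟨0, by simp [← h, hl]⟩
          · exact ⟨1, by simp [← h, hl]⟩
    · intro x y hx hy hKx hKy hcx hcy hxy
      obtain ⟨c, hcT, hca, hkc⟩ := hkk x hx hKx hcx
      obtain ⟨cb, gl, gm, gn⟩ := hkk y hy hKy hcy
      have hk := oppi _ _ hxy
      have : c = cb := hv _ _ (hTm _ hcT) (hTm _ gl) (by rw [← hkc, hk, gn])
      subst this
      refine s.lc S Sd x y hx hy hcx (hca.trans gm.symm) (pt Da pa c) (s.pc Sd c)
        (fun u hu h => h.notin hx hu.1) (fun u hu h => h.notin hy hu.1) ?_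
      intro i hi
      have hic : c ≠ i := by
        rintro rfl
        rw [hca, mem_insert, mem_erase] at hi
        rcases hi with h | h
        · exact (hTm c hcT).ne h
        · exact h.1 rfl
      exact ⟨fun u hu kw => hic (hu.2.symm.trans kw.2),
        s.sadj Sd kl (mem_insert_of_mem hcT) ((s.new x hx hKx).2 hi) hic⟩
    · intro x y hx hy hKx hKy hcx hcy h
      have : fa y ≠ φ := fun h => hKy (hfu xa y kl (hDD y hy) hT hcy h.symm)
      simp only [opp] at h
      rcases cj (kk x) with kj | kj | kj <;> rw [kj] at h <;> simp at h
      exact this h.symm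
  · have hfi : ∃ f i, (∀ j ∈ T, vert j = node f i ∨ vert j = node f (i+1)) ∧ (T.card = 2 →
        (∃ j ∈ T, vert j = node f i) ∧ ∃ j ∈ T, vert j = node f (i+1)) := by
      rcases (by omega : T.card = 0 ∨ T.card = 1 ∨ T.card = 2) with h | h | h
      · obtain ⟨c, hc⟩ := Tb.surj (vert 0)
        rw [Finset.card_eq_zero] at h
        exact ⟨c.1, c.2, by simp [h], by simp [h]⟩
      · obtain ⟨a, ha⟩ := Finset.card_eq_one.1 h
        obtain ⟨c, hc⟩ := Tb.surj (vert a)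
        exact ⟨c.1, c.2, by simp only [ha, mem_singleton]; rintro j rfl; exact Or.inl hc.symm, by simp [ha]⟩
      · obtain ⟨a, b, hab, hTab⟩ := Finset.card_eq_two.1 h
        have ha : a ∈ T := by simp [hTab]
        have hb : b ∈ T := by simp [hTab]
        obtain ⟨f, i, hfi⟩ := hadj a b (hTm a ha) (hTm b hb) hab (Sd.acl xa kl a ha b hb hab)
        refine ⟨f, i, ?_, fun _ => ?_⟩
        · rw [hTab]
          rcases hfi with ⟨kd, ke⟩ | ⟨kd, ke⟩ <;> simp [kd, ke]
        · rcases hfi with ⟨kd, ke⟩ | ⟨kd, ke⟩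
          · exact ⟨⟨a, ha, kd.symm⟩, b, hb, ke.symm⟩
          · exact ⟨⟨b, hb, kd.symm⟩, a, ha, ke.symm⟩
    obtain ⟨f, i, em, aj⟩ := hfi
    obtain ⟨na, kr, Ta, ng, nj⟩ := Tb.stack2 f i
    have heq : ∀ x, x ∉ Da → comp G D xa x → (att G Da pa (m+1) x).card = 3 → T.card = 2 ∧ att G Da pa (m+1) x = insert m T := by
      intro x hx hK hc
      have kd := hsub x hx hK
      have ke := hcard x hx hK hc
      have kf := Finset.card_le_card kd
      have ki : T.card = 2 := by omega
      refine ⟨ki, ?_⟩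
      rw [← Finset.insert_erase (s.new x hx hK).1, Finset.eq_of_subset_of_card_le kd (by omega)]
    obtain ⟨xe, bt⟩ : ∃ xe, ∀ x, x ∉ Da → comp G D xa x → (att G Da pa (m+1) x).card = 3 →
        xe ∉ Da ∧ comp G D xa xe ∧ (att G Da pa (m+1) xe).card = 3 := by
      by_cases h : ∃ x, x ∉ Da ∧ comp G D xa x ∧ (att G Da pa (m+1) x).card = 3
      · obtain ⟨xe, h⟩ := h
        exact ⟨xe, fun _ _ _ _ => h⟩
      · exact ⟨xa, fun x a b c => (h ⟨x, a, b, c⟩).elim⟩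
    refine s.ph Sd kl Ta vert fa hv hadj hfa hfu ?_ ?_ Sum.inl Sum.inl_injective ?_
      (fun x => if comp G Da xe x then Sum.inr 0 else Sum.inr 1) ?_ ?_ ?_
    · rintro u v ⟨f, i, h⟩
      refine ⟨Sum.inl f, i, ?_⟩
      rw [ng f]; simpa using h
    · intro j hj
      rcases em j hj with h | h
      · exact ⟨Sum.inr 0, 2, Or.inr (by rw [nj, h]; simp)⟩
      · exact ⟨Sum.inr 0, 1, Or.inl (by rw [nj, h]; simp)⟩
    · intro x hx hK hc k
      rw [ng]
    · intro x hx hK hc v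
      obtain ⟨go, hca⟩ := heq x hx hK hc
      obtain ⟨⟨a, ha, bl⟩, b, hb, am⟩ := aj go
      have : na (if comp G Da xe x then Sum.inr 0 else Sum.inr 1) = ![some (node f i), some (node f (i+1)), none] := by
        split_ifs <;> exact nj _
      rw [hca]
      simp only [this]
      constructor
      · rintro ⟨k, rfl⟩
        rcases cj k with rfl | rfl | rfl
        · exact Or.inr ⟨a, mem_insert_of_mem ha, (hTm a ha).ne, by rw [bl]; rfl⟩
        · exact Or.inr ⟨b, mem_insert_of_mem hb, (hTm b hb).ne, by rw [am]; rfl⟩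
        · exact Or.inl rfl
      · rintro (rfl | ⟨j, hj, hjm, rfl⟩)
        · exact ⟨2, rfl⟩
        · rcases em j ((mem_insert.1 hj).resolve_left hjm) with h | h
          · exact ⟨0, by rw [h]; rfl⟩
          · exact ⟨1, by rw [h]; rfl⟩
    · intro x y hx hy hKx hKy hcx hcy hxy
      obtain ⟨kd, ke, kf⟩ := bt x hx hKx hcx
      have ex := (heq x hx hKx hcx).2
      have ey := (heq y hy hKy hcy).2
      have ee := (heq xe kd ke kf).2
      by_cases h1x : comp G Da xe x <;> by_cases h1y : comp G Da xe y <;> simp [h1x, h1y] at hxy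
      · exact h1x.symm.trans h1y
      · refine s.lc S Sd x y hx hy hcx (ex.trans ey.symm) {u | comp G Da xe u} (cr xe kd)
          (fun u hu h => h1x (comp.trans hu h.symm)) (fun u hu h => h1y (comp.trans hu h.symm)) ?_
        intro i hi
        refine ⟨fun u hu kw => comp.notin hu kd kw.1, ap (x := xe) (m := m+1) ?_⟩
        rw [ee, ← ex]; exact hi
    · intro x y hx hy hKx hKy hcx hcy h
      split_ifs at h

theorem Sys.run (S : Sys G z par rk hub nat lay d q) :
    ∃ m p, St G z hub nat lay (d + 3 * q - 3) m univ p ∧ Pl G univ p m := by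
  have ind : ∀ k (D : Finset W) m p, (univ \ D).card ≤ k → St G z hub nat lay (d + 3 * q - 3) m D p → Pl G D p m →
      ∃ m p, St G z hub nat lay (d + 3 * q - 3) m univ p ∧ Pl G univ p m := by
    intro k
    induction k with
    | zero =>
      intro D m p hk kd ke
      have : D = univ := by
        rw [Nat.le_zero, Finset.card_eq_zero, Finset.sdiff_eq_empty_iff_subset] at hk
        exact Finset.univ_subset_iff.1 hk
      subst this
      exact ⟨m, p, kd, ke⟩
    | succ k ih =>
      intro D m p hk kd ke
      by_cases hD : D = univ
      · subst hD; exact ⟨m, p, kd, ke⟩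
      obtain ⟨xa, kl⟩ : ∃ xa, xa ∉ D := by
        by_contra h; push Not at h; exact hD (Finset.eq_univ_iff_forall.2 h)
      obtain ⟨Y, yb, yc, ye, yf, yg, yh⟩ := find_Y S kd xa kl
      have s := mkStp kd xa kl Y yb yc ye yf
      refine ih _ _ _ ?_ (s.st S kd kl yg yh) (s.pl S kd kl ke)
      have : univ \ (D ∪ Y) ⊂ univ \ D := by
        obtain ⟨y, hy⟩ := yb
        rw [Finset.ssubset_iff_of_subset (Finset.sdiff_subset_sdiff le_rfl subset_union_left)]
        exact ⟨y, by simp [s.YD y hy], by simp [hy]⟩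
      have := Finset.card_lt_card this
      omega
  have hpt : ∀ i, pt ({z} : Finset W) (fun _ => 0) i ⊆ {z} := fun i n hn => by simpa using hn.1
  have km : ∀ x i, i ∈ att G {z} (fun _ => 0) 1 x → i = 0 := by
    intro x i hi
    simp only [att, mem_filter, mem_range] at hi; omega
  have kd : ∀ x, (att G {z} (fun _ => 0) 1 x).card ≤ 1 :=
    fun x => Finset.card_le_one.2 fun a ha b hb => (km x a ha).trans (km x b hb).symm
  obtain ⟨σ, hσ⟩ := ts_base
  refine ind _ {z} 1 (fun _ => 0) le_rfl ⟨by simp, by simp, by simp, ?_, ?_, ?_, ?_, ?_, ?_⟩ ?_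
  · intro i x hx y hy P hP _
    rw [hpt i hx] at hP; rw [hpt i hy]; exact hP
  · intro x hx i hi j hj hij
    exact (hij ((km x i hi).trans (km x j hj).symm)).elim
  · exact fun x hx => le_trans (kd x) (by norm_num)
  · intro j hj
    obtain rfl : j = 0 := by omega
    simp
  · intro v hv hh
    simp only [mem_singleton] at hv
    exact (S.hub_z (hv ▸ hh)).elim
  · intro i hi l
    rw [Finset.filter_false_of_mem]
    · simp
    · intro n _ h; omega
  · refine ⟨Fin 3, Fin 3, Fin 2, inferInstance, inferInstance, inferInstance, σ, _, hσ, fun _ => 0, fun _ => 0, ?_, ?_, ?_, ?_⟩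
    · intro i j hi hj _; omega
    · intro i j hi hj hij; omega
    · intro x hx hc; have := kd x; omega
    · intro x y _ _ hc; have := kd x; omega

end Step

theorem th {m : ℕ} (hm : 0 < m) (H : SimpleGraph (Fin m))
    (hc : ∀ j : Fin m, (univ.filter fun i => i < j ∧ H.Adj i j).card ≤ 3)
    (hq : ∀ i ib j : Fin m, i < j → ib < j → i ≠ ib → H.Adj i j → H.Adj ib j → H.Adj i ib) : TreewidthLE H 3 := by
  let N : Fin m → Finset (Fin m) := fun j => univ.filter fun i => i < j ∧ H.Adj i j
  have hN : ∀ i j, i ∈ N j ↔ i < j ∧ H.Adj i j := fun i j => by simp [N]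
  let o : Fin m := ⟨0, hm⟩
  have hpar : ∀ j : Fin m, ∃ k, (j ≠ o → k < j) ∧ ((N j).Nonempty → k ∈ N j) ∧ ∀ i ∈ N j, i ≤ k := by
    intro j
    by_cases h : (N j).Nonempty
    · exact ⟨(N j).max' h, fun _ => ((hN _ _).1 (Finset.max'_mem _ h)).1, fun _ => Finset.max'_mem _ h,
        fun i hi => Finset.le_max' _ _ hi⟩
    · rw [Finset.not_nonempty_iff_eq_empty] at h
      refine ⟨o, fun kj => ?_, by simp [h], by simp [h]⟩
      rw [Fin.lt_def]; exact Nat.pos_of_ne_zero fun km => kj (Fin.ext km)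
  choose par kd ke kf using hpar
  let T : SimpleGraph (Fin m) := SimpleGraph.fromRel fun j k => j ≠ o ∧ k = par j
  have hT : ∀ j, j ≠ o → T.Adj j (par j) := by
    intro j hj
    rw [SimpleGraph.fromRel_adj]
    exact ⟨(kd j hj).ne', Or.inl ⟨hj, rfl⟩⟩
  have hreach : ∀ k, ∀ j : Fin m, j.val ≤ k → T.Reachable j o := by
    intro k
    induction k with
    | zero => intro j hj; rw [show j = o from Fin.ext (by simpa using hj)]
    | succ k ih =>
      intro j hj
      by_cases h : j = o
      · rw [h]
      · have := kd j h
        rw [Fin.lt_def] at this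
        exact (hT j h).reachable.trans (ih _ (by omega))
  have hconn : T.Connected := by
    haveI : Nonempty (Fin m) := ⟨o⟩
    exact ⟨fun a b => (hreach _ a le_rfl).trans (hreach _ b le_rfl).symm⟩
  refine ⟨Fin m, T, fun j => insert j (N j : Set (Fin m)), ?_, fun v => ⟨v, by simp⟩, ?_, ?_, ?_⟩
  · rw [SimpleGraph.isTree_iff_connected_and_card]
    refine ⟨hconn, le_antisymm ?_ ?_⟩
    · have hsub : T.edgeSet ⊆ ((univ.erase o).image fun j => s(j, par j) : Finset (Sym2 (Fin m))) := by
        intro e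
        induction e with
        | _ a b =>
        intro he
        rw [SimpleGraph.mem_edgeSet, SimpleGraph.fromRel_adj] at he
        simp only [coe_image, Set.mem_image, mem_coe, mem_erase, mem_univ, and_true]
        rcases he.2 with ⟨h, kj⟩ | ⟨h, kj⟩
        · exact ⟨a, h, by rw [kj]⟩
        · exact ⟨b, h, by rw [kj, Sym2.eq_swap]⟩
      have kd := Set.ncard_le_ncard hsub (Finset.finite_toSet _)
      rw [Set.ncard_coe_finset] at kd
      have ke := Finset.card_image_le (s := univ.erase o) (f := fun j => s(j, par j))
      rw [Finset.card_erase_of_mem (mem_univ _), Finset.card_univ, Fintype.card_fin] at ke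
      change T.edgeSet.ncard + 1 ≤ _
      rw [Nat.card_eq_fintype_card, Fintype.card_fin]
      omega
    · exact hconn.card_vert_le_card_edgeSet_add_one
  · intro u v huv
    rcases lt_or_gt_of_ne huv.ne with h | h
    · exact ⟨v, by simp [hN, h, huv], by simp⟩
    · exact ⟨u, by simp, by simp [hN, h, huv.symm]⟩
  · intro v
    let s : Set (Fin m) := {i | v ∈ insert i (N i : Set (Fin m))}
    have hs : ∀ i, i ∈ s ↔ v = i ∨ v ∈ N i := fun i => by simp [s]
    have hv : v ∈ s := (hs v).2 (Or.inl rfl)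
    have key : ∀ k, ∀ j : Fin m, j.val ≤ k → ∀ hj : j ∈ s, (T.induce s).Reachable ⟨j, hj⟩ ⟨v, hv⟩ := by
      intro k
      induction k with
      | zero =>
        intro j hj hjs
        rcases (hs j).1 hjs with h | h
        · subst h; rfl
        · have := ((hN _ _).1 h).1; rw [Fin.lt_def] at this; omega
      | succ k ih =>
        intro j hj hjs
        rcases (hs j).1 hjs with h | h
        · subst h; rfl
        · have hlt := ((hN _ _).1 h).1
          have hjo : j ≠ o := by rintro rfl; rw [Fin.lt_def] at hlt; simp [o] at hlt
          have hp := (hN _ _).1 (ke j ⟨v, h⟩)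
          have hle := kf j v h
          have hps : par j ∈ s := by
            rw [hs]
            by_cases he : v = par j
            · exact Or.inl he
            · exact Or.inr ((hN _ _).2 ⟨lt_of_le_of_ne hle he, hq _ _ j hlt hp.1 he ((hN _ _).1 h).2 hp.2⟩)
          have hpl := hp.1
          rw [Fin.lt_def] at hpl
          refine SimpleGraph.Reachable.trans (SimpleGraph.Adj.reachable ?_) (ih (par j) (by omega) hps)
          exact hT j hjo
    haveI : Nonempty s := ⟨⟨v, hv⟩⟩
    exact ⟨fun a b => (key _ a.1 le_rfl a.2).trans (key _ b.1 le_rfl b.2).symm⟩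
  · intro j
    refine (Set.encard_insert_le _ _).trans ?_
    rw [Set.encard_coe_eq_coe_finsetCard]
    have := hc j
    norm_cast
    have kj : (N j).card ≤ 3 := hc j
    omega

theorem Sys.out {W : Type} [Fintype W] {G : SimpleGraph W} {z : W} {par : W → W} {rk : W → ℕ} {hub nat : W → Prop}
    {lay : W → ℕ} {d q : ℕ} (S : Sys G z par rk hub nat lay d q) :
    ∃ (m : ℕ) (H : SimpleGraph (Fin m)) (p : W → Fin m), IsPlanar H ∧ TreewidthLE H 3 ∧
      (∀ n, p n = p z → n = z) ∧
      (∀ i, i ≠ p z → ∀ l, (univ.filter fun n => p n = i ∧ nat n ∧ lay n = l).card ≤ d + 3 * q - 3) ∧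
      ∀ v, hub v → ∀ x y, G.Adj v x → G.Adj v y → p x = p y ∨ H.Adj (p x) (p y) := by
  obtain ⟨m, p, h, V, E, F, iV, iE, iF, σ, node, hTS, vert, fa, hv, hadj, -⟩ := S.run
  have hlt : ∀ n, p n < m := fun n => h.lt n (mem_univ n)
  have hz : p z = 0 := (h.pz z (mem_univ _)).2 rfl
  have hm : 0 < m := hz ▸ hlt z
  let H : SimpleGraph (Fin m) :=
    { Adj := fun i j => i ≠ j ∧ SAdj G (pt univ p i) (pt univ p j)
      symm := ⟨fun i j hij => ⟨hij.1.symm, hij.2.symm⟩⟩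
      loopless := ⟨fun i hi => hi.1 rfl⟩ }
  refine ⟨m, H, fun n => ⟨p n, hlt n⟩, ?_, ?_, ?_, ?_, ?_⟩
  · obtain ⟨emb, he⟩ := hTS.embedding
    refine ⟨V, E, F, inferInstance, inferInstance, inferInstance, _, emb, by simpa using he, ⟨fun i => vert i, ?_⟩, ?_⟩
    · rintro i j ⟨hij, hs⟩
      have eo : (i : ℕ) ≠ j := fun h => hij (Fin.ext h)
      exact hTS.tadj (hadj i j i.2 j.2 eo hs) (fun h => eo (hv i j i.2 j.2 h))
    · intro i j hij
      exact Fin.ext (hv i j i.2 j.2 hij)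
  · apply th hm
    · intro j
      refine le_trans ?_ (h.back j j.2).1
      rw [← Finset.card_map Fin.valEmbedding]
      apply Finset.card_le_card
      intro i hi
      simp only [mem_map, mem_filter, mem_univ, true_and] at hi
      obtain ⟨a, ⟨kd, ke⟩, rfl⟩ := hi
      simp only [mem_filter, mem_range]
      exact ⟨kd, ke.2⟩
    · intro i ib j kd ke kf ki kp
      exact ⟨kf, (h.back j j.2).2 i ib kd ke (fun h => kf (Fin.ext h)) ki.2 kp.2⟩
  · intro n hn
    rw [Fin.mk.injEq, hz] at hn
    exact (h.pz n (mem_univ _)).1 hn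
  · intro i hi l
    have gp : 1 ≤ (i : ℕ) := Nat.pos_of_ne_zero fun km => hi (Fin.ext (by simp [km, hz]))
    refine le_trans (Finset.card_le_card ?_) (h.bound i gp l)
    intro n hn
    simp only [mem_filter, mem_univ, true_and] at hn ⊢
    exact ⟨by rw [← hn.1], hn.2⟩
  · intro v hh x y hx hy
    rcases (h.hubD v (mem_univ _) hh x hx).2 y hy with kj | kj
    · exact Or.inl (Fin.ext kj)
    · by_cases he : p x = p y
      · exact Or.inl (Fin.ext he)
      · exact Or.inr ⟨fun h => he (by rw [Fin.mk.injEq] at h; exact h), kj⟩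


section Gen
inductive Rch {Y : Type} (R : Y → Y → Prop) (Good : Y → Prop) (w : Y → ℕ) : ℕ → ℕ → Y → Prop
  | base {y} : Good y → Rch R Good w 0 0 y
  | step {a b y ya} : Rch R Good w a b y → R y ya → Rch R Good w (a + w ya) (b + 1) ya

theorem wtree {Y : Type} (R : Y → Y → Prop) (Good : Y → Prop) (w : Y → ℕ)
    (hr : ∀ y, ∃ s, Good s ∧ Relation.ReflTransGen R s y) :
    ∃ (D r : Y → ℕ) (par : Y → Y), (∀ y, ¬ Good y → R (par y) y ∧ D y = D (par y) + w y ∧ r (par y) < r y) ∧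
      (∀ y ya, R y ya → D ya ≤ D y + w ya) := by
  have kd : ∀ y, ∃ a b, Rch R Good w a b y := by
    intro y
    obtain ⟨s, hs, h⟩ := hr y
    induction h with
    | refl => exact ⟨0, 0, .base hs⟩
    | tail _ h ih => obtain ⟨a, b, hab⟩ := ih; exact ⟨_, _, hab.step h⟩
  let D : Y → ℕ := fun y => Nat.find (kd y)
  have hD : ∀ y, ∃ b, Rch R Good w (D y) b y := fun y => Nat.find_spec (kd y)
  let r : Y → ℕ := fun y => Nat.find (hD y)
  have hrr : ∀ y, Rch R Good w (D y) (r y) y := fun y => Nat.find_spec (hD y)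
  have hDm : ∀ y a b, Rch R Good w a b y → D y ≤ a := fun y a b h => Nat.find_min' (kd y) ⟨b, h⟩
  have hrm : ∀ y b, Rch R Good w (D y) b y → r y ≤ b := fun y b h => Nat.find_min' (hD y) h
  have hst : ∀ y ya, R y ya → D ya ≤ D y + w ya := fun y ya h => hDm _ _ _ ((hrr y).step h)
  have : ∀ y, ∃ ya, ¬ Good y → R ya y ∧ D y = D ya + w y ∧ r ya < r y := by
    intro y
    by_cases hg : Good y
    · exact ⟨y, fun h => absurd hg h⟩
    generalize hA : D y = A
    generalize hB : r y = B
    have h := hrr y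
    rw [hA, hB] at h
    cases h with
    | base h => exact absurd h hg
    | @step a b ya _ h kj =>
      refine ⟨ya, fun _ => ⟨kj, ?_, ?_⟩⟩
      · have := hDm _ _ _ h; have := hst _ _ kj; omega
      · have ke := hDm _ _ _ h
        have kf := hst _ _ kj
        have ki : D ya = a := by omega
        rw [← ki] at h
        have := hrm _ _ h
        omega
  choose par hp using this
  exact ⟨D, r, par, hp, hst⟩

theorem wlab {Y F : Type} (Good : Y → Prop) (lab : Y → F) (r : Y → ℕ) (par : Y → Y)
    (h : ∀ y, ¬ Good y → r (par y) < r y) :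
    ∃ ν : Y → F, (∀ y, Good y → ν y = lab y) ∧ ∀ y, ¬ Good y → ν y = ν (par y) := by
  have hfin : ∀ n y, r y ≤ n → ∃ k ≤ n, Good (par^[k] y) := by
    intro n
    induction n with
    | zero =>
      intro y hy
      refine ⟨0, le_rfl, ?_⟩
      by_contra hg
      have := h y hg
      omega
    | succ n ih =>
      intro y hy
      by_cases hg : Good y
      · exact ⟨0, by omega, hg⟩
      obtain ⟨k, hk, ke⟩ := ih (par y) (by have := h y hg; omega)
      exact ⟨k + 1, by omega, by simpa using ke⟩
  have hex : ∀ y, ∃ n, Good (par^[n] y) := fun y => by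
    obtain ⟨k, -, hk⟩ := hfin _ y le_rfl
    exact ⟨k, hk⟩
  refine ⟨fun y => lab (par^[Nat.find (hex y)] y), fun y hy => ?_, fun y hy => ?_⟩
  · have : Nat.find (hex y) = 0 := by rw [Nat.find_eq_zero]; exact hy
    simp [this]
  · have ke : Nat.find (hex y) = Nat.find (hex (par y)) + 1 := by
      rw [Nat.find_eq_iff]
      refine ⟨by simpa using Nat.find_spec (hex (par y)), fun n hn => ?_⟩
      rcases n with _ | n
      · simpa using hy
      · simpa using Nat.find_min (hex (par y)) (by omega : n < _)
    show lab _ = lab _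
    rw [ke]; rfl

theorem invol {X : Type} [Fintype X] (ι : X → X) (kd : ∀ x, ι (ι x) = x) (ke : ∀ x, ι x ≠ x) :
    ∃ (E : Type) (_ : Fintype E) (σ : E × Bool ≃ X), ∀ e, σ (e, true) = ι (σ (e, false)) := by
  let k : X → ℕ := fun x => (Fintype.equivFin X x : ℕ)
  have hk : ∀ x y, k x = k y → x = y := fun x y h => (Fintype.equivFin X).injective (Fin.ext h)
  have hne : ∀ x, ¬ k x < k (ι x) → k (ι x) < k (ι (ι x)) := by
    intro x hx
    rw [kd]
    exact lt_of_le_of_ne (not_lt.mp hx) fun h => ke x (hk _ _ h)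
  refine ⟨{x // k x < k (ι x)}, inferInstance,
    ⟨fun p => bif p.2 then ι p.1.1 else p.1.1,
     fun x => if h : k x < k (ι x) then (⟨x, h⟩, false) else (⟨ι x, hne x h⟩, true), ?_, ?_⟩, fun e => rfl⟩
  · rintro ⟨⟨x, hx⟩, b⟩
    cases b
    · simp [hx]
    · have : ¬ k (ι x) < k (ι (ι x)) := by rw [kd]; omega
      simp only [cond_true, kd]
      exact dif_neg (by omega)
  · intro x
    by_cases h : k x < k (ι x) <;> simp [h, kd]

theorem im {X E : Type} [Fintype X] [Fintype E] (σ : E × Bool ≃ X) : Fintype.card X = 2 * Fintype.card E := by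
  rw [← Fintype.card_congr σ]; simp [mul_comm]
end Gen

section FSsec
variable {Fl V E F C H : Type} [Fintype Fl] [Fintype V] [Fintype E] [Fintype F] [Fintype C] [Fintype H]

structure FS (af ae aa : Fl → Fl) (v : Fl → V) (e : Fl → E) (f : Fl → F) (c : Fl → C) (h : Fl → H) (g : ℕ) : Prop where
  ik : ∀ x, af (af x) = x
  ig : ∀ x, ae (ae x) = x
  ie : ∀ x, aa (aa x) = x
  ni : ∀ x, af x ≠ x
  ng : ∀ x, ae x ≠ x
  nj : ∀ x, aa x ≠ x
  vc : ∀ x, v (ae x) = v x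
  va : ∀ x, v (aa x) = v x
  eg : ∀ x, e (af x) = e x
  ef : ∀ x, e (aa x) = e x
  fg : ∀ x, f (af x) = f x
  ff : ∀ x, f (ae x) = f x
  c_iff : ∀ x y, c x = c y ↔ y = x ∨ y = ae x
  h_iff : ∀ x y, h x = h y ↔ y = x ∨ y = aa x
  sv : Function.Surjective v
  se : Function.Surjective e
  sf : Function.Surjective f
  sc : Function.Surjective c
  sh : Function.Surjective h
  lnk : ∀ (S : Fl → Prop), (∀ x, S x → S (ae x)) → (∀ x, S x → S (aa x)) → ∀ x y, v x = v y → S x → S y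
  con : ∀ (S : Fl → Prop), (∀ x, S x → S (af x)) → (∀ x, S x → S (ae x)) → (∀ x, S x → S (aa x)) → ∀ x y, S x → S y
  ce : Fintype.card Fl = 4 * Fintype.card E
  cc : Fintype.card Fl = 2 * Fintype.card C
  ch : Fintype.card Fl = 2 * Fintype.card H
  cg : Fintype.card E + 2 ≤ Fintype.card V + Fintype.card F + g

def glu (af ae aa : Fl → Fl) (s : (Fl × Fin 3) × Fin 3) : (Fl × Fin 3) × Fin 3 :=
  match s with
  | ((x, 0), 0) => ((ae x, 0), 0)
  | ((x, 0), 1) => ((x, 1), 1)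
  | ((x, 0), 2) => ((aa x, 0), 2)
  | ((x, 1), 0) => ((aa x, 1), 0)
  | ((x, 1), 1) => ((x, 0), 1)
  | ((x, 1), 2) => ((x, 2), 0)
  | ((x, 2), 0) => ((x, 1), 2)
  | ((x, 2), 1) => ((ae x, 2), 1)
  | ((x, 2), 2) => ((af x, 2), 2)

def nod {L : Type} (nv ne nf nc nh : Fl → L) (t : Fl × Fin 3) (i : Fin 3) : L :=
  match t, i with
  | (x, 0), 0 => nv x
  | (x, 0), 1 => nc x
  | (x, 0), 2 => nh x
  | (x, 1), 0 => ne x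
  | (x, 1), 1 => nh x
  | (x, 1), 2 => nc x
  | (x, 2), 0 => ne x
  | (x, 2), 1 => nc x
  | (x, 2), 2 => nf x

theorem nod_comp {L La : Type} (b : L → La) (nv ne nf nc nh : Fl → L) (t : Fl × Fin 3) (i : Fin 3) :
    b (nod nv ne nf nc nh t i) = nod (b ∘ nv) (b ∘ ne) (b ∘ nf) (b ∘ nc) (b ∘ nh) t i := by
  obtain ⟨x, j⟩ := t
  fin_cases j <;> fin_cases i <;> rfl

variable {af ae aa : Fl → Fl} {v : Fl → V} {e : Fl → E} {f : Fl → F} {c : Fl → C} {h : Fl → H} {g : ℕ}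

abbrev Nb (V E F C H : Type) := (V ⊕ E) ⊕ F ⊕ C ⊕ H
def qv (v : Fl → V) (x : Fl) : Nb V E F C H := .inl (.inl (v x))
def qe (e : Fl → E) (x : Fl) : Nb V E F C H := .inl (.inr (e x))
def qf (f : Fl → F) (x : Fl) : Nb V E F C H := .inr (.inl (f x))
def qc (c : Fl → C) (x : Fl) : Nb V E F C H := .inr (.inr (.inl (c x)))
def qh (h : Fl → H) (x : Fl) : Nb V E F C H := .inr (.inr (.inr (h x)))
def qn (v : Fl → V) (e : Fl → E) (f : Fl → F) (c : Fl → C) (h : Fl → H) : Fl × Fin 3 → Fin 3 → Nb V E F C H :=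
  nod (qv v) (qe e) (qf f) (qc c) (qh h)

theorem fin3c : ∀ k : Fin 3, k = 0 ∨ k = 1 ∨ k = 2 := by decide

theorem side_glu {T E : Type} (σ : E × Bool ≃ T × Fin 3) (ι : T × Fin 3 → T × Fin 3)
    (hι : ∀ x, ι (ι x) = x) (hσ : ∀ e, σ (e, true) = ι (σ (e, false))) (s : T × Fin 3) :
    side σ (ι s).1 (ι s).2 = side σ s.1 s.2 := by
  obtain ⟨⟨e, b⟩, rfl⟩ := σ.surjective s
  have kd : ι (σ (e, b)) = σ (e, !b) := by
    cases b
    · rw [← hσ]; rfl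
    · rw [hσ, hι]; rfl
  rw [kd]; simp [side]

theorem FS.ex (Q : FS af ae aa v e f c h g) :
    ∃ (EQ : Type) (_ : Fintype EQ) (σ : EQ × Bool ≃ (Fl × Fin 3) × Fin 3),
      (∀ s, side σ (glu af ae aa s).1 (glu af ae aa s).2 = side σ s.1 s.2) ∧
      PreP σ (qn v e f c h) univ g ∧ reached (qn v e f c h) = univ := by
  have ci : ∀ x, c (ae x) = c x := fun x => ((Q.c_iff _ _).2 (Or.inr rfl)).symm
  have ke : ∀ x, h (aa x) = h x := fun x => ((Q.h_iff _ _).2 (Or.inr rfl)).symm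
  have hi : ∀ s, glu af ae aa (glu af ae aa s) = s := by
    rintro ⟨⟨x, j⟩, i⟩
    fin_cases j <;> fin_cases i <;> simp [glu, Q.ik, Q.ig, Q.ie]
  have hn : ∀ s, glu af ae aa s ≠ s := by
    rintro ⟨⟨x, j⟩, i⟩
    fin_cases j <;> fin_cases i <;> simp [glu, Q.ni, Q.ng, Q.nj]
  obtain ⟨EQ, _, σ, hσ⟩ := invol _ hi hn
  have hreach : reached (qn v e f c h) = univ := by
    rw [eq_univ_iff_forall]
    rintro ((y | y) | y | y | y)
    · obtain ⟨x, rfl⟩ := Q.sv y; exact mb (node := qn v e f c h) (x, 0) 0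
    · obtain ⟨x, rfl⟩ := Q.se y; exact mb (node := qn v e f c h) (x, 1) 0
    · obtain ⟨x, rfl⟩ := Q.sf y; exact mb (node := qn v e f c h) (x, 2) 2
    · obtain ⟨x, rfl⟩ := Q.sc y; exact mb (node := qn v e f c h) (x, 0) 1
    · obtain ⟨x, rfl⟩ := Q.sh y; exact mb (node := qn v e f c h) (x, 0) 2
  refine ⟨EQ, inferInstance, σ, side_glu σ _ hi hσ, ⟨?_, ?_, ?_, ?_⟩, hreach⟩
  · intro ea
    simp only [src, tgt, hσ]
    generalize σ (ea, false) = s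
    obtain ⟨⟨x, j⟩, i⟩ := s
    fin_cases j <;> fin_cases i <;>
      simp [glu, qn, nod, qv, qe, qf, qc, qh, Q.vc, Q.va, Q.eg, Q.ef, Q.fg, Q.ff, ci, ke]
  · intro ea he; exact absurd (mem_univ _) he
  · intro S hS
    have ai : ∀ s, S (glu af ae aa s).1 = S s.1 := by
      intro s
      obtain ⟨⟨e, b⟩, rfl⟩ := σ.surjective s
      cases b
      · rw [← hσ]; exact (hS e (mem_univ _)).symm
      · rw [hσ, hi]; have := hS e (mem_univ _); rw [lf, rt, hσ] at this; exact this
    have kg : ∀ x, S (x, 1) = S (x, 0) := fun x => ai ((x, 0), 1)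
    have kh : ∀ x, S (x, 2) = S (x, 1) := fun x => ai ((x, 1), 2)
    have kn : ∀ x j, S (x, j) = S (x, 0) := by
      intro x j
      rcases fin3c j with rfl | rfl | rfl
      · rfl
      · exact kg x
      · rw [kh, kg]
    rintro ⟨x, j⟩ ⟨y, jc⟩
    rw [kn x, kn y]
    refine (Q.con (fun y => S (y, 0) = S (x, 0)) ?_ ?_ ?_ x y rfl).symm
    · intro y hy; rw [← hy, ← kn y 2, ← kn _ 2]; exact ai ((y, 2), 2)
    · intro y hy; rw [← hy]; exact ai ((y, 0), 0)
    · intro y hy; rw [← hy]; exact ai ((y, 0), 2)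
  · rw [hreach, card_univ, card_univ]
    have := im σ
    have := Q.ce; have := Q.cc; have := Q.ch; have := Q.cg
    simp only [Fintype.card_prod, Fintype.card_fin, Fintype.card_sum] at *
    omega
end FSsec

section FSsec
variable {Fl V E F C H : Type} [Fintype Fl] [Fintype V] [Fintype E] [Fintype F] [Fintype C] [Fintype H]
variable {af ae aa : Fl → Fl} {v : Fl → V} {e : Fl → E} {f : Fl → F} {c : Fl → C} {h : Fl → H} {g : ℕ}

theorem FS.ci (Q : FS af ae aa v e f c h g) (x) : c (ae x) = c x := ((Q.c_iff _ _).2 (Or.inr rfl)).symm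
theorem FS.ke (Q : FS af ae aa v e f c h g) (x) : h (aa x) = h x := ((Q.h_iff _ _).2 (Or.inr rfl)).symm

theorem FS.cross (Q : FS af ae aa v e f c h g) (u : V) (U : C ⊕ H → Prop) (x y : Fl) (hx : v x = u) (hy : v y = u)
    (kd : U (.inl (c x))) (ke : ¬ U (.inl (c y))) :
    2 ≤ (univ.filter fun x => v x = u ∧ ¬ (U (.inl (c x)) ↔ U (.inr (h x)))).card := by
  set A := univ.filter fun x => v x = u ∧ ¬ (U (.inl (c x)) ↔ U (.inr (h x))) with hA
  have hne : A.Nonempty := by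
    by_contra hem
    rw [not_nonempty_iff_eq_empty, filter_eq_empty_iff] at hem
    have er : ∀ x, v x = u → (U (.inl (c x)) ↔ U (.inr (h x))) := fun x hx => by
      have := hem (mem_univ x); tauto
    have := Q.lnk (fun x => v x = u ∧ U (.inl (c x)))
      (fun x ⟨kg, kh⟩ => ⟨(Q.vc x).trans kg, by rw [Q.ci]; exact kh⟩)
      (fun x ⟨kg, kh⟩ => ⟨(Q.va x).trans kg, by
        rw [er _ ((Q.va x).trans kg), Q.ke, ← er _ kg]; exact kh⟩) x y (hx.trans hy.symm) ⟨hx, kd⟩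
    exact ke this.2
  let ind : Prop → K := fun p => if p then 1 else 0
  have sl : ∑ x ∈ univ.filter (fun x => v x = u), ind (U (.inl (c x))) = 0 := by
    refine sum_involution (fun x _ => ae x) ?_ ?_ ?_ ?_
    · intro x _; rw [Q.ci]; exact Ka _
    · intro x _ _; exact Q.ng x
    · intro x hx; simpa [Q.vc] using hx
    · intro x _; exact Q.ig x
  have sm : ∑ x ∈ univ.filter (fun x => v x = u), ind (U (.inr (h x))) = 0 := by
    refine sum_involution (fun x _ => aa x) ?_ ?_ ?_ ?_
    · intro x _; rw [Q.ke]; exact Ka _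
    · intro x _ _; exact Q.nj x
    · intro x hx; simpa [Q.va] using hx
    · intro x _; exact Q.ie x
  have sn : (A.card : K) = 0 := by
    have : (A.card : K) = ∑ x ∈ univ.filter (fun x => v x = u), (ind (U (.inl (c x))) + ind (U (.inr (h x)))) := by
      rw [card_eq_sum_ones, Nat.cast_sum, hA, ← filter_filter, sum_filter]
      refine sum_congr rfl fun x _ => ?_
      have := Ka (1 : K)
      by_cases kg : U (.inl (c x)) <;> by_cases kh : U (.inr (h x)) <;> simp [ind, kg, kh, this]
    rw [this, sum_add_distrib, sl, sm, add_zero]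
  have s4 : 2 ∣ A.card := (ZMod.natCast_eq_zero_iff _ _).1 sn
  have := hne.card_pos
  omega

theorem FS.depth (Q : FS af ae aa v e f c h g) (u : V) (D : C ⊕ H → ℕ) (B : Finset Fl)
    (hD : ∀ x, v x = u → D (.inl (c x)) ≤ D (.inr (h x)) + 1 ∧ D (.inr (h x)) ≤ D (.inl (c x)) + 1)
    (hB : ∀ x, v x = u → D (.inl (c x)) ≠ D (.inr (h x)) → x ∈ B) (x y : Fl) (hx : v x = u) (hy : v y = u) :
    2 * (D (.inl (c x)) - D (.inl (c y))) ≤ B.card := by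
  let A : ℕ → Finset Fl := fun t => univ.filter fun x => v x = u ∧ ¬ (t ≤ D (.inl (c x)) ↔ t ≤ D (.inr (h x)))
  have kd : ((Ioc (D (.inl (c y))) (D (.inl (c x)))).biUnion A).card ≤ B.card := by
    apply card_le_card
    intro z hz
    simp only [mem_biUnion, A, mem_filter, mem_univ, true_and] at hz
    obtain ⟨t, -, hz, k⟩ := hz
    exact hB z hz fun h => k (by rw [h])
  rw [card_biUnion] at kd
  · refine le_trans ?_ kd
    refine le_trans ?_ (card_nsmul_le_sum _ _ 2 fun t ht => ?_)
    · simp [mul_comm]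
    · rw [mem_Ioc] at ht
      refine (Q.cross u (fun y => t ≤ D y) x y hx hy ht.2 (by omega)).trans (le_of_eq ?_)
      simp only [A]; congr
  · intro s _ t _ hst
    rw [Function.onFun, disjoint_left]
    intro z kd ke
    simp only [A, mem_filter, mem_univ, true_and] at kd ke
    have := hD z kd.1
    omega

theorem FS.vor (Q : FS af ae aa v e f c h g) (nation : F → Prop) :
    ∃ ν : C ⊕ H → F,
      (∀ x, ∀ y, y = .inl (c x) ∨ y = .inr (h x) →
        (∃ xb, v xb = v x ∧ f xb = ν y) ∧ ((∃ xb, v xb = v x ∧ nation (f xb)) → nation (ν y))) ∧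
      (∀ x, nation (f x) → ∃ xb, v xb = v x ∧ ν (.inl (c xb)) = f x) ∧
      (∀ (S : C ⊕ H → K) (SF : F → K), (∀ x, ν (.inl (c x)) = f x → S (.inl (c x)) = SF (f x)) →
        (∀ x, ν (.inl (c x)) = ν (.inr (h x)) → S (.inl (c x)) = S (.inr (h x))) → ∀ y, S y = SF (ν y)) ∧
      (∀ u, (∃ xb, v xb = u ∧ nation (f xb)) → (univ.filter fun x => v x = u ∧ ν (.inl (c x)) ≠ ν (.inr (h x))).card ≤
        (univ.filter fun n => nation n ∧ ∃ x, v x = u ∧ f x = n).card) := by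
  have hrep : ∀ (u : V) (n : F), ∃ x, (∃ xb, v xb = u ∧ f xb = n) → v x = u ∧ f x = n := by
    intro u n
    by_cases k : ∃ xb, v xb = u ∧ f xb = n
    · obtain ⟨x, hx⟩ := k; exact ⟨x, fun _ => hx⟩
    · obtain ⟨x, -⟩ := Q.sv u; exact ⟨x, fun h => absurd h k⟩
  choose rep hrep using hrep
  let rc : C → Fl := Function.surjInv Q.sc
  have hrc : ∀ y, c (rc y) = y := Function.surjInv_eq Q.sc
  let rh : H → Fl := Function.surjInv Q.sh
  have hrh : ∀ y, h (rh y) = y := Function.surjInv_eq Q.sh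
  let Vy : C ⊕ H → V := Sum.elim (fun y => v (rc y)) (fun y => v (rh y))
  have ao : ∀ x, Vy (.inl (c x)) = v x := by
    intro x
    show v (rc (c x)) = v x
    rcases (Q.c_iff _ _).1 (hrc (c x)).symm with k | k <;> rw [k]
    exact Q.vc x
  have bh : ∀ x, Vy (.inr (h x)) = v x := by
    intro x
    show v (rh (h x)) = v x
    rcases (Q.h_iff _ _).1 (hrh (h x)).symm with k | k <;> rw [k]
    exact Q.va x
  let lab : C ⊕ H → F := Sum.elim (fun y => f (rc y)) (fun y => f (rh y))
  have hl : ∀ x, lab (.inl (c x)) = f x := by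
    intro x
    show f (rc (c x)) = f x
    rcases (Q.c_iff _ _).1 (hrc (c x)).symm with k | k <;> rw [k]
    exact Q.ff x
  let Good : C ⊕ H → Prop := fun y => ∃ x, y = .inl (c x) ∧
    ((∃ xb, v xb = v x ∧ nation (f xb)) → nation (f x) ∧ c x = c (rep (v x) (f x)))
  let R : C ⊕ H → C ⊕ H → Prop := fun y ya => ∃ x, (y = .inl (c x) ∧ ya = .inr (h x)) ∨ (y = .inr (h x) ∧ ya = .inl (c x))
  have hgr : ∀ x, nation (f x) → Good (.inl (c (rep (v x) (f x)))) ∧ v (rep (v x) (f x)) = v x ∧ f (rep (v x) (f x)) = f x := by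
    intro x hx
    obtain ⟨kg, kh⟩ := hrep (v x) (f x) ⟨x, rfl, rfl⟩
    exact ⟨⟨_, rfl, fun _ => by rw [kg, kh]; exact ⟨hx, rfl⟩⟩, kg, kh⟩
  have hr : ∀ y, ∃ s, Good s ∧ Relation.ReflTransGen R s y := by
    have key : ∀ x, ∃ s, Good s ∧ Relation.ReflTransGen R s (.inl (c x)) ∧ Relation.ReflTransGen R s (.inr (h x)) := by
      intro x
      obtain ⟨xa, kl, hg⟩ : ∃ xa, v xa = v x ∧ Good (.inl (c xa)) := by
        by_cases k : ∃ xb, v xb = v x ∧ nation (f xb)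
        · obtain ⟨xb, kg, kh⟩ := k
          obtain ⟨kn, ko, -⟩ := hgr xb kh
          exact ⟨_, ko.trans kg, kn⟩
        · exact ⟨x, rfl, x, rfl, fun kv => absurd kv k⟩
      refine ⟨_, hg, Q.lnk (fun x => Relation.ReflTransGen R (.inl (c xa)) (.inl (c x)) ∧
        Relation.ReflTransGen R (.inl (c xa)) (.inr (h x))) ?_ ?_ xa x kl ⟨.refl, .single ⟨xa, Or.inl ⟨rfl, rfl⟩⟩⟩⟩
      · rintro y ⟨kg, kh⟩
        have : Relation.ReflTransGen R (.inl (c xa)) (.inl (c (ae y))) := by rw [Q.ci]; exact kg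
        exact ⟨this, this.tail ⟨ae y, Or.inl ⟨rfl, rfl⟩⟩⟩
      · rintro y ⟨kg, kh⟩
        have : Relation.ReflTransGen R (.inl (c xa)) (.inr (h (aa y))) := by rw [Q.ke]; exact kh
        exact ⟨this.tail ⟨aa y, Or.inr ⟨rfl, rfl⟩⟩, this⟩
    rintro (y | y)
    · obtain ⟨x, rfl⟩ := Q.sc y
      obtain ⟨s, kg, kh, -⟩ := key x; exact ⟨s, kg, kh⟩
    · obtain ⟨x, rfl⟩ := Q.sh y
      obtain ⟨s, kg, -, kh⟩ := key x; exact ⟨s, kg, kh⟩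
  obtain ⟨_, r, par, hp, -⟩ := wtree R Good (fun _ => 0) hr
  obtain ⟨ν, bu, bv⟩ := wlab Good lab r par fun y hy => (hp y hy).2.2
  have hVR : ∀ y ya, R y ya → Vy y = Vy ya := by
    rintro y ya ⟨x, ⟨rfl, rfl⟩ | ⟨rfl, rfl⟩⟩ <;> rw [ao, bh]
  have hind : ∀ (P : C ⊕ H → Prop), (∀ y, Good y → P y) → (∀ y, ¬ Good y → P (par y) → P y) → ∀ y, P y := by
    intro P kg kh
    suffices ∀ n y, r y < n → P y from fun y => this _ y (Nat.lt_succ_self _)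
    intro n
    induction n with
    | zero => intro y hy; omega
    | succ n ih =>
      intro y hy
      by_cases hg : Good y
      · exact kg y hg
      · exact kh y hg (ih _ (by have := (hp y hg).2.2; omega))
  have kd : ∀ y, (∃ xb, v xb = Vy y ∧ f xb = ν y) ∧ ((∃ xb, v xb = Vy y ∧ nation (f xb)) → nation (ν y)) := by
    refine hind _ ?_ ?_
    · rintro y hg
      have bx := hg
      obtain ⟨x, rfl, hx⟩ := hg
      rw [bu _ bx, hl, ao]
      exact ⟨⟨x, rfl, rfl⟩, fun k => (hx k).1⟩
    · intro y hy ih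
      rw [bv y hy, ← hVR _ _ (hp y hy).1]; exact ih
  refine ⟨ν, ?_, ?_, ?_, ?_⟩
  · rintro x y (rfl | rfl)
    · have := kd (.inl (c x)); rwa [ao] at this
    · have := kd (.inr (h x)); rwa [bh] at this
  · intro x hx
    obtain ⟨kg, kh, kn⟩ := hgr x hx
    exact ⟨_, kh, by rw [bu _ kg, hl, kn]⟩
  · intro S SF kg kh
    refine hind _ ?_ ?_
    · intro y hg
      have bx := hg
      obtain ⟨x, rfl, hx⟩ := hg
      have := bu _ bx
      rw [hl] at this
      rw [this]; exact kg x this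
    · intro y hy ih
      have kf := bv y hy
      rw [kf, ← ih]
      obtain ⟨x, ⟨ko, kq⟩ | ⟨ko, kq⟩⟩ := (hp y hy).1
      · rw [ko, kq]; rw [ko, kq] at kf; exact (kh x kf.symm).symm
      · rw [ko, kq]; rw [ko, kq] at kf; exact kh x kf
  · intro u hu
    set Fu := univ.filter fun x => v x = u with hFu
    have ci : Fu.card ≤ 2 * (Fu.image c).card := by
      refine card_le_mul_card_image _ _ fun y hy => ?_
      obtain ⟨x, rfl⟩ := Q.sc y
      refine (card_le_card (t := {x, ae x}) ?_).trans card_le_two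
      intro z hz
      have := (Q.c_iff x z).1 (mem_filter.1 hz).2.symm
      simpa using this
    have cp : Fu.card ≤ 2 * (Fu.image h).card := by
      refine card_le_mul_card_image _ _ fun y hy => ?_
      obtain ⟨x, rfl⟩ := Q.sh y
      refine (card_le_card (t := {x, aa x}) ?_).trans card_le_two
      intro z hz
      have := (Q.h_iff x z).1 (mem_filter.1 hz).2.symm
      simpa using this
    let Yu : Finset (C ⊕ H) := univ.filter fun y => Vy y = u
    have cj : ((Fu.image c).disjSum (Fu.image h)).card ≤ Yu.card := by
      apply card_le_card
      intro y hy
      rcases mem_disjSum.1 hy with ⟨z, hz, rfl⟩ | ⟨z, hz, rfl⟩ <;>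
        obtain ⟨x, hx, rfl⟩ := mem_image.1 hz <;> simp only [Yu, mem_filter, mem_univ, true_and, ao, bh] <;>
        exact (mem_filter.1 hx).2
    rw [card_disjSum] at cj
    have cq := card_filter_add_card_filter_not (s := Yu) Good
    have c5 : (Yu.filter Good).card ≤ (univ.filter fun n => nation n ∧ ∃ x, v x = u ∧ f x = n).card := by
      have hY : ∀ y ∈ Yu.filter Good, ∃ x, y = .inl (c x) ∧ v x = u ∧ nation (f x) ∧ c x = c (rep u (f x)) := by
        intro y hy
        simp only [Yu, mem_filter, mem_univ, true_and] at hy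
        obtain ⟨kg, x, rfl, hx⟩ := hy
        rw [ao] at kg
        rw [kg] at hx
        exact ⟨x, rfl, kg, hx hu⟩
      refine card_le_card_of_injOn lab ?_ ?_
      · intro y hy
        obtain ⟨x, rfl, kg, kh, -⟩ := hY y hy
        rw [hl]
        simp only [coe_filter, mem_univ, true_and, Set.mem_ofPred_eq]
        exact ⟨kh, x, kg, rfl⟩
      · intro y hy ya ky k
        obtain ⟨x, rfl, kg, kh, kn⟩ := hY y hy
        obtain ⟨xb, rfl, es, cs, gq⟩ := hY ya ky
        rw [hl, hl] at k
        rw [kn, gq, k]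
    have hpf : ∀ y, ∃ x, ¬ Good y → (par y = .inl (c x) ∧ y = .inr (h x)) ∨ (par y = .inr (h x) ∧ y = .inl (c x)) := by
      intro y
      by_cases hy : Good y
      · obtain ⟨x, -⟩ := Q.sv u; exact ⟨x, fun k => absurd hy k⟩
      · obtain ⟨x, hx⟩ := (hp y hy).1; exact ⟨x, fun _ => hx⟩
    choose pf hpf using hpf
    have cm : (Yu.filter fun y => ¬ Good y).card ≤ (Fu.filter fun x => ¬ ν (.inl (c x)) ≠ ν (.inr (h x))).card := by
      refine card_le_card_of_injOn pf ?_ ?_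
      · intro y hy
        simp only [Yu, coe_filter, mem_filter, mem_univ, true_and, Set.mem_ofPred_eq, hFu, not_not] at hy ⊢
        obtain ⟨kg, kh⟩ := hy
        have kf := bv y kh
        rcases hpf y kh with ⟨ko, kq⟩ | ⟨ko, kq⟩
        · rw [← bh, ← ko, ← kq]; exact ⟨kg, kf.symm⟩
        · rw [← ao, ← ko, ← kq]; exact ⟨kg, kf⟩
      · intro y hy ya ky k
        have kh := (mem_filter.1 hy).2
        have cs := (mem_filter.1 ky).2
        have ra := (hp y kh).2.2
        have rb := (hp ya cs).2.2
        have qb := hpf y kh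
        have qd := hpf ya cs
        rw [← k] at qd
        rcases qb with ⟨ko, kq⟩ | ⟨ko, kq⟩ <;> rcases qd with ⟨ct, av⟩ | ⟨ct, av⟩
        · rw [kq, av]
        · rw [ko, ← av] at ra; rw [ct, ← kq] at rb; omega
        · rw [ko, ← av] at ra; rw [ct, ← kq] at rb; omega
        · rw [kq, av]
    have c7 := card_filter_add_card_filter_not (s := Fu) fun x => ν (.inl (c x)) ≠ ν (.inr (h x))
    rw [← filter_filter, ← hFu]
    omega
end FSsec

section Clsec
variable {T EQ V E F : Type} [Fintype T] [Fintype EQ] [Fintype V] [Fintype E] [Fintype F]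

abbrev Na (V E F : Type) := (V ⊕ E) ⊕ F

structure Cl (σ : EQ × Bool ≃ T × Fin 3) (nd : T → Fin 3 → Na V E F) (live : Finset EQ) (g : ℕ)
    (inc : V → F → Prop) (nation : F → Prop) (D : F → ℕ) (root : F) (pr : Na V E F → Na V E F)
    (pe : Na V E F → EQ) (rk : Na V E F → ℕ) (d : ℕ) : Prop where
  P : PreP σ nd live g
  cov : reached nd = univ
  ind : ∀ B : Finset EQ, (∀ e ∈ B, (∃ u n, Jn σ nd e (.inl (.inl u)) n) ∧ ∀ n, n ≠ .inr root → pe n ≠ e) →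
    Ind (lf σ) (rt σ) B
  jn : ∀ n, n ≠ .inr root → Jn σ nd (pe n) n (pr n)
  prF : ∀ n, n ≠ .inr root → ∃ f, pr n = .inr f
  hrk : ∀ n, n ≠ .inr root → rk (pr n) < rk n
  hD : ∀ f, f ≠ root → ∀ fb, pr (.inr f) = .inr fb → D f = D fb + if nation f then 1 else 0
  adjV : ∀ e u n, Jn σ nd e (.inl (.inl u)) n → ∃ f, n = .inr f ∧ inc u f ∧
    ((∃ fb, nation fb ∧ inc u fb) → nation f)
  natV : ∀ u f, nation f → inc u f → ∃ e, Jn σ nd e (.inl (.inl u)) (.inr f)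
  dep : ∀ u f fb, nation f → nation fb → inc u f → inc u fb → D f ≤ D fb + d / 2
  deg : ∀ u, (univ.filter fun n => nation n ∧ inc u n).card ≤ d
end Clsec

section FSsec
variable {Fl V E F C H : Type} [Fintype Fl] [Fintype V] [Fintype E] [Fintype F] [Fintype C] [Fintype H]
variable {af ae aa : Fl → Fl} {v : Fl → V} {e : Fl → E} {f : Fl → F} {c : Fl → C} {h : Fl → H} {g : ℕ}

theorem nodV {Va Ea Fa : Type} {v : Fl → Va} {e : Fl → Ea} {ff fe fd : Fl → Fa} {t : Fl × Fin 3} {i : Fin 3} {u : Va}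
    (hh : nod (fun x => .inl (.inl (v x))) (fun x => .inl (.inr (e x))) (fun x => .inr (ff x)) (fun x => .inr (fe x))
      (fun x => .inr (fd x)) t i = (.inl (.inl u) : Na Va Ea Fa)) : ∃ x, t = (x, 0) ∧ i = 0 ∧ v x = u := by
  obtain ⟨x, j⟩ := t
  fin_cases j <;> fin_cases i <;> simp [nod] at hh
  exact ⟨x, rfl, rfl, hh⟩

theorem fin3s : ∀ i : Fin 3, i + 1 = 0 → i = 2 := by decide

theorem FS.cl (Q : FS af ae aa v e f c h g) (nation : F → Prop) (xa : Fl) (d : ℕ) (hd : 2 ≤ d)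
    (hdeg : ∀ u, (univ.filter fun n => nation n ∧ ∃ x, v x = u ∧ f x = n).card ≤ d) :
    ∃ (EQ : Type) (_ : Fintype EQ) (σ : EQ × Bool ≃ (Fl × Fin 3) × Fin 3) (nd : Fl × Fin 3 → Fin 3 → Na V E F)
      (live : Finset EQ) (D : F → ℕ) (root : F) (pr : Na V E F → Na V E F) (pe : Na V E F → EQ) (rk : Na V E F → ℕ),
      Cl σ nd live g (fun u n => ∃ x, v x = u ∧ f x = n) nation D root pr pe rk d := by
  obtain ⟨EQ, _, σ, hσ, Pd, gr⟩ := Q.ex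
  obtain ⟨ν, bi, cu, gs, gt⟩ := Q.vor nation
  let b : Nb V E F C H → Na V E F := Sum.elim Sum.inl (Sum.elim Sum.inr (fun y => .inr (ν y)))
  obtain ⟨live, -, Pb, -⟩ := Pd.contract b (by
    intro k hk
    have kz : ∀ t i, b (qn v e f c h t i) = b (qn v e f c h t (i+1)) → k (qn v e f c h t i) = k (qn v e f c h t (i+1)) := by
      intro t i hb
      have := hk (side σ t i) (mem_univ _)
      rcases Pd.sa t i with ⟨kd, ke⟩ | ⟨kd, ke⟩
      · rw [← kd, ← ke] at this; exact this hb
      · rw [← kd, ← ke] at this; exact (this hb.symm).symm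
    have kf := gs (fun y => k (.inr (.inr y))) (fun n => k (.inr (.inl n)))
      (fun x hx => kz (x, 2) 1 (congrArg Sum.inr hx))
      (fun x hx => kz (x, 0) 1 (congrArg Sum.inr hx))
    have ki : ∀ x, k x = k (Sum.elim Sum.inl (fun n => .inr (.inl n)) (b x)) := by
      rintro (x | x | x)
      · rfl
      · rfl
      · exact kf x
    intro x y hxy
    rw [ki x, ki y, hxy])
  let nd : Fl × Fin 3 → Fin 3 → Na V E F := nod (fun x => .inl (.inl (v x))) (fun x => .inl (.inr (e x)))
    (fun x => .inr (f x)) (fun x => .inr (ν (.inl (c x)))) (fun x => .inr (ν (.inr (h x))))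
  have hnd : (fun t i => b (qn v e f c h t i)) = nd := by
    funext t i; exact nod_comp _ _ _ _ _ _ _ _
  rw [hnd] at Pb
  have hnV : ∀ t i u, nd t i = .inl (.inl u) → ∃ x, t = (x, 0) ∧ i = 0 ∧ v x = u := fun t i u k => nodV k
  have cov : reached nd = univ := by
    rw [eq_univ_iff_forall]
    intro y
    obtain ⟨ya, rfl⟩ : ∃ ya, b ya = y := by
      rcases y with y | y
      · exact ⟨.inl y, rfl⟩
      · exact ⟨.inr (.inl y), rfl⟩
    have := eq_univ_iff_forall.1 gr ya
    simp only [reached, mem_image, mem_univ, true_and] at this ⊢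
    obtain ⟨p, rfl⟩ := this
    exact ⟨p, (congrFun (congrFun hnd p.1) p.2).symm⟩
  have jside : ∀ t i, Jn σ nd (side σ t i) (nd t i) (nd t (i+1)) := by
    intro t i
    rcases Pb.sa t i with ⟨kd, ke⟩ | ⟨kd, ke⟩
    · exact Or.inl ⟨kd.symm, ke.symm⟩
    · exact Or.inr ⟨ke.symm, kd.symm⟩
  have jinv : ∀ ea x y, Jn σ nd ea x y → ∃ t i, ea = side σ t i ∧ ((nd t i = x ∧ nd t (i+1) = y) ∨ (nd t i = y ∧ nd t (i+1) = x)) := by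
    intro ea x y j
    exact ⟨(σ (ea, false)).1, (σ (ea, false)).2, by simp [side], j⟩
  have jV : ∀ ea u n, Jn σ nd ea (.inl (.inl u)) n → ∃ x, v x = u ∧ ((ea = side σ (x, 0) 0 ∧ n = .inr (ν (.inl (c x)))) ∨
      (ea = side σ (x, 0) 2 ∧ n = .inr (ν (.inr (h x))))) := by
    intro ea u n j
    obtain ⟨t, i, he, ⟨kd, ke⟩ | ⟨kd, ke⟩⟩ := jinv _ _ _ j
    · obtain ⟨x, rfl, rfl, hx⟩ := hnV _ _ _ kd
      exact ⟨x, hx, Or.inl ⟨he, ke.symm⟩⟩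
    · obtain ⟨x, rfl, hi, hx⟩ := hnV _ _ _ ke
      obtain rfl := fin3s i hi
      exact ⟨x, hx, Or.inr ⟨he, kd.symm⟩⟩
  -- connectivity of faces
  let R : F → F → Prop := fun n nb => n ≠ nb ∧ ∃ ea, Jn σ nd ea (.inr n) (.inr nb)
  have Rt : ∀ t i j n nb, nd t i = .inr n → nd t j = .inr nb → n ≠ nb → R n nb := by
    intro t i j n nb kd ke kf
    exact ⟨kf, Pb.td ⟨i, kd⟩ ⟨j, ke⟩ (fun hh => kf (Sum.inr.inj hh))⟩
  let root := f xa
  have hreach : ∀ n, ∃ s, s = root ∧ Relation.ReflTransGen R s n := by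
    have ext : ∀ t i j n nb, nd t i = .inr n → nd t j = .inr nb → Relation.ReflTransGen R root n → Relation.ReflTransGen R root nb := by
      intro t i j n nb kd ke kf
      by_cases hh : n = nb
      · rw [← hh]; exact kf
      · exact kf.tail (Rt t i j n nb kd ke hh)
    have cf : ∀ x, Relation.ReflTransGen R root (ν (.inl (c x))) → Relation.ReflTransGen R root (f x) := fun x => ext (x, 2) 1 2 _ _ rfl rfl
    have fc : ∀ x, Relation.ReflTransGen R root (f x) → Relation.ReflTransGen R root (ν (.inl (c x))) := fun x => ext (x, 2) 2 1 _ _ rfl rfl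
    have chh : ∀ x, Relation.ReflTransGen R root (ν (.inl (c x))) → Relation.ReflTransGen R root (ν (.inr (h x))) := fun x => ext (x, 0) 1 2 _ _ rfl rfl
    have hc : ∀ x, Relation.ReflTransGen R root (ν (.inr (h x))) → Relation.ReflTransGen R root (ν (.inl (c x))) := fun x => ext (x, 0) 2 1 _ _ rfl rfl
    intro n
    obtain ⟨x, rfl⟩ := Q.sf n
    refine ⟨root, rfl, ?_⟩
    refine Q.con (fun x => Relation.ReflTransGen R root (f x)) ?_ ?_ ?_ xa x .refl
    · intro x hx; rw [Q.fg]; exact hx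
    · intro x hx; rw [Q.ff]; exact hx
    · intro x hx
      have := chh x (fc x hx)
      rw [← Q.ke] at this
      exact cf _ (hc _ this)
  obtain ⟨D, r, par, hp, hDR⟩ := wtree R (fun n => n = root) (fun n => if nation n then 1 else 0) hreach
  have hE : ∀ n, ∃ ea, n ≠ root → Jn σ nd ea (.inr n) (.inr (par n)) := by
    intro n
    by_cases hn : n = root
    · exact ⟨side σ (xa, 0) 0, fun k => absurd hn k⟩
    · obtain ⟨-, ea, j⟩ := (hp n hn).1; exact ⟨ea, fun _ => j.symm⟩
  choose ep hep using hE
  let rv : V → Fl := Function.surjInv Q.sv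
  have hrv : ∀ y, v (rv y) = y := Function.surjInv_eq Q.sv
  let re : E → Fl := Function.surjInv Q.se
  have hre : ∀ y, e (re y) = y := Function.surjInv_eq Q.se
  let pf : Na V E F → F := Sum.elim (Sum.elim (fun u => ν (.inl (c (rv u)))) (fun u => ν (.inr (h (re u))))) par
  let pe : Na V E F → EQ := Sum.elim (Sum.elim (fun u => side σ (rv u, 0) 0) (fun u => side σ (re u, 1) 0)) ep
  let rk : Na V E F → ℕ := Sum.elim (fun y => r (pf (.inl y)) + 1) r
  refine ⟨EQ, inferInstance, σ, nd, live, D, root, fun n => .inr (pf n), pe, rk, ⟨Pb, cov, ?_, ?_, fun n _ => ⟨_, rfl⟩, ?_, ?_, ?_, ?_, ?_, fun u => (le_of_eq (by congr)).trans (hdeg u)⟩⟩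
  · intro B hB z hz hcyc
    have tri : ∀ t, ∑ i, z (side σ t i) = 0 := by
      intro t
      have := exchange (σ := σ) (fun ta => if ta = t then 1 else 0) z
      have km : _ = (0 : K) := hcyc (fun ta => if ta = t then 1 else 0)
      have := this.trans km
      simpa using this
    have mid : ∀ x, z (side σ (x, 0) 1) = 0 := by
      intro x
      apply hz
      intro hx
      obtain ⟨⟨u, n, j⟩, -⟩ := hB _ hx
      have jd := jside (x, 0) 1
      have qb : nd (x, 0) 1 = .inr (ν (.inl (c x))) := rfl
      have qd : nd (x, 0) (1 + 1) = .inr (ν (.inr (h x))) := rfl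
      rw [qb, qd] at jd
      rcases j with ⟨j, -⟩ | ⟨-, j⟩ <;> rcases jd with ⟨kg, kh⟩ | ⟨kg, kh⟩ <;>
        first | exact Sum.inl_ne_inr (j.symm.trans kg) | exact Sum.inl_ne_inr (j.symm.trans kh)
    have zg : ∀ x, z (side σ (x, 0) 0) = 0 ↔ z (side σ (x, 0) 2) = 0 := by
      intro x
      have := tri (x, 0)
      rw [Fin.sum_univ_three, mid, add_zero] at this
      rw [Kb this]
    have zv : ∀ x, z (side σ (x, 0) 0) = 0 := by
      intro x
      refine Q.lnk (fun x => z (side σ (x, 0) 0) = 0) ?_ ?_ (rv (v x)) x (hrv _) ?_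
      · intro y hy; rw [← hy]; exact congrArg z (hσ ((y, 0), 0))
      · intro y hy
        rw [zg] at hy ⊢
        rw [← hy]; exact congrArg z (hσ ((y, 0), 2))
      · apply hz
        intro hx
        exact (hB _ hx).2 (.inl (.inl (v x))) (by simp) rfl
    funext ea
    by_cases he : ea ∈ B
    · obtain ⟨⟨u, n, j⟩, -⟩ := hB _ he
      obtain ⟨x, -, ⟨rfl, -⟩ | ⟨rfl, -⟩⟩ := jV _ _ _ j
      · exact zv x
      · exact (zg x).1 (zv x)
    · exact hz _ he
  · rintro ((u | u) | n) hn
    · have := jside (rv u, 0) 0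
      have qb : nd (rv u, 0) 0 = .inl (.inl u) := congrArg (fun y => Sum.inl (Sum.inl y)) (hrv u)
      rw [qb] at this
      exact this
    · have := jside (re u, 1) 0
      have qb : nd (re u, 1) 0 = .inl (.inr u) := congrArg (fun y => Sum.inl (Sum.inr y)) (hre u)
      rw [qb] at this
      exact this
    · exact hep n (fun hh => hn (by rw [hh]))
  · rintro (y | n) hn
    · exact Nat.lt_succ_self _
    · exact (hp n (fun hh => hn (by rw [hh]))).2.2
  · intro n hn nb ku
    rw [← Sum.inr.inj ku]
    exact (hp n hn).2.1
  · intro ea u n j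
    obtain ⟨x, hx, ⟨-, rfl⟩ | ⟨-, rfl⟩⟩ := jV _ _ _ j
    · obtain ⟨kg, kh⟩ := bi x _ (Or.inl rfl)
      rw [hx] at kg kh
      exact ⟨_, rfl, kg, fun ⟨nb, kn, xb, ko, kq⟩ => kh ⟨xb, ko, by rw [kq]; exact kn⟩⟩
    · obtain ⟨kg, kh⟩ := bi x _ (Or.inr rfl)
      rw [hx] at kg kh
      exact ⟨_, rfl, kg, fun ⟨nb, kn, xb, ko, kq⟩ => kh ⟨xb, ko, by rw [kq]; exact kn⟩⟩
  · rintro u n hn ⟨x, rfl, rfl⟩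
    obtain ⟨xb, kg, kh⟩ := cu x hn
    refine ⟨side σ (xb, 0) 0, ?_⟩
    rw [← kg, ← kh]
    exact jside (xb, 0) 0
  · rintro u n nb hn ku ⟨x, hx, rfl⟩ ⟨y, hy, rfl⟩
    obtain ⟨xb, kg, kh⟩ := cu x hn
    obtain ⟨ya, kn, ko⟩ := cu y ku
    have hnat : ∃ xb, v xb = u ∧ nation (f xb) := ⟨x, hx, hn⟩
    have := Q.depth u (fun y => D (ν y)) (univ.filter fun x => v x = u ∧ ν (.inl (c x)) ≠ ν (.inr (h x))) (by
      intro w hw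
      have ng := (bi w _ (Or.inl rfl)).2 (by rw [hw]; exact hnat)
      have nj := (bi w _ (Or.inr rfl)).2 (by rw [hw]; exact hnat)
      by_cases hh : ν (.inl (c w)) = ν (.inr (h w))
      · simp only [hh]; omega
      · have ra := hDR _ _ (Rt (w, 0) 1 2 _ _ rfl rfl hh)
        have rb := hDR _ _ (Rt (w, 0) 2 1 _ _ rfl rfl (Ne.symm hh))
        simp only [ng, nj, if_true] at ra rb
        exact ⟨rb, ra⟩) (by
      intro w hw hne
      simp only [mem_filter, mem_univ, true_and]
      exact ⟨hw, fun hh => hne (by simp only [hh])⟩) xb ya (kg.trans hx) (kn.trans hy)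
    have kp := (this.trans (gt u hnat)).trans (hdeg u)
    simp only [kh, ko] at kp
    omega
end FSsec

section Clsec
variable {T EQ V E F : Type} [Fintype T] [Fintype EQ] [Fintype V] [Fintype E] [Fintype F]
variable {σ : EQ × Bool ≃ T × Fin 3} {nd : T → Fin 3 → Na V E F} {live : Finset EQ} {g : ℕ}
    {inc : V → F → Prop} {nation : F → Prop} {D : F → ℕ} {root : F} {pr : Na V E F → Na V E F}
    {pe : Na V E F → EQ} {rk : Na V E F → ℕ} {d : ℕ}

theorem Cl.anc_le (S : Cl σ nd live g inc nation D root pr pe rk d) {n : Na V E F} {fb : F}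
    (h : Anc (.inr root) pr n (.inr fb)) : ∀ f, n = .inr f → D fb ≤ D f := by
  induction h using Relation.ReflTransGen.head_induction_on with
  | refl => intro f hf; rw [Sum.inr.inj hf]
  | head kd ke ih =>
    intro f hf
    obtain ⟨kg, kh⟩ := kd
    obtain ⟨fe, aj⟩ := S.prF _ kg
    have := ih fe (kh.symm.trans aj)
    subst hf
    have := S.hD f (fun hh => kg (by rw [hh])) fe aj
    omega

theorem Cl.ez (S : Cl σ nd live g inc nation D root pr pe rk d) {f fb : F}
    (h : Anc (.inr root) pr (.inr f) (.inr fb)) (hn : nation f) (hne : f ≠ fb) : D fb < D f := by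
  rcases Relation.ReflTransGen.cases_head h with h | ⟨b, ⟨kg, kh⟩, h⟩
  · exact absurd (Sum.inr.inj h) hne
  · obtain ⟨fe, aj⟩ := S.prF _ kg
    have kd := S.anc_le h fe (kh.symm.trans aj)
    have ke := S.hD f (fun hh => kg (by rw [hh])) fe aj
    rw [if_pos hn] at ke
    omega

theorem Cl.dj (S : Cl σ nd live g inc nation D root pr pe rk d) (n : Na V E F) (l q : ℕ) (hq : 1 ≤ q) :
    (univ.filter fun f => Anc (.inr root) pr n (.inr f) ∧ nation f ∧ D f / q = l).card ≤ q := by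
  have : (Ico (l * q) (l * q + q)).card = q := by simp
  refine le_trans (card_le_card_of_injOn (t := Ico (l * q) (l * q + q)) D ?_ ?_) this.le
  · intro f hf
    have hf := (mem_filter.1 hf).2.2.2
    have kd := Nat.div_add_mod (D f) q
    have ke := Nat.mod_lt (D f) hq
    rw [hf, mul_comm] at kd
    rw [coe_Ico]
    exact ⟨by omega, by omega⟩
  · intro f hf fb cv hD
    obtain ⟨kd, ke, -⟩ := (mem_filter.1 hf).2
    obtain ⟨gu, gv, -⟩ := (mem_filter.1 cv).2
    by_contra hne
    rcases Relation.ReflTransGen.total_of_right_unique (fun a b c h kj => h.2.symm.trans kj.2) kd gu with h | h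
    · have := S.ez h ke hne; omega
    · have := S.ez h gv (Ne.symm hne); omega

theorem Cl.anc_root (S : Cl σ nd live g inc nation D root pr pe rk d) (n : Na V E F) :
    Anc (.inr root) pr n (.inr root) := by
  suffices ∀ k n, rk n < k → Anc (.inr root) pr n (.inr root) from this _ n (Nat.lt_succ_self _)
  intro k
  induction k with
  | zero => intro n h; omega
  | succ k ih =>
    intro n h
    by_cases hn : n = .inr root
    · rw [hn]; exact .refl
    · exact .head ⟨hn, rfl⟩ (ih _ (by have := S.hrk n hn; omega))

theorem Cl.fl (S : Cl σ nd live g inc nation D root pr pe rk d) {n : Na V E F} {u : V}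
    (h : Anc (.inr root) pr n (.inl (.inl u))) : n = .inl (.inl u) := by
  rcases Relation.ReflTransGen.cases_tail h with h | ⟨b, -, kg, kh⟩
  · exact h.symm
  · obtain ⟨f, hf⟩ := S.prF _ kg
    rw [kh] at hf; cases hf

theorem mfu {α : Type} {i : Fintype α} {p : α → Prop} {ib : DecidablePred p} {a : α} :
    a ∈ @Finset.filter α p ib (@univ α i) ↔ p a := by simp

theorem Cl.fin (S : Cl σ nd live g inc nation D root pr pe rk d) (hd : 3 ≤ d) (tc : T) :
    ∃ (m : ℕ) (H : SimpleGraph (Fin m)) (p : F → Fin m), IsPlanar H ∧ TreewidthLE H 3 ∧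
      (∀ i l, (univ.filter fun n => p n = i ∧ nation n ∧ D n / (d / 2) = l).card ≤
        max (2 * g * (d / 2)) (d + 3 * (d / 2) - 3)) ∧
      ∀ u n nb, nation n → nation nb → inc u n → inc u nb → p n = p nb ∨ H.Adj (p n) (p nb) := by
  have hq : 1 ≤ d / 2 := by omega
  set q := d / 2 with hqd
  have pne : ∀ n, n ≠ .inr root → n ≠ pr n := fun n hn h => by
    have := S.hrk n hn; rw [← h] at this; omega
  set B := live.filter fun e => (∃ u n, Jn σ nd e (.inl (.inl u)) n) ∧ ∀ n, n ≠ .inr root → pe n ≠ e with hB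
  obtain ⟨X, hXl, hXg, hXB, hXp, hcut⟩ := S.P.genus_cut S.cov tc (root := .inr root) (rk := rk)
    (fun n hn => S.P.jh (S.jn n hn) (pne n hn)) (fun n hn => S.jn n hn) S.hrk B (filter_subset _ _)
    (fun e he => (mem_filter.1 he).2.2) (S.ind B fun e he => (mem_filter.1 he).2)
  have hXV : ∀ e ∈ X, ∀ u n, ¬ Jn σ nd e (.inl (.inl u)) n := by
    intro e he u n j
    refine disjoint_left.1 hXB he (mem_filter.2 ⟨hXl he, ⟨u, n, j⟩, fun n hn h => hXp n hn (h ▸ he)⟩)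
  set Z : Finset (Na V E F) := univ.filter fun a => a = .inr root ∨
    ∃ e ∈ X, Anc (.inr root) pr (src σ nd e) a ∨ Anc (.inr root) pr (tgt σ nd e) a with hZ
  have hrZ : .inr root ∈ Z := by simp [hZ]
  have hZV : ∀ u, (.inl (.inl u) : Na V E F) ∉ Z := by
    intro u hu
    rcases (mem_filter.1 hu).2 with h | ⟨e, he, h | h⟩
    · cases h
    · exact hXV e he u _ (Or.inl ⟨S.fl h, rfl⟩)
    · exact hXV e he u _ (Or.inr ⟨rfl, S.fl h⟩)
  let W := {x : Na V E F // x ∉ Z ∨ x = .inr root}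
  let z : W := ⟨.inr root, Or.inr rfl⟩
  let b : Na V E F → W := fun x => if h : x ∈ Z then z else ⟨x, Or.inl h⟩
  have bZ : ∀ x, x ∈ Z → b x = z := fun x hx => dif_pos hx
  have bN : ∀ x (hx : x ∉ Z), b x = ⟨x, Or.inl hx⟩ := fun x hx => dif_neg hx
  have bz : ∀ x, b x = z → x ∈ Z := by
    intro x hx
    by_contra h
    rw [bN x h] at hx
    exact h (by rw [show x = .inr root from congrArg Subtype.val hx]; exact hrZ)
  have bw : ∀ w : W, b w.1 = w := by
    rintro ⟨w, h⟩
    by_cases hw : w ∈ Z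
    · rw [bZ _ hw]
      rcases h with h | h
      · exact absurd hw h
      · exact Subtype.ext h.symm
    · exact bN _ hw
  have bval : ∀ x, b x ≠ z → (b x).1 = x := by
    intro x hx
    have : x ∉ Z := fun h => hx (bZ x h)
    rw [bN x this]
  have bV : ∀ x u, (b x).1 = .inl (.inl u) → x = .inl (.inl u) := by
    intro x u hx
    rw [bval] at hx
    · exact hx
    · intro h; rw [h] at hx; cases hx
  have Pa := hcut Z b hrZ (by
      intro n hn hnr
      rcases (mem_filter.1 hn).2 with h | ⟨e, he, h⟩
      · exact absurd h hnr
      · exact mem_filter.2 ⟨mem_univ _, Or.inr ⟨e, he, h.imp (fun h => h.tail ⟨hnr, rfl⟩) (fun h => h.tail ⟨hnr, rfl⟩)⟩⟩)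
    (fun e he => ⟨mem_filter.2 ⟨mem_univ _, Or.inr ⟨e, he, Or.inl .refl⟩⟩,
      mem_filter.2 ⟨mem_univ _, Or.inr ⟨e, he, Or.inr .refl⟩⟩⟩)
    (fun x hx y hy => by rw [bZ x hx, bZ y hy]) (by
      have hcW : ∀ inst : DecidableEq W, (@Finset.image _ _ inst b univ).card = Fintype.card W := fun inst => by
        rw [image_univ_of_surjective (fun w => ⟨w.1, bw w⟩), card_univ]
      rw [hcW, Fintype.card_subtype]
      have kd : (insert (.inr root) (univ \ Z) : Finset (Na V E F)) ⊆ univ.filter (fun x => x ∉ Z ∨ x = .inr root) := by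
        intro x hx
        simp only [mem_insert, mem_sdiff, mem_univ, true_and, mem_filter] at hx ⊢
        tauto
      have ke := card_le_card kd
      rw [card_insert_of_notMem (by simp [hrZ]), card_sdiff_of_subset (subset_univ _), card_univ] at ke
      have := card_le_univ Z
      omega)
  set nl : T → Fin 3 → W := fun t i => b (nd t i) with hnd2
  have Ja : ∀ e x y, Jn σ nd e x y → Jn σ nl e (b x) (b y) := by
    rintro e x y (⟨rfl, rfl⟩ | ⟨rfl, rfl⟩)
    · exact Or.inl ⟨rfl, rfl⟩
    · exact Or.inr ⟨rfl, rfl⟩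
  have J2V : ∀ u (w n : W), w.1 = .inl (.inl u) → (AG σ nl).Adj w n →
      ∃ f, n = b (.inr f) ∧ inc u f ∧ ((∃ fb, nation fb ∧ inc u fb) → nation f) := by
    rintro u w n hw ⟨-, e, j⟩
    obtain ⟨x, jc, hx⟩ : ∃ x, Jn σ nd e (.inl (.inl u)) x ∧ n = b x := by
      rcases j with ⟨jg, jd⟩ | ⟨jg, jd⟩
      · exact ⟨tgt σ nd e, Or.inl ⟨bV _ _ ((congrArg Subtype.val jg).trans hw), rfl⟩, jd.symm⟩
      · exact ⟨src σ nd e, Or.inr ⟨rfl, bV _ _ ((congrArg Subtype.val jd).trans hw)⟩, jg.symm⟩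
    obtain ⟨f, rfl, h⟩ := S.adjV _ _ _ jc
    exact ⟨f, hx, h⟩
  have bF : ∀ f u, (b (.inr f)).1 ≠ .inl (.inl u) := fun f u h => by cases bV _ _ h
  have gw : ∀ n a, Anc z (fun w => b (pr w.1)) n a → a ≠ z → Anc (.inr root) pr n.1 a.1 := by
    intro n a h ha
    induction h using Relation.ReflTransGen.head_induction_on with
    | refl => exact .refl
    | @head n nb kd ke ih =>
      obtain ⟨kg, kh⟩ := kd
      replace kh : b (pr n.1) = nb := kh
      have ku : nb ≠ z := by
        rintro rfl
        rcases Relation.ReflTransGen.cases_head ke with h | ⟨c, ⟨k, -⟩, -⟩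
        · exact ha h.symm
        · exact k rfl
      refine .head ⟨fun h => kg (Subtype.ext h), ?_⟩ ih
      have kn := congrArg Subtype.val kh
      rw [bval _ (by rw [kh]; exact ku)] at kn
      exact kn
  have SY : Sys (AG σ nl) z (fun w => b (pr w.1)) (fun w => if w = z then 0 else rk w.1 + 1)
      (fun w => ∃ u, w.1 = .inl (.inl u)) (fun w => w ≠ z ∧ ∃ f, w.1 = .inr f ∧ nation f)
      (fun w => Sum.elim (fun _ => 0) (fun f => D f / q) w.1) d q := by
    refine ⟨Pa.nq, Pa.nr, Pa.rainbow, ?_, ?_, ?_, ?_, ?_, ?_, ?_, hd, hq⟩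
    · intro n hn
      have hr : n.1 ≠ .inr root := fun h => hn (Subtype.ext h)
      refine ⟨fun h => ?_, pe n.1, ?_⟩
      · have := congrArg Subtype.val h
        rw [bval _ (by rw [← h]; exact hn)] at this
        exact pne _ hr this
      · have := Ja _ _ _ (S.jn n.1 hr)
        rwa [bw] at this
    · intro n hn
      have hr : n.1 ≠ .inr root := fun h => hn (Subtype.ext h)
      simp only [if_neg hn]
      split_ifs with h
      · omega
      · rw [bval _ h]; have := S.hrk _ hr; omega
    · rintro n hn ⟨u, hu⟩
      have hr : n.1 ≠ .inr root := fun h => hn (Subtype.ext h)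
      obtain ⟨f, hf⟩ := S.prF _ hr
      simp only [hf] at hu
      exact bF _ _ hu
    · rintro ⟨u, hu⟩; cases hu
    · rintro w wc ⟨u, hu⟩ ⟨u', kw⟩ ha
      obtain ⟨f, hf, -⟩ := J2V u w wc hu ha
      rw [hf] at kw
      exact bF _ _ kw
    · rintro w ⟨u, hu⟩ ⟨n, hn, hnz, f, hf, hnat⟩
      obtain ⟨ff, kd, ke, kf⟩ := J2V u w n hu hn
      have hff : ff = f := by
        rw [kd, bval _ (by rw [← kd]; exact hnz)] at hf
        exact Sum.inr.inj hf
      subst hff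
      refine le_trans (card_le_card (t := (univ.filter fun n => nation n ∧ inc u n).image fun f => b (.inr f)) ?_)
        (card_image_le.trans (S.deg u))
      intro x hx
      obtain ⟨fe, ki, kp, kx⟩ := J2V u w x hu (mem_filter.1 hx).2
      exact mem_image.2 ⟨fe, mem_filter.2 ⟨mem_univ _, kx ⟨ff, hnat, ke⟩, kp⟩, ki.symm⟩
    · intro n l
      refine le_trans ?_ (S.dj n.1 l q hq)
      refine le_trans (card_le_card (t := (univ.filter fun f => Anc (.inr root) pr n.1 (.inr f) ∧ nation f ∧ D f / q = l).image
        fun f => b (.inr f)) ?_) card_image_le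
      intro a ha
      obtain ⟨kd, ⟨ke, f, kf, ki⟩, kp⟩ := mfu.1 ha
      have kx := gw n a kd ke
      rw [kf] at kx kp
      exact mem_image.2 ⟨f, mem_filter.2 ⟨mem_univ _, kx, ki, kp⟩, by rw [← kf]; exact bw a⟩
  obtain ⟨m, H, p, kd, ke, kf, ki, kp⟩ := SY.out
  refine ⟨m, H, fun f => p (b (.inr f)), kd, ke, ?_, ?_⟩
  · intro i l
    by_cases hi : i = p z
    · subst hi
      have hsub : ∀ f, p (b (.inr f)) = p z → (.inr f : Na V E F) ∈ Z := fun f hf => bz _ (kf _ hf)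
      by_cases hX : X = ∅
      · refine le_trans (card_le_card (t := {root}) ?_) ?_
        · intro f hf
          have := (mem_filter.1 (hsub f (mem_filter.1 hf).2.1)).2
          rw [hX] at this
          simpa using this
        · rw [card_singleton]; refine le_max_of_le_right ?_; omega
      · obtain ⟨eg, gx⟩ := nonempty_iff_ne_empty.2 hX
        let A : Na V E F → Finset F := fun n => univ.filter fun f => Anc (.inr root) pr n (.inr f) ∧ nation f ∧ D f / q = l
        refine le_trans (card_le_card (t := X.biUnion fun e => A (src σ nd e) ∪ A (tgt σ nd e)) ?_) ?_
        · intro f hf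
          obtain ⟨kg, kh⟩ := (mem_filter.1 hf).2
          rcases (mem_filter.1 (hsub f kg)).2 with h | ⟨e, he, h⟩
          · rw [Sum.inr.inj h] at kh ⊢
            exact mem_biUnion.2 ⟨eg, gx, mem_union_left _ (mem_filter.2 ⟨mem_univ _, S.anc_root _, kh⟩)⟩
          · refine mem_biUnion.2 ⟨e, he, ?_⟩
            rw [mem_union]
            exact h.imp (fun h => mem_filter.2 ⟨mem_univ _, h, kh⟩) (fun h => mem_filter.2 ⟨mem_univ _, h, kh⟩)
        · refine le_max_of_le_left (le_trans (card_biUnion_le_card_mul _ _ (2 * q) fun e _ => ?_) ?_)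
          · refine (card_union_le _ _).trans ?_
            have kg := S.dj (src σ nd e) l q hq
            have kh := S.dj (tgt σ nd e) l q hq
            show (A _).card + (A _).card ≤ _
            simp only [A]
            omega
          · calc X.card * (2 * q) ≤ g * (2 * q) := Nat.mul_le_mul_right _ hXg
              _ = 2 * g * q := by ring
    · refine le_max_of_le_right (le_trans ?_ (ki i hi l))
      have hbz : ∀ f, p (b (.inr f)) = i → b (.inr f) ≠ z := fun f h kj => hi (by rw [← h, kj])
      refine card_le_card_of_injOn (fun f => b (.inr f)) ?_ ?_
      · intro f hf
        obtain ⟨kg, kh, kn⟩ := (mem_filter.1 hf).2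
        refine mfu.2 ⟨kg, ⟨hbz f kg, f, bval _ (hbz f kg), kh⟩, ?_⟩
        simp only [bval _ (hbz f kg)]
        exact kn
      · intro f hf fb cv h
        have kg := hbz f (mem_filter.1 hf).2.1
        have es := hbz fb (mem_filter.1 cv).2.1
        have := congrArg Subtype.val h
        simp only [bval _ kg, bval _ es] at this
        exact Sum.inr.inj this
  · intro u n nb hn ku hi kt
    have key : ∀ n, nation n → inc u n → (AG σ nl).Adj (b (.inl (.inl u))) (b (.inr n)) := by
      intro n hn hi
      obtain ⟨e, j⟩ := S.natV u n hn hi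
      exact ⟨fun h => bF n u (by rw [← h, bN _ (hZV u)]), e, Ja _ _ _ j⟩
    exact kp _ ⟨u, by rw [bN _ (hZV u)]⟩ _ _ (key n hn hi) (key nb ku kt)
end Clsec

theorem bnot : ∀ a b : Bool, ¬ a = b → b = !a := by decide

theorem mkFS {V E F P : Type} [Fintype V] [Fintype E] [Fintype F] [Fintype P] (g : ℕ) (ends : E → Sym2 V)
    (hl : ∀ e, ¬ (ends e).IsDiag) (nx : P ≃ P) (vt : P → V) (ed : P → E) (fa : P → F) (oth : P → P)
    (hA : ∀ p, ends (ed p) = s(vt p, vt (nx p))) (hf : ∀ p, fa (nx p) = fa p)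
    (od : ∀ p, oth (oth p) = p) (og : ∀ p, oth p ≠ p) (ob : ∀ p q, ed p = ed q ↔ q = p ∨ q = oth p)
    (se : Function.Surjective ed) (sf : Function.Surjective fa)
    (lk : ∀ S : P → Prop, (∀ p pa c cb, vt c = vt cb → ed p = ed pa → p ≠ pa → (c = p ∨ c = nx p) →
      (cb = pa ∨ cb = nx pa) → S c → S cb) → ∀ c cb, vt c = vt cb → S c → S cb)
    (cn : ∀ S : V → Prop, (∀ e u w, ends e = s(u, w) → S u → S w) → ∀ u w, S u → S w) (pb : P)
    (cg : Fintype.card E + 2 ≤ Fintype.card V + Fintype.card F + g) :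
    ∃ (H : Type) (_ : Fintype H) (af ae aa : P × Bool → P × Bool) (v : P × Bool → V) (e : P × Bool → E)
      (f : P × Bool → F) (c : P × Bool → P) (h : P × Bool → H), FS af ae aa v e f c h g ∧
      ∀ u n, (∃ x, v x = u ∧ f x = n) ↔ ∃ p, vt p = u ∧ fa p = n := by
  let cor : P × Bool → P := fun x => bif x.2 then nx x.1 else x.1
  let af : P × Bool → P × Bool := fun x => (x.1, !x.2)
  let ae : P × Bool → P × Bool := fun x => bif x.2 then (nx x.1, false) else (nx.symm x.1, true)
  let aa : P × Bool → P × Bool := fun x => (oth x.1, if vt x.1 = vt (oth x.1) then x.2 else !x.2)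
  have hne : ∀ p, vt p ≠ vt (nx p) := fun p h => hl (ed p) (by rw [hA, h]; exact rfl)
  have oe : ∀ p, ed (oth p) = ed p := fun p => ((ob p (oth p)).2 (Or.inr rfl)).symm
  have hs : ∀ p, s(vt (oth p), vt (nx (oth p))) = s(vt p, vt (nx p)) := fun p => by rw [← hA, ← hA, oe]
  have binj : ∀ q b ba, vt (cor (q, b)) = vt (cor (q, ba)) → b = ba := by
    intro q b ba h
    cases b <;> cases ba
    · rfl
    · exact absurd h (hne q)
    · exact absurd h.symm (hne q)
    · rfl
  have ie : ∀ x, aa (aa x) = x := by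
    rintro ⟨p, b⟩
    by_cases h : vt p = vt (oth p)
    · simp [aa, od, h]
    · simp [aa, od, h, Ne.symm h]
  have nj : ∀ x, aa x ≠ x := fun x h => og x.1 (congrArg Prod.fst h)
  have va : ∀ x, vt (cor (aa x)) = vt (cor x) := by
    rintro ⟨p, b⟩
    have k := hs p
    have kg := hne p
    rw [Sym2.eq_iff] at k
    by_cases h : vt p = vt (oth p)
    · have : vt (nx (oth p)) = vt (nx p) := by
        rcases k with k | k
        · exact k.2
        · exact absurd (h.trans k.1) kg
      cases b <;> simp [aa, cor, ← h, this]
    · have k : vt (oth p) = vt (nx p) ∧ vt (nx (oth p)) = vt p := by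
        rcases k with k | k
        · exact absurd k.1.symm h
        · exact k
      cases b <;> simp [aa, cor, k.1, k.2, kg]
  have ig : ∀ x, ae (ae x) = x := by rintro ⟨p, b⟩; cases b <;> simp [ae]
  have c_iff : ∀ x y, cor x = cor y ↔ y = x ∨ y = ae x := by
    rintro ⟨p, b⟩ ⟨q, ba⟩
    cases b <;> cases ba <;> simp [cor, ae, eq_comm, Equiv.eq_symm_apply, Equiv.symm_apply_eq]
  have vc : ∀ x, vt (cor (ae x)) = vt (cor x) := fun x => by rw [(c_iff x (ae x)).2 (Or.inr rfl)]
  have lnk : ∀ (S : P × Bool → Prop), (∀ x, S x → S (ae x)) → (∀ x, S x → S (aa x)) →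
      ∀ x y, vt (cor x) = vt (cor y) → S x → S y := by
    intro S kd ke x y hxy hx
    have up : ∀ x, S x → ∀ y, cor y = cor x → S y := by
      intro x hx y h
      rcases (c_iff x y).1 h.symm with rfl | rfl
      · exact hx
      · exact kd _ hx
    refine lk (fun c => ∀ y, cor y = c → S y) ?_ _ _ hxy (up x hx) y rfl
    intro p pa c cb hc hp hpp kf ki hS
    have gy : pa = oth p := ((ob p pa).1 hp).resolve_left (Ne.symm hpp)
    obtain ⟨b, hb⟩ : ∃ b, c = cor (p, b) := by
      rcases kf with h | h
      · exact ⟨false, h⟩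
      · exact ⟨true, h⟩
    obtain ⟨ba, am⟩ : ∃ b, cb = cor (pa, b) := by
      rcases ki with h | h
      · exact ⟨false, h⟩
      · exact ⟨true, h⟩
    have : aa (p, b) = (pa, ba) := by
      have k := va (p, b)
      rw [← hb, hc, am] at k
      subst gy
      generalize hz : aa (p, b) = z at k
      have et : z.1 = oth p := by rw [← hz]
      obtain ⟨zd, ze⟩ := z
      simp only at et
      subst et
      rw [binj _ _ _ k]
    rw [am]
    refine up _ ?_
    rw [← this]
    exact ke _ (hS _ hb.symm)
  obtain ⟨H, _, σ, hσ⟩ := invol aa ie nj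
  have st : ∀ e u w, ends e = s(u, w) → ∃ x, vt (cor x) = u ∧ vt (cor (af x)) = w := by
    intro e u w h
    obtain ⟨p, rfl⟩ := se e
    rw [hA, Sym2.eq_iff] at h
    rcases h with h | h
    · exact ⟨(p, false), h⟩
    · exact ⟨(p, true), h.2, h.1⟩
  have gz : Fintype.card P = 2 * Fintype.card E := by
    have := card_eq_sum_card_fiberwise (s := (univ : Finset P)) (t := (univ : Finset E)) (f := ed) (fun x _ => mem_univ _)
    rw [card_univ] at this
    rw [this, sum_congr rfl (fun e _ => show _ = 2 from ?_)]
    · simp [mul_comm]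
    · obtain ⟨p, rfl⟩ := se e
      rw [show (univ.filter fun q => ed q = ed p) = {p, oth p} from ?_, card_pair (og p).symm]
      ext q
      simp only [mem_filter, mem_univ, true_and, mem_insert, mem_singleton]
      rw [eq_comm, ob]
  refine ⟨H, inferInstance, af, ae, aa, fun x => vt (cor x), fun x => ed x.1, fun x => fa x.1, cor, fun x => (σ.symm x).1, ?_, ?_⟩
  · refine ⟨fun x => by simp [af], ig, ie, fun x h => ?_, ?_, nj, vc, va, fun x => rfl, fun x => oe _, fun x => rfl, ?_,
      c_iff, ?_, ?_, ?_, ?_, ?_, ?_, lnk, ?_, ?_, ?_, im σ, cg⟩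
    · have := congrArg Prod.snd h
      cases h : x.2 <;> simp [af, h] at this
    · rintro ⟨p, b⟩ h
      cases b <;> simp [ae] at h
    · rintro ⟨p, b⟩
      cases b
      · have := hf (nx.symm p); rw [Equiv.apply_symm_apply] at this; exact this.symm
      · exact hf p
    · intro x y
      have hz : ∀ z, σ (z.1, !z.2) = aa (σ z) := by
        rintro ⟨z, b⟩
        cases b
        · exact hσ z
        · show σ (z, false) = _
          rw [hσ, ie]
      constructor
      · intro h
        by_cases hb : (σ.symm x).2 = (σ.symm y).2
        · left; exact (σ.symm.injective (Prod.ext h hb)).symm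
        · right
          have := hz (σ.symm x)
          rw [Equiv.apply_symm_apply] at this
          rw [← this, ← Equiv.symm_apply_eq]
          refine Prod.ext h.symm ?_
          exact bnot _ _ hb
      · rintro (rfl | rfl)
        · rfl
        · have := hz (σ.symm x)
          rw [Equiv.apply_symm_apply] at this
          show (σ.symm x).1 = (σ.symm (aa x)).1
          rw [← this, Equiv.symm_apply_apply]
    · intro u
      refine cn (fun u => ∃ x, vt (cor x) = u) ?_ _ u ⟨(pb, false), rfl⟩
      intro e u w h _
      obtain ⟨x, -, hx⟩ := st e u w h
      exact ⟨_, hx⟩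
    · intro e; obtain ⟨p, rfl⟩ := se e; exact ⟨(p, false), rfl⟩
    · intro e; obtain ⟨p, rfl⟩ := sf e; exact ⟨(p, false), rfl⟩
    · intro p; exact ⟨(p, false), rfl⟩
    · intro z; exact ⟨σ (z, false), by simp⟩
    · intro S km kd ke x y hx
      refine cn (fun u => ∀ y, vt (cor y) = u → S y) ?_ _ _ (fun y hy => lnk S kd ke x y hy.symm hx) y rfl
      intro e u w h hu y hy
      obtain ⟨x, bt, io⟩ := st e u w h
      exact lnk S kd ke (af x) y (io.trans hy.symm) (km _ (hu _ bt))
    · rw [Fintype.card_prod, gz, Fintype.card_bool]; ring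
    · rw [Fintype.card_prod, Fintype.card_bool]; ring
  · intro u n
    constructor
    · rintro ⟨⟨p, b⟩, kd, ke⟩
      cases b
      · exact ⟨p, kd, ke⟩
      · exact ⟨nx p, kd, (hf p).trans ke⟩
    · rintro ⟨p, kd, ke⟩
      exact ⟨(p, false), kd, ke⟩

theorem toFS {V E F : Type} [Fintype V] [Fintype E] [Fintype F] {Ga : Multigraph V E}
    (hl : ∀ e, ¬ (Ga.ends e).IsDiag) (emb : Ga.Embedding F) (g : ℕ) (hg : emb.eulerGenus ≤ (g : ℤ)) (fg : F) :
    ∃ (Fl C H : Type) (_ : Fintype Fl) (_ : Fintype C) (_ : Fintype H) (af ae aa : Fl → Fl) (v : Fl → V) (e : Fl → E)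
      (f : Fl → F) (c : Fl → C) (h : Fl → H), FS af ae aa v e f c h g ∧ Nonempty Fl ∧
      ∀ u n, (∃ x, v x = u ∧ f x = n) ↔ (emb.boundary n).HasVtx u := by
  set bd := emb.boundary with hbd
  let P := Σ f : F, Fin (bd f).len
  let π : P → F × ℕ := fun p => (p.1, p.2.1)
  have πi : ∀ p q, π p = π q → p = q := by
    rintro ⟨f, i⟩ ⟨fb, j⟩ h
    obtain ⟨kd, ke⟩ := Prod.mk.inj h
    dsimp only at kd
    subst kd
    rw [show i = j from Fin.ext ke]
  have πs : ∀ x : F × ℕ, x.2 < (bd x.1).len → ∃ p, π p = x := fun x hx => ⟨⟨x.1, x.2, hx⟩, rfl⟩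
  have πl : ∀ p, (π p).2 < (bd (π p).1).len := fun p => p.2.2
  let nm : P → P := fun p => ⟨p.1, (p.2.1 + 1) % (bd p.1).len, Nat.mod_lt _ (bd p.1).len_pos⟩
  have nxi : Function.Injective nm := by
    rintro ⟨f, i, hi⟩ ⟨fb, j, hj⟩ h
    have kj := congrArg π h
    obtain ⟨kd, ke⟩ := Prod.mk.inj kj
    dsimp only [nm] at kd ke
    subst kd
    have : i = j := by
      rcases Nat.lt_or_ge (i + 1) (bd f).len with a | a <;> rcases Nat.lt_or_ge (j + 1) (bd f).len with b | b
      · rw [Nat.mod_eq_of_lt a, Nat.mod_eq_of_lt b] at ke; omega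
      · rw [Nat.mod_eq_of_lt a, show j + 1 = (bd f).len by omega, Nat.mod_self] at ke; omega
      · rw [Nat.mod_eq_of_lt b, show i + 1 = (bd f).len by omega, Nat.mod_self] at ke; omega
      · omega
    subst this
    rfl
  let nx : P ≃ P := Equiv.ofBijective nm (Finite.injective_iff_bijective.1 nxi)
  let vt : P → V := fun p => (bd p.1).vtx p.2.1
  let ed : P → E := fun p => (bd p.1).edge p.2.1
  have oex : ∀ p, ∃ q, q ≠ p ∧ ∀ qa, ed p = ed qa ↔ qa = p ∨ qa = q := by
    intro p
    obtain ⟨x, y, hxy, hS⟩ := Set.ncard_eq_two.1 (emb.edge_twice (ed p))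
    have mem : ∀ q, ed p = ed q ↔ π q = x ∨ π q = y := by
      intro q
      have : π q ∈ {p_1 | Multigraph.IsOcc emb.boundary (ed p) p_1} ↔ π q ∈ ({x, y} : Set (F × ℕ)) := by rw [hS]
      exact ⟨fun h => this.1 ⟨πl q, h.symm⟩, fun h => (this.2 h).2.symm⟩
    have key : ∀ x y, x ≠ y → (∀ q, ed p = ed q ↔ π q = x ∨ π q = y) → y ∈ {p_1 | Multigraph.IsOcc emb.boundary (ed p) p_1} →
        π p = x → ∃ q, q ≠ p ∧ ∀ qa, ed p = ed qa ↔ qa = p ∨ qa = q := by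
      rintro x y hxy mem hy rfl
      obtain ⟨q, rfl⟩ := πs y hy.1
      refine ⟨q, fun h => hxy (by rw [h]), fun qa => (mem qa).trans ?_⟩
      exact or_congr ⟨πi _ _, fun h => by rw [h]⟩ ⟨πi _ _, fun h => by rw [h]⟩
    rcases (mem p).1 rfl with h | h
    · exact key x y hxy mem (by rw [hS]; simp) h
    · exact key y x hxy.symm (fun q => (mem q).trans or_comm) (by rw [hS]; simp) h
  choose oth eu cx using oex
  have se : Function.Surjective ed := by
    intro e
    obtain ⟨x, y, hxy, hS⟩ := Set.ncard_eq_two.1 (emb.edge_twice e)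
    have : x ∈ {p | Multigraph.IsOcc emb.boundary e p} := by rw [hS]; simp
    obtain ⟨p, rfl⟩ := πs x this.1
    exact ⟨p, this.2⟩
  have pb : ∀ f, P := fun f => ⟨f, 0, (bd f).len_pos⟩
  obtain ⟨H, i, af, ae, aa, v, e, f, c, h, hFS, hinc⟩ := mkFS g Ga.ends hl nx vt ed (fun p => p.1) oth (by
      rintro ⟨f, i, hi⟩
      show _ = s((bd f).vtx i, (bd f).vtx ((i + 1) % (bd f).len))
      rw [show Ga.ends (ed ⟨f, i, hi⟩) = _ from (bd f).compat i]
      have : (bd f).vtx (i + 1) = (bd f).vtx ((i + 1) % (bd f).len) := by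
        rcases Nat.lt_or_ge (i + 1) (bd f).len with a | a
        · rw [Nat.mod_eq_of_lt a]
        · have kd : i + 1 = (bd f).len := by omega
          rw [kd, Nat.mod_self]
          simpa using (bd f).vtx_per 0
      rw [this]) (fun p => rfl)
    (by
      intro p
      have kd : ed (oth p) = ed p := ((cx p (oth p)).2 (Or.inr rfl)).symm
      exact (((cx _ p).1 kd).resolve_left (eu p).symm).symm) eu cx se
    (fun f => ⟨⟨f, 0, (bd f).len_pos⟩, rfl⟩)
    (by
      intro S hS c cb hcc hc
      have L := emb.link_conn (vt c) (π c) (π cb) ⟨πl c, rfl⟩ ⟨πl cb, hcc.symm⟩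
      have one : ∀ x y, Multigraph.CornerLinked emb.boundary (vt c) x y → (∃ c, π c = x ∧ S c) → ∃ c, π c = y ∧ S c := by
        rintro x y ⟨kd, ke, e, p, pa, hpp, o, oa, he, aq⟩ ⟨c, rfl, hc⟩
        obtain ⟨cb, rfl⟩ := πs y ke.1
        obtain ⟨p, rfl⟩ := πs p o.1
        obtain ⟨pa, rfl⟩ := πs pa oa.1
        have en : ∀ c p, Multigraph.EndOf emb.boundary (π c) (π p) → c = p ∨ c = nx p := by
          rintro c p ⟨kd, ke⟩
          exact ke.imp (fun ke => πi _ _ (Prod.ext kd ke)) (fun ke => πi _ (nx p) (Prod.ext kd ke))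
        exact ⟨cb, rfl, hS p pa c cb (kd.2.trans ke.2.symm) (o.2.trans oa.2.symm) (fun h => hpp (by rw [h]))
          (en _ _ he) (en _ _ aq) hc⟩
      have sy : ∀ x y, Multigraph.CornerLinked emb.boundary (vt c) x y → Multigraph.CornerLinked emb.boundary (vt c) y x := by
        rintro x y ⟨kd, ke, e, p, pa, hpp, o, oa, he, aq⟩
        exact ⟨ke, kd, e, pa, p, hpp.symm, oa, o, aq, he⟩
      have all : ∀ x y, Relation.EqvGen (Multigraph.CornerLinked emb.boundary (vt c)) x y →
          ((∃ c, π c = x ∧ S c) ↔ ∃ c, π c = y ∧ S c) := by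
        intro x y h
        induction h with
        | rel x y h => exact ⟨one x y h, one y x (sy _ _ h)⟩
        | refl x => exact Iff.rfl
        | symm x y _ ih => exact ih.symm
        | trans x y z _ _ kd ke => exact kd.trans ke
      obtain ⟨cp, kd, ke⟩ := (all _ _ L).1 ⟨c, rfl, hc⟩
      rwa [πi _ _ kd] at ke)
    (by
      intro S hS u w hu
      obtain ⟨W⟩ := emb.conn.preconnected u w
      induction W with
      | nil => exact hu
      | cons h W ih =>
        obtain ⟨-, e, he⟩ := h
        exact ih (hS e _ _ he hu)) (pb fg)
    (by
      unfold Multigraph.Embedding.eulerGenus at hg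
      simp only [Nat.card_eq_fintype_card] at hg
      omega)
  refine ⟨P × Bool, P, H, inferInstance, inferInstance, i, af, ae, aa, v, e, f, c, h, hFS, ⟨(pb fg, true)⟩, ?_⟩
  intro u n
  rw [hinc]
  constructor
  · rintro ⟨⟨f, i, hi⟩, kd, rfl⟩
    exact ⟨i, hi, kd⟩
  · rintro ⟨i, hi, h⟩
    exact ⟨⟨n, i, hi⟩, h, rfl⟩

theorem planar_triv : IsPlanar (⊥ : SimpleGraph Empty) := by
  let M : Multigraph Bool Unit := ⟨fun _ => s(false, true)⟩
  let w : M.CWalk := ⟨2, by norm_num, fun i => decide (i % 2 = 1), fun _ => (), fun i => by simp, fun _ => rfl, by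
    intro i
    show s(false, true) = _
    rcases Nat.mod_two_eq_zero_or_one i with h | h
    · simp [h, Nat.add_mod]
    · simp [h, Nat.add_mod, Sym2.eq_swap]⟩
  refine ⟨Bool, Unit, Unit, inferInstance, inferInstance, inferInstance, M, ⟨fun _ => w, ?_, ?_, ?_⟩, ?_, ⟨⟨fun x => x.elim, fun {x} => x.elim⟩, fun x => x.elim⟩⟩
  · have kd : M.simple.Adj false true := ⟨by simp, (), rfl⟩
    refine ⟨fun u v => ?_⟩
    cases u <;> cases v
    · rfl
    · exact kd.reachable
    · exact kd.symm.reachable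
    · rfl
  · intro e
    rw [Set.ncard_eq_two]
    refine ⟨((), 0), ((), 1), by simp, ?_⟩
    ext ⟨u, i⟩
    show (i < 2 ∧ () = e) ↔ _
    simp
    omega
  · rintro v ⟨⟨⟩, i⟩ ⟨⟨⟩, j⟩ ⟨kd, ke⟩ ⟨kf, ki⟩
    have : i = j := by
      change i < 2 at kd
      change j < 2 at kf
      have h := ke.trans ki.symm
      change decide (i % 2 = 1) = decide (j % 2 = 1) at h
      rw [decide_eq_decide] at h
      omega
    subst this
    exact .refl _
  · simp [Multigraph.Embedding.eulerGenus]

theorem tw_triv : TreewidthLE (⊥ : SimpleGraph Empty) 3 :=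
  ⟨Unit, ⊥, fun _ => ∅, ⟨SimpleGraph.Connected.mk (fun _ _ => by rfl), SimpleGraph.isAcyclic_bot⟩, fun v => v.elim, fun v => v.elim,
    fun v => v.elim, fun i => by simp⟩

theorem main_thm (g d : ℕ) (hd : 3 ≤ d)
    {V E F : Type} [Fintype V] [Fintype E] [Fintype F]
    (Ga : Multigraph V E) (hs : Ga.IsSimple) (emb : Ga.Embedding F)
    (hg : emb.eulerGenus ≤ (g : ℤ))
    (nation : F → Prop)
    (hdeg : ∀ v : V, Set.ncard {f : F | nation f ∧ (emb.boundary f).HasVtx v} ≤ d)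
    (M : SimpleGraph {f : F // nation f})
    (hM : ∀ f fb : {f : F // nation f}, M.Adj f fb ↔ f ≠ fb ∧
      ∃ v : V, (emb.boundary f.val).HasVtx v ∧ (emb.boundary fb.val).HasVtx v) :
    ∃ (W : Type) (H : SimpleGraph W) (n : ℕ),
      IsPlanar H ∧ TreewidthLE H 3 ∧
      M.IsContainedIn
        ((H.strongProd (SimpleGraph.pathGraph n)).strongProd
          (SimpleGraph.completeGraph (Fin (max (2 * g * (d / 2)) (d + 3 * (d / 2) - 3))))) := by
  rcases isEmpty_or_nonempty F with hF | ⟨⟨fg⟩⟩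
  · exact ⟨Empty, ⊥, 0, planar_triv, tw_triv, ⟨fun x => hF.elim x.1, fun {x} => hF.elim x.1⟩, fun x => hF.elim x.1⟩
  obtain ⟨Fl, C, H', _, _, _, af, ae, aa, v, e, f, c, h, hFS, ⟨xa⟩, hinc⟩ := toFS hs.1 emb g hg fg
  obtain ⟨EQ, _, σ, nd, live, D, root, pr, pe, rk, hC⟩ := hFS.cl nation xa d (by omega) (by
    intro u
    refine le_trans (le_of_eq ?_) (hdeg u)
    rw [Set.ncard_eq_toFinset_card']
    congr 1
    ext n
    simp [hinc])
  obtain ⟨m, H, p, kd, ke, kf, ki⟩ := hC.fin hd (xa, 0)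
  have hq : 0 < d / 2 := by omega
  set q := d / 2 with hqd
  set ℓ := max (2 * g * q) (d + 3 * q - 3) with hℓ
  let lay : F → ℕ := fun n => D n / q
  let N := (univ.sup lay) + 1
  have hN : ∀ n, lay n < N := fun n => Nat.lt_succ_of_le (le_sup (mem_univ n))
  let Cs : Fin m → ℕ → Finset F := fun i l => univ.filter fun n => p n = i ∧ nation n ∧ lay n = l
  have hCs : ∀ i l, (Cs i l).card ≤ ℓ := fun i l => (le_of_eq (by congr)).trans (kf i l)
  have emx : ∀ i l, ∃ φ : F → Fin ℓ, Set.InjOn φ (Cs i l) := by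
    intro i l
    have hpos : 0 < ℓ := lt_of_lt_of_le (show 0 < d + 3 * q - 3 by omega) (le_max_right _ _)
    let φ := (Cs i l).equivFin
    refine ⟨fun n => if hn : n ∈ Cs i l then Fin.castLE (hCs i l) (φ ⟨n, hn⟩) else ⟨0, hpos⟩, ?_⟩
    intro n hn nb ku hh
    have hn := mem_coe.1 hn
    have ku := mem_coe.1 ku
    simp only [dif_pos hn, dif_pos ku] at hh
    exact congrArg Subtype.val (φ.injective (Fin.castLE_injective _ hh))
  choose φ hφ using emx
  let ψ : {f : F // nation f} → (Fin m × Fin N) × Fin ℓ := fun n => ((p n.1, ⟨lay n.1, hN n.1⟩), φ (p n.1) (lay n.1) n.1)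
  have ψi : Function.Injective ψ := by
    rintro ⟨n, hn⟩ ⟨nb, ku⟩ hh
    obtain ⟨kg, kh⟩ := Prod.mk.inj hh
    obtain ⟨kn, ko⟩ := Prod.mk.inj kg
    have ko : lay n = lay nb := congrArg Fin.val ko
    dsimp only at kh kn
    rw [← kn, ← ko] at kh
    refine Subtype.ext (hφ (p n) (lay n) ?_ ?_ kh)
    · exact mem_coe.2 (mem_filter.2 ⟨mem_univ _, rfl, hn, rfl⟩)
    · exact mem_coe.2 (mem_filter.2 ⟨mem_univ _, kn.symm, ku, ko.symm⟩)
  have hlay : ∀ n nb : {f : F // nation f}, (∃ u, (emb.boundary n.1).HasVtx u ∧ (emb.boundary nb.1).HasVtx u) →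
      lay n.1 ≤ lay nb.1 + 1 := by
    rintro n nb ⟨u, kg, kh⟩
    have := hC.dep u n.1 nb.1 n.2 nb.2 ((hinc _ _).2 kg) ((hinc _ _).2 kh)
    calc lay n.1 ≤ (D nb.1 + q) / q := Nat.div_le_div_right this
      _ = lay nb.1 + 1 := Nat.add_div_right _ hq
  refine ⟨Fin m, H, N, kd, ke, ⟨ψ, fun {n nb} hA => ?_⟩, ψi⟩
  obtain ⟨hne, u, kg, kh⟩ := (hM n nb).1 hA
  have l1 := hlay n nb ⟨u, kg, kh⟩
  have la := hlay nb n ⟨u, kh, kg⟩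
  refine ⟨fun h => hne (ψi h), ?_, ?_⟩
  · by_cases hE : (ψ n).1 = (ψ nb).1
    · exact Or.inl hE
    · refine Or.inr ⟨hE, ki u n.1 nb.1 n.2 nb.2 ((hinc _ _).2 kg) ((hinc _ _).2 kh), ?_⟩
      rcases lt_trichotomy (lay n.1) (lay nb.1) with h | h | h
      · exact Or.inr (SimpleGraph.pathGraph_adj.2 (Or.inl (show lay n.1 + 1 = lay nb.1 by omega)))
      · exact Or.inl (Fin.ext h)
      · exact Or.inr (SimpleGraph.pathGraph_adj.2 (Or.inr (show lay nb.1 + 1 = lay n.1 by omega)))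
  · by_cases hE : (ψ n).2 = (ψ nb).2
    · exact Or.inl hE
    · exact Or.inr hE
end MGP
end

/-- For all integers `g ≥ 0` and `d ≥ 3`, every `(g,d)`-map graph is contained in
`H ⊠ P ⊠ K_ℓ` for some planar graph `H` with treewidth at most 3 and some path `P`,
where `ℓ = max{2g⌊d/2⌋, d + 3⌊d/2⌋ − 3}`. -/
theorem map_graph_product_structure (g d : ℕ) (hd : 3 ≤ d)
    {V E F : Type} [Fintype V] [Fintype E] [Fintype F]
    (G₀ : Multigraph V E) (hs : G₀.IsSimple) (emb : G₀.Embedding F)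
    (hg : emb.eulerGenus ≤ (g : ℤ))
    (nation : F → Prop)
    (hdeg : ∀ v : V, Set.ncard {f : F | nation f ∧ (emb.boundary f).HasVtx v} ≤ d)
    (M : SimpleGraph {f : F // nation f})
    (hM : ∀ f f' : {f : F // nation f}, M.Adj f f' ↔ f ≠ f' ∧
      ∃ v : V, (emb.boundary f.val).HasVtx v ∧ (emb.boundary f'.val).HasVtx v) :
    ∃ (W : Type) (H : SimpleGraph W) (n : ℕ),
      IsPlanar H ∧ TreewidthLE H 3 ∧
      M.IsContainedIn
        ((H.strongProd (SimpleGraph.pathGraph n)).strongProd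
          (SimpleGraph.completeGraph (Fin (max (2 * g * (d / 2)) (d + 3 * (d / 2) - 3))))) := by
  exact MGP.main_thm g d hd G₀ hs emb hg nation hdeg M hM
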